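/- Let F : ℝ → ℝ be a C^∞ function with F(x+1) = F(x) + 1 and F′(x) > 0 for all x ∈ ℝ (a lift of an orientation-preserving C^∞ diffeomorphism of the circle), and let ρ be its rotation number, i.e. the number with lim_{n→∞} F^n(0)/n = ρ. Assume ρ is Diophantine: there exist an integer k ≥ 2 and ε > 0 such that |ρ − p/q| > ε/q^k for every p ∈ ℤ and every integer q ≥ 1. Then F is C^∞-conjugate to the translation by ρ: there exists a C^∞ map H : ℝ → ℝ with H(x+1) = H(x) + 1 and H′(x) > 0 for all x ∈ ℝ, such that H(F(x)) = H(x) + ρ for all x ∈ ℝ. -/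

import Mathlib

open Filter
namespace HY

structure Lift (F : ℝ → ℝ) (ρ : ℝ) : Prop where
  sm : ContDiff ℝ (⊤ : ℕ∞) F
  per : ∀ x : ℝ, F (x + 1) = F x + 1
  pos : ∀ x : ℝ, 0 < deriv F x
  rot : Tendsto (fun n : ℕ => F^[n] 0 / n) atTop (nhds ρ)
  irr : Irrational ρ

section basic
variable {F : ℝ → ℝ} {ρ : ℝ} (h : Lift F ρ)
include h

lemma Lift.mono : StrictMono F := strictMono_of_deriv_pos h.pos

lemma Lift.itmono (n : ℕ) : StrictMono (F^[n]) := h.mono.iterate n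

lemma Lift.itsm (n : ℕ) : ContDiff ℝ (⊤ : ℕ∞) (F^[n]) := by
  induction n with
  | zero => simpa using contDiff_id
  | succ n ih => rw [Function.iterate_succ']; exact h.sm.comp ih

lemma Lift.itdiff (n : ℕ) : Differentiable ℝ (F^[n]) := (h.itsm n).differentiable (by simp)

lemma Lift.exlift : ∃ f : CircleDeg1Lift, (∀ x, f x = F x) ∧ f.translationNumber = ρ := by
  let f : CircleDeg1Lift := ⟨⟨F, h.mono.monotone⟩, h.per⟩
  refine ⟨f, fun x => rfl, ?_⟩
  refine f.translationNumber_eq_of_tendsto₀ ?_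
  have e : (f : ℝ → ℝ) = F := rfl
  simpa [e] using h.rot

lemma Lift.fint (n : ℕ) (x : ℝ) (r : ℤ) : F^[n] (x + r) = F^[n] x + r := by
  obtain ⟨f, hf, -⟩ := h.exlift
  have : F = f := by ext x; rw [hf]
  rw [this, ← CircleDeg1Lift.coe_pow, CircleDeg1Lift.map_add_int]

lemma Lift.fsub (n : ℕ) (x : ℝ) (r : ℤ) : F^[n] (x - r) = F^[n] x - r := by
  have := h.fint n x (-r)
  push_cast at this; simpa [sub_eq_add_neg] using this

lemma Lift.ord0 (c : ℕ) (r : ℤ) (x : ℝ) (hc : 0 < c * ρ + r) : x < F^[c] x + r := by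
  obtain ⟨f, hf, ht⟩ := h.exlift
  have e : F = f := by ext x; rw [hf]
  by_contra hcon
  push Not at hcon
  have := CircleDeg1Lift.translationNumber_le_of_le_add_int (f ^ c) (x := x) (m := -r)
    (by rw [CircleDeg1Lift.coe_pow, ← e]; push_cast; linarith)
  rw [CircleDeg1Lift.translationNumber_pow, ht] at this
  push_cast at this; linarith

lemma Lift.ord0' (c : ℕ) (r : ℤ) (x : ℝ) (hc : c * ρ + r < 0) : F^[c] x + r < x := by
  obtain ⟨f, hf, ht⟩ := h.exlift
  have e : F = f := by ext x; rw [hf]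
  by_contra hcon
  push Not at hcon
  have := CircleDeg1Lift.le_translationNumber_of_add_int_le (f ^ c) (x := x) (m := -r)
    (by rw [CircleDeg1Lift.coe_pow, ← e]; push_cast; linarith)
  rw [CircleDeg1Lift.translationNumber_pow, ht] at this
  push_cast at this; linarith

lemma Lift.ord (a b : ℕ) (r : ℤ) (x : ℝ) (hc : a * ρ < b * ρ + r) :
    F^[a] x < F^[b] x + r := by
  rcases le_total a b with hab | hab
  · obtain ⟨c, rfl⟩ := Nat.exists_eq_add_of_le' hab
    rw [Function.iterate_add_apply]
    apply h.ord0; push_cast at hc; linarith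
  · obtain ⟨c, rfl⟩ := Nat.exists_eq_add_of_le' hab
    rw [Function.iterate_add_apply]
    have := h.ord0' c (-r) (F^[b] x) (by push_cast at hc ⊢; linarith)
    push_cast at this; linarith

lemma Lift.ordle (a b : ℕ) (r : ℤ) (x : ℝ) (hc : a * ρ ≤ b * ρ + r) :
    F^[a] x ≤ F^[b] x + r := by
  rcases hc.lt_or_eq with hc | hc
  · exact (h.ord a b r x hc).le
  · have h1 : ((a : ℤ) - b : ℤ) = 0 := by
      by_contra hne
      have := (h.irr.intCast_mul hne)
      apply this
      refine ⟨r, ?_⟩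
      push_cast; linarith
    have h2 : a = b := by omega
    subst h2
    have : (r : ℝ) = 0 := by linarith
    rw [this]; simp

/-- converse of the order lemma -/
lemma Lift.ordc (a b : ℕ) (r : ℤ) (x : ℝ) (hc : F^[a] x ≤ F^[b] x + r) :
    a * ρ ≤ b * ρ + r := by
  by_contra hcon
  push Not at hcon
  have := h.ord b a (-r) x (by push_cast; linarith)
  push_cast at this; linarith

end basic

/-- `g = F^q - p` -/
def G (F : ℝ → ℝ) (q : ℕ) (p : ℤ) (x : ℝ) : ℝ := F^[q] x - p

structure Pair (ρ : ℝ) (q : ℕ) (p : ℤ) (q' : ℕ) (p' : ℤ) : Prop where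
  q0 : 0 < q
  qq : q ≤ q'
  det : q * p' - q' * p = 1
  a1 : p' - q' * ρ < q * ρ - p
  a0 : 0 < p' - q' * ρ

lemma Pair.best {ρ : ℝ} {q : ℕ} {p : ℤ} {q' : ℕ} {p' : ℤ} (h : Pair ρ q p q' p')
    (j : ℤ) (r : ℤ) (j0 : 0 < j) (j1 : j < q') : q * ρ - p ≤ |j * ρ - r| := by
  obtain ⟨u, hu⟩ : ∃ u : ℤ, u = j * p' - r * q' := ⟨_, rfl⟩
  obtain ⟨v, hv⟩ : ∃ v : ℤ, v = q * r - p * j := ⟨_, rfl⟩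
  have d := h.det
  have ej : j = u * q + v * q' := by rw [hu, hv]; linear_combination (-j) * d
  have er : r = u * p + v * p' := by rw [hu, hv]; linear_combination (-r) * d
  have key : (j * ρ - r : ℝ) = u * (q * ρ - p) - v * (p' - q' * ρ) := by
    rw [ej, er]; push_cast; ring
  rw [key]
  have hq := h.q0
  have hqq := h.qq
  have a0 := h.a0
  have a1 := h.a1
  set A := (q * ρ - p : ℝ)
  set A' := (p' - q' * ρ : ℝ)
  rcases lt_trichotomy u 0 with hu0 | hu0 | hu0
  · have : 0 < v := by
      by_contra hv0
      push Not at hv0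
      nlinarith
    have u1 : (u : ℝ) ≤ -1 := by exact_mod_cast (by omega : u ≤ -1)
    have v1 : (1 : ℝ) ≤ v := by exact_mod_cast this
    rw [abs_of_neg (by nlinarith)]
    nlinarith
  · subst hu0
    exfalso
    simp at ej
    rcases le_or_gt v 0 with h1 | h1
    · nlinarith
    · nlinarith
  · have : v ≤ 0 := by
      by_contra hv0
      push Not at hv0
      nlinarith
    have u1 : (1 : ℝ) ≤ u := by exact_mod_cast hu0
    have v1 : (v : ℝ) ≤ 0 := by exact_mod_cast this
    refine le_trans ?_ (le_abs_self _)
    nlinarith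

section pair
variable {F : ℝ → ℝ} {ρ : ℝ} (h : Lift F ρ) {q : ℕ} {p : ℤ} {q' : ℕ} {p' : ℤ}
  (hp : Pair ρ q p q' p')
include h hp

lemma Pair.g_gt (x : ℝ) : x < G F q p x := by
  have := h.ord0 q (-p) x (by have := hp.a0; have := hp.a1; push_cast; linarith)
  simpa [G, sub_eq_add_neg] using this

lemma Pair.g'_lt (x : ℝ) : G F q' p' x < x := by
  have := h.ord0' q' (-p') x (by have := hp.a0; have := hp.a1; push_cast; linarith)
  simpa [G, sub_eq_add_neg] using this

omit hp in
lemma Lift.G_comm (i : ℕ) (q : ℕ) (p : ℤ) (x : ℝ) : G F q p (F^[i] x) = F^[i] (G F q p x) := by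
  simp only [G]
  rw [h.fsub, ← Function.iterate_add_apply, ← Function.iterate_add_apply, add_comm]

omit hp in
lemma Lift.G_mono (q : ℕ) (p : ℤ) : StrictMono (G F q p) := fun x y hxy => by
  simpa [G] using h.itmono q hxy

/-- B1 -/
lemma Pair.sum_le (x : ℝ) :
    ∑ i ∈ Finset.range q', (G F q p (F^[i] x) - F^[i] x) ≤ 1 := by
  classical
  have a0 := hp.a0
  have a1 := hp.a1
  let f : ℕ → ℤ := fun i => ⌊i * ρ⌋
  let I : ℕ → Set ℝ := fun i => Set.Ioc (F^[i] x - f i) (F^[i + q] x - f i - p)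
  have hbase : ∀ i j : ℕ, i < q' → j < q' → i ≠ j →
      q * ρ - p ≤ |((i * ρ - f i) - (j * ρ - f j))| := by
    intro i j hi hj hij
    rcases lt_or_gt_of_ne hij with hl | hl
    · have := hp.best (j - i) (f j - f i) (by omega) (by omega)
      push_cast at this
      rw [← abs_neg]; convert this using 2; ring
    · have := hp.best (i - j) (f i - f j) (by omega) (by omega)
      push_cast at this
      convert this using 2; ring
  have hd : ∀ i j : ℕ, i < q' → j < q' → (i * ρ - f i) + (q * ρ - p) ≤ (j * ρ - f j) →
      Disjoint (I i) (I j) := by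
    intro i j hi hj hij
    rw [Set.disjoint_left]
    intro y hy hy'
    have := h.ordle (i + q) j (f i - f j + p) x (by push_cast; linarith)
    push_cast at this
    have h1 := hy.2; have h2 := hy'.1
    linarith
  have hdisj : Set.PairwiseDisjoint (↑(Finset.range q')) I := by
    intro i hi j hj hij
    simp at hi hj
    have := hbase i j hi hj hij
    rcases le_abs.mp this with h1 | h1
    · exact (hd j i hj hi (by linarith)).symm
    · exact hd i j hi hj (by linarith)
  have hlen : ∀ i, MeasureTheory.volume (I i) = ENNReal.ofReal (G F q p (F^[i] x) - F^[i] x) := by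
    intro i
    rw [Real.volume_Ioc]; congr 1; simp only [G]
    rw [← Function.iterate_add_apply, add_comm q i]; ring
  have hsub : (⋃ i ∈ Finset.range q', I i) ⊆ Set.Ioc x (x + 1) := by
    intro y hy
    simp only [Set.mem_iUnion, Finset.mem_range] at hy
    obtain ⟨i, hi, hy1, hy2⟩ := hy
    have f1 : (f i : ℝ) ≤ i * ρ := Int.floor_le _
    have f2 : i * ρ < f i + 1 := Int.lt_floor_add_one _
    constructor
    · have := h.ordle 0 i (-(f i)) x (by push_cast; linarith)
      push_cast at this; simp at this; linarith
    · have : (i * ρ - f i) + (q * ρ - p) ≤ 1 := by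
        rcases Nat.eq_zero_or_pos i with h0 | h0
        · subst h0
          have q1 : (1 : ℝ) ≤ q' := by
            have := hp.q0; have := hp.qq; exact_mod_cast (by omega : 1 ≤ q')
          have q2 : (0 : ℝ) < q := by exact_mod_cast hp.q0
          have e : (q' : ℝ) * (q * ρ - p) + q * (p' - q' * ρ) = 1 := by
            have := hp.det
            have : ((q * p' - q' * p : ℤ) : ℝ) = 1 := by rw [this]; simp
            push_cast at this; linarith
          have : (f 0 : ℝ) = 0 := by simp [f]
          rw [this]; simp
          nlinarith
        · have := hp.best i (f i + 1) (by omega) (by omega)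
          push_cast at this
          rw [abs_of_neg (by linarith)] at this
          linarith
      have := h.ordle (i + q) 0 (f i + p + 1) x (by push_cast; linarith)
      push_cast at this; simp at this
      linarith
  have hm : MeasureTheory.volume (⋃ i ∈ Finset.range q', I i)
      = ∑ i ∈ Finset.range q', MeasureTheory.volume (I i) :=
    MeasureTheory.measure_biUnion_finset hdisj (fun i _ => measurableSet_Ioc)
  have hm2 := MeasureTheory.measure_mono (μ := MeasureTheory.volume) hsub
  rw [hm, Finset.sum_congr rfl (fun i _ => hlen i), ← ENNReal.ofReal_sum_of_nonneg
    (fun i _ => by have := hp.g_gt h (F^[i] x); linarith), Real.volume_Ioc] at hm2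
  rw [ENNReal.ofReal_le_ofReal_iff (by linarith)] at hm2
  linarith

end pair
end HY

namespace HY

/-- `ψ_l = log D F^l` -/
noncomputable def psi (F : ℝ → ℝ) (l : ℕ) (x : ℝ) : ℝ := Real.log (deriv (F^[l]) x)

noncomputable def uu (F : ℝ → ℝ) (l : ℕ) : ℝ → ℝ := deriv (psi F l)

noncomputable def SS (F : ℝ → ℝ) (l : ℕ) (x : ℝ) : ℝ := deriv (uu F l) x - uu F l x ^ 2 / 2

section
variable {F : ℝ → ℝ} {ρ : ℝ} (h : Lift F ρ)
include h

lemma Lift.dadd (a b : ℕ) (x : ℝ) :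
    deriv (F^[a + b]) x = deriv (F^[a]) (F^[b] x) * deriv (F^[b]) x := by
  rw [Function.iterate_add]
  exact deriv_comp x (h.itdiff a _) (h.itdiff b _)

lemma Lift.dpos (n : ℕ) (x : ℝ) : 0 < deriv (F^[n]) x := by
  induction n with
  | zero => simp
  | succ n ih => rw [add_comm, h.dadd]; exact mul_pos (h.pos _) ih

lemma Lift.exp_psi (n : ℕ) (x : ℝ) : Real.exp (psi F n x) = deriv (F^[n]) x :=
  Real.exp_log (h.dpos n x)

lemma Lift.psi_add (a b : ℕ) (x : ℝ) : psi F (a + b) x = psi F a (F^[b] x) + psi F b x := by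
  rw [psi, h.dadd, Real.log_mul (h.dpos _ _).ne' (h.dpos _ _).ne']; rfl

lemma Lift.dsm (n : ℕ) : ContDiff ℝ (⊤ : ℕ∞) (deriv (F^[n])) := by
  have := h.itsm n
  exact (contDiff_infty_iff_deriv.mp this).2

lemma Lift.psism (n : ℕ) : ContDiff ℝ (⊤ : ℕ∞) (psi F n) :=
  (h.dsm n).log (fun x => (h.dpos n x).ne')

lemma Lift.usm (n : ℕ) : ContDiff ℝ (⊤ : ℕ∞) (uu F n) :=
  (contDiff_infty_iff_deriv.mp (h.psism n)).2

lemma Lift.Ssm (n : ℕ) : ContDiff ℝ (⊤ : ℕ∞) (SS F n) :=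
  (contDiff_infty_iff_deriv.mp (h.usm n)).2.sub (((h.usm n).pow 2).div_const 2)

lemma Lift.psid (n : ℕ) : Differentiable ℝ (psi F n) := (h.psism n).differentiable (by simp)
lemma Lift.ud (n : ℕ) : Differentiable ℝ (uu F n) := (h.usm n).differentiable (by simp)

lemma Lift.psi_has (n : ℕ) (x : ℝ) : HasDerivAt (psi F n) (uu F n x) x :=
  (h.psid n x).hasDerivAt

lemma Lift.it_has (n : ℕ) (x : ℝ) : HasDerivAt (F^[n]) (deriv (F^[n]) x) x :=
  (h.itdiff n x).hasDerivAt

lemma Lift.d_has (n : ℕ) (x : ℝ) :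
    HasDerivAt (deriv (F^[n])) (uu F n x * deriv (F^[n]) x) x := by
  have h1 := (h.psi_has n x).exp
  have e : (fun x => Real.exp (psi F n x)) = deriv (F^[n]) := by
    ext y; exact h.exp_psi n y
  rw [e, h.exp_psi] at h1
  rwa [mul_comm]

lemma Lift.u_add (a b : ℕ) (x : ℝ) :
    uu F (a + b) x = uu F a (F^[b] x) * deriv (F^[b]) x + uu F b x := by
  have e : psi F (a + b) = fun x => psi F a (F^[b] x) + psi F b x := by
    ext y; exact h.psi_add a b y
  rw [uu, e]
  exact (((h.psi_has a (F^[b] x)).comp x (h.it_has b x)).add (h.psi_has b x)).deriv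

lemma Lift.S_add (a b : ℕ) (x : ℝ) :
    SS F (a + b) x = SS F a (F^[b] x) * deriv (F^[b]) x ^ 2 + SS F b x := by
  have e : uu F (a + b) = fun x => uu F a (F^[b] x) * deriv (F^[b]) x + uu F b x := by
    ext y; exact h.u_add a b y
  have h1 : HasDerivAt (fun x => uu F a (F^[b] x)) (deriv (uu F a) (F^[b] x) * deriv (F^[b]) x) x :=
    ((h.ud a (F^[b] x)).hasDerivAt).comp x (h.it_has b x)
  have h2 := ((h1.mul (h.d_has b x)).add (h.ud b x).hasDerivAt).deriv
  have e' : uu F (a + b) = (fun x => uu F a (F^[b] x)) * deriv (F^[b]) + uu F b := e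
  rw [← e'] at h2
  rw [SS, h2, e, SS, SS]; ring

lemma Lift.psi_sum (n : ℕ) (x : ℝ) : psi F n x = ∑ i ∈ Finset.range n, psi F 1 (F^[i] x) := by
  induction n with
  | zero => simp [psi]
  | succ n ih => rw [Finset.sum_range_succ, ← ih, add_comm n 1, h.psi_add]; ring

lemma Lift.u_sum (n : ℕ) (x : ℝ) :
    uu F n x = ∑ i ∈ Finset.range n, uu F 1 (F^[i] x) * deriv (F^[i]) x := by
  induction n with
  | zero =>
    have : psi F 0 = fun _ => 0 := by ext; simp [psi]
    simp [uu, this]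
  | succ n ih => rw [Finset.sum_range_succ, ← ih, add_comm n 1, h.u_add]; ring

lemma Lift.S_sum (n : ℕ) (x : ℝ) :
    SS F n x = ∑ i ∈ Finset.range n, SS F 1 (F^[i] x) * deriv (F^[i]) x ^ 2 := by
  induction n with
  | zero =>
    have : psi F 0 = fun _ => 0 := by ext; simp [psi]
    have h2 : uu F 0 = fun _ => 0 := by ext; simp [uu, this]
    simp [SS, h2]
  | succ n ih => rw [Finset.sum_range_succ, ← ih, add_comm n 1, h.S_add]; ring

omit h in
lemma per_deriv {f : ℝ → ℝ} {c : ℝ} (hf : ∀ x, f (x + 1) = f x + c) (x : ℝ) :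
    deriv f (x + 1) = deriv f x := by
  have h1 : deriv (fun y => f (y + 1)) x = deriv f (x + 1) := deriv_comp_add_const f 1 x
  have h2 : (fun y => f (y + 1)) = fun y => f y + c := by ext y; exact hf y
  rw [← h1, h2]; simp

omit h in
lemma per_bdd {f : ℝ → ℝ} (hf : ∀ x, f (x + 1) = f x) (hc : Continuous f) :
    ∃ C, 0 ≤ C ∧ ∀ x, |f x| ≤ C := by
  obtain ⟨C, hC⟩ := (isCompact_Icc (a := (0 : ℝ)) (b := 1)).exists_bound_of_continuousOn
    hc.continuousOn
  have hp : Function.Periodic f 1 := hf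
  refine ⟨max C 0, le_max_right _ _, fun x => ?_⟩
  obtain ⟨y, hy, e⟩ := hp.exists_mem_Ico₀ one_pos x
  rw [e]
  exact le_trans (hC y ⟨hy.1, hy.2.le⟩) (le_max_left _ _)

lemma Lift.dper (n : ℕ) (x : ℝ) : deriv (F^[n]) (x + 1) = deriv (F^[n]) x :=
  per_deriv (c := 1) (fun x => by have := h.fint n x 1; simpa using this) x

lemma Lift.psiper (n : ℕ) (x : ℝ) : psi F n (x + 1) = psi F n x := by
  rw [psi, h.dper]; rfl

lemma Lift.uper (n : ℕ) (x : ℝ) : uu F n (x + 1) = uu F n x :=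
  per_deriv (c := 0) (fun x => by simpa using h.psiper n x) x

lemma Lift.Sper (n : ℕ) (x : ℝ) : SS F n (x + 1) = SS F n x := by
  rw [SS, h.uper, per_deriv (c := 0) (fun x => by simpa using h.uper n x)]; rfl

end

/-- bundled `F` with a bound `L` for `φ'` and `S_1`. -/
structure LiftL (F : ℝ → ℝ) (ρ L : ℝ) : Prop extends Lift F ρ where
  L0 : 0 ≤ L
  Lu : ∀ x, |uu F 1 x| ≤ L
  LS : ∀ x, |SS F 1 x| ≤ L

lemma Lift.exL {F : ℝ → ℝ} {ρ : ℝ} (h : Lift F ρ) : ∃ L, LiftL F ρ L := by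
  obtain ⟨C, c0, hC⟩ := per_bdd (h.uper 1) (h.usm 1).continuous
  obtain ⟨D, d0, hD⟩ := per_bdd (h.Sper 1) (h.Ssm 1).continuous
  exact ⟨max C D, h, le_max_of_le_left c0, fun x => (hC x).trans (le_max_left _ _),
    fun x => (hD x).trans (le_max_right _ _)⟩

end HY

namespace HY
lemma abs_sub_le_of_deriv {f f' : ℝ → ℝ} {a b C x y : ℝ} (hf : ∀ z, HasDerivAt f (f' z) z)
    (hC : ∀ z ∈ Set.Icc a b, |f' z| ≤ C) (hx : x ∈ Set.Icc a b) (hy : y ∈ Set.Icc a b) :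
    |f y - f x| ≤ C * |y - x| :=
  (convex_Icc a b).norm_image_sub_le_of_norm_hasDerivWithin_le
    (fun z _ => (hf z).hasDerivWithinAt) hC hx hy

lemma mvt {f f' : ℝ → ℝ} {a b : ℝ} (hab : a < b) (hf : ∀ z, HasDerivAt f (f' z) z) :
    ∃ c ∈ Set.Icc a b, f b - f a = f' c * (b - a) := by
  obtain ⟨c, hc, e⟩ := exists_hasDerivAt_eq_slope f f' hab
    (fun z _ => (hf z).continuousAt.continuousWithinAt) (fun z _ => hf z)
  refine ⟨c, ⟨hc.1.le, hc.2.le⟩, ?_⟩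
  rw [e]; field_simp [(sub_pos.mpr hab).ne']

section
variable {F : ℝ → ℝ} {ρ : ℝ} (h : Lift F ρ)
include h
lemma Lift.psi_zero (n : ℕ) :
    ∃ y ∈ Set.Icc (0 : ℝ) 1, psi F n y = 0 := by
  obtain ⟨y, hy, e⟩ := mvt (zero_lt_one' ℝ) (h.it_has n)
  refine ⟨y, hy, ?_⟩
  have := h.fint n 0 1
  norm_num at this
  rw [this] at e
  have : deriv (F^[n]) y = 1 := by linarith
  rw [psi, this, Real.log_one]

lemma Lift.psi_int (n : ℕ) (x : ℝ) (r : ℤ) :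
    psi F n (x + r) = psi F n x := by
  have : Function.Periodic (psi F n) 1 := h.psiper n
  simpa using this.int_mul r x

lemma Lift.psi_intsub (n : ℕ) (x : ℝ) (r : ℤ) :
    psi F n (x - r) = psi F n x := by
  have := h.psi_int n x (-r)
  push_cast at this
  simpa [sub_eq_add_neg] using this

lemma Lift.psi_comm (n q : ℕ) (p : ℤ) (x : ℝ) :
    psi F n (G F q p x) - psi F n x = psi F q (F^[n] x) - psi F q x := by
  have h1 := h.psi_add n q x
  have h2 := h.psi_add q n x
  rw [add_comm] at h1
  rw [G, h.psi_intsub]; linarith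

lemma Lift.surj (q : ℕ) (p : ℤ) :
    Function.Surjective (G F q p) := by
  obtain ⟨f, hf, -⟩ := h.exlift
  have e : F = f := by ext x; rw [hf]
  have h1 := (f ^ q).tendsto_atTop
  have h2 := (f ^ q).tendsto_atBot
  rw [CircleDeg1Lift.coe_pow, ← e] at h1 h2
  intro y
  obtain ⟨x, hx⟩ := (h.itsm q).continuous.surjective h1 h2 (y + p)
  exact ⟨x, by rw [G, hx]; ring⟩

lemma Lift.G_has (q : ℕ) (p : ℤ) (x : ℝ) :
    HasDerivAt (G F q p) (deriv (F^[q]) x) x := (h.it_has q x).sub_const _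

lemma Lift.GG_comm (q : ℕ) (p : ℤ) (q' : ℕ) (p' : ℤ) (x : ℝ) :
    G F q p (G F q' p' x) = G F q' p' (G F q p x) := by
  simp only [G]
  rw [h.fsub, h.fsub, ← Function.iterate_add_apply, ← Function.iterate_add_apply, add_comm q]; ring

lemma Lift.GG_eq (q : ℕ) (p : ℤ) (q' : ℕ) (p' : ℤ) (x : ℝ) :
    G F q p (G F q' p' x) = G F (q + q') (p + p') x := by
  simp only [G]
  rw [h.fsub, ← Function.iterate_add_apply]; push_cast; ring

lemma Lift.G_lt (q : ℕ) (p : ℤ) (q' : ℕ) (p' : ℤ)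
    (hlt : q * ρ - p < q' * ρ - p') (x : ℝ) : G F q p x < G F q' p' x := by
  have := h.ord q q' (p - p') x (by push_cast; linarith)
  simp only [G]; push_cast at this; linarith

lemma Lift.G_le (q : ℕ) (p : ℤ) (q' : ℕ) (p' : ℤ)
    (hlt : q * ρ - p ≤ q' * ρ - p') (x : ℝ) : G F q p x ≤ G F q' p' x := by
  have := h.ordle q q' (p - p') x (by push_cast; linarith)
  simp only [G]; push_cast at this; linarith

lemma Lift.G_le_inv (q : ℕ) (p : ℤ) (x : ℝ)
    (hx : x ≤ G F q p x) : p ≤ q * ρ := by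
  have := h.ordc 0 q (-p) x (by simpa [G, sub_eq_add_neg] using hx)
  push_cast at this; linarith

lemma Lift.G_ge_inv (q : ℕ) (p : ℤ) (x : ℝ)
    (hx : G F q p x ≤ x) : q * ρ ≤ p := by
  have := h.ordc q 0 p x (by simp [G] at hx; simpa using hx)
  simpa using this

omit h in
lemma G_zero (x : ℝ) : G F 0 0 x = x := by simp [G]

end

section
variable {F : ℝ → ℝ} {ρ L : ℝ} (h : LiftL F ρ L) {q : ℕ} {p : ℤ} {q' : ℕ} {p' : ℤ}
  (hp : Pair ρ q p q' p')

include h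

lemma LiftL.psi1_lip (x y : ℝ) : |psi F 1 x - psi F 1 y| ≤ L * |x - y| := by
  refine abs_sub_le_of_deriv (a := min x y) (b := max x y) (h.psi_has 1) (fun z _ => h.Lu z) ?_ ?_
  · exact ⟨min_le_right _ _, le_max_right _ _⟩
  · exact ⟨min_le_left _ _, le_max_left _ _⟩

include hp

lemma Pair.gg'_gt (x : ℝ) : x < G F q p (G F q' p' x) := by
  have a1 := hp.a1
  have := h.G_lt 0 0 (q + q') (p + p') (by push_cast; linarith) x
  rw [h.GG_eq]; rwa [G_zero] at this

/-- B2 -/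
lemma Pair.psi_close {x y z : ℝ} (hy : y ∈ Set.Icc x (G F q p x)) (hz : z ∈ Set.Icc x (G F q p x))
    {i : ℕ} (hi : i ≤ q') : |psi F i y - psi F i z| ≤ L := by
  rw [h.psi_sum, h.psi_sum, ← Finset.sum_sub_distrib]
  have key : ∀ k w, w ∈ Set.Icc x (G F q p x) → F^[k] w ∈ Set.Icc (F^[k] x) (G F q p (F^[k] x)) := by
    intro k w hw
    rw [h.G_comm]
    exact ⟨(h.itmono k).monotone hw.1, (h.itmono k).monotone hw.2⟩
  calc _ ≤ ∑ k ∈ Finset.range i, |psi F 1 (F^[k] y) - psi F 1 (F^[k] z)| :=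
        Finset.abs_sum_le_sum_abs _ _
    _ ≤ ∑ k ∈ Finset.range i, L * (G F q p (F^[k] x) - F^[k] x) := by
        refine Finset.sum_le_sum fun k _ => (h.psi1_lip _ _).trans ?_
        refine mul_le_mul_of_nonneg_left ?_ h.L0
        have h1 := key k y hy
        have h2 := key k z hz
        rw [abs_le]; constructor <;> linarith [h1.1, h1.2, h2.1, h2.2]
    _ ≤ ∑ k ∈ Finset.range q', L * (G F q p (F^[k] x) - F^[k] x) := by
        refine Finset.sum_le_sum_of_subset_of_nonneg (by simpa using hi) fun k _ _ => ?_
        exact mul_nonneg h.L0 (by linarith [hp.g_gt h.toLift (F^[k] x)])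
    _ ≤ L := by
        rw [← Finset.mul_sum]
        have := hp.sum_le h.toLift x
        nlinarith [h.L0]

omit hp in
lemma LiftL.d_close {n : ℕ} {y z C : ℝ} (hc : |psi F n y - psi F n z| ≤ C) :
    deriv (F^[n]) y ≤ Real.exp C * deriv (F^[n]) z := by
  rw [← h.exp_psi, ← h.exp_psi, ← Real.exp_add]
  exact Real.exp_le_exp.mpr (by linarith [abs_le.mp hc |>.2])

lemma Pair.d_le {x y : ℝ} (hy : y ∈ Set.Icc x (G F q p x)) {i : ℕ} (hi : i ≤ q') :
    deriv (F^[i]) y * (G F q p x - x) ≤ Real.exp L * (G F q p (F^[i] x) - F^[i] x) := by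
  have hg := hp.g_gt h.toLift x
  obtain ⟨c, hc, e⟩ := mvt hg (h.it_has i)
  rw [h.G_comm, e, ← mul_assoc]
  exact mul_le_mul_of_nonneg_right (h.d_close (hp.psi_close h hy hc hi)) (by linarith)

/-- B3 -/
lemma Pair.denjoy (x : ℝ) : |psi F q' x| ≤ 2 * L := by
  obtain ⟨y0, -, hy0⟩ := h.psi_zero q'
  have hpos := hp.q0
  obtain ⟨i, hi, hmax⟩ := Finset.exists_max_image (Finset.range (q + q'))
    (fun i => F^[i] x + (⌊y0 - F^[i] x⌋ : ℤ)) ⟨0, by simp; omega⟩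
  simp only [Finset.mem_range] at hi hmax
  set r := ⌊y0 - F^[i] x⌋ with hr
  have hz : F^[i] x + r ≤ y0 := by
    have := Int.floor_le (y0 - F^[i] x); rw [← hr] at this; linarith
  -- maximality for any candidate
  have hcand : ∀ j : ℕ, j < q + q' → ∀ s : ℤ, F^[i] x + r < F^[j] x + s → y0 < F^[j] x + s := by
    intro j hj s hs
    by_contra hcon
    push Not at hcon
    have h1 : s ≤ ⌊y0 - F^[j] x⌋ := Int.le_floor.mpr (by linarith)
    have h2 : (s : ℝ) ≤ (⌊y0 - F^[j] x⌋ : ℤ) := by exact_mod_cast h1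
    have := hmax j hj
    linarith
  obtain ⟨j, hj, hjL⟩ : ∃ j < q', |psi F q' (F^[j] x)| ≤ L := by
    rcases lt_or_ge i q' with hiq | hiq
    · refine ⟨i, hiq, ?_⟩
      have h1 : F^[q] (F^[i] x) = F^[i + q] x := by
        rw [← Function.iterate_add_apply, add_comm]
      have h2 := hp.g_gt h.toLift (F^[i] x + r)
      have h3 : G F q p (F^[i] x + r) = F^[i + q] x + ((r - p : ℤ) : ℝ) := by
        rw [G, h.fint, h1]; push_cast; ring
      have h4 := hcand (i + q) (by omega) (r - p) (by rw [← h3]; exact h2)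
      rw [← h3] at h4
      have := hp.psi_close h (x := F^[i] x + r) (y := F^[i] x + r) (z := y0)
        ⟨le_rfl, h2.le⟩ ⟨hz, h4.le⟩ le_rfl
      rwa [hy0, sub_zero, h.psi_int] at this
    · obtain ⟨j, rfl⟩ := Nat.exists_eq_add_of_le' hiq
      have hqq := hp.qq
      refine ⟨j, by omega, ?_⟩
      set w := F^[j] x + ((r + p' : ℤ) : ℝ) with hw
      have h3 : G F q' p' w = F^[j + q'] x + r := by
        rw [G, h.fint, ← Function.iterate_add_apply, add_comm q' j]; push_cast; ring
      have h2 := hp.g'_lt h.toLift w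
      have h4 := hcand j (by omega) (r + p') (by rw [← h3]; exact h2)
      have h5 := hp.gg'_gt h w
      rw [← h3] at hz
      have := hp.psi_close h (x := G F q' p' w) (y := w) (z := y0)
        ⟨h2.le, h5.le⟩ ⟨hz, by linarith⟩ le_rfl
      rwa [hy0, sub_zero, hw, h.psi_int] at this
  have h1 := hp.psi_close h (x := G F q' p' x) (y := G F q' p' x) (z := x)
    ⟨le_rfl, by linarith [hp.gg'_gt h x, hp.g'_lt h.toLift x]⟩
    ⟨(hp.g'_lt h.toLift x).le, (hp.gg'_gt h x).le⟩ hj.le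
  rw [h.psi_comm] at h1
  have h2 := abs_le.mp h1
  have h3 := abs_le.mp hjL
  rw [abs_le]; constructor <;> linarith [h2.1, h2.2, h3.1, h3.2]

/-- B5 -/
lemma Pair.sum_pow {M : ℝ} (hM : ∀ x, G F q p x - x ≤ M) {x y : ℝ}
    (hy : y ∈ Set.Icc x (G F q p x)) (k : ℕ) {l : ℕ} (hl : l ≤ q') :
    ∑ i ∈ Finset.range l, deriv (F^[i]) y ^ (k + 1)
      ≤ Real.exp L ^ (k + 1) * M ^ k / (G F q p x - x) ^ (k + 1) := by
  have hm : 0 < G F q p x - x := by linarith [hp.g_gt h.toLift x]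
  have hpos : ∀ i, 0 < G F q p (F^[i] x) - F^[i] x := fun i => by
    linarith [hp.g_gt h.toLift (F^[i] x)]
  rw [le_div_iff₀ (by positivity), Finset.sum_mul]
  have hM0 : 0 ≤ M := le_trans hm.le (hM x)
  calc _ ≤ ∑ i ∈ Finset.range l, Real.exp L ^ (k + 1) * M ^ k * (G F q p (F^[i] x) - F^[i] x) := by
        refine Finset.sum_le_sum fun i hi => ?_
        have hi' : i ≤ q' := by simp at hi; omega
        rw [← mul_pow]
        have h1 := hp.d_le h hy hi'
        have h2 : 0 ≤ deriv (F^[i]) y * (G F q p x - x) := by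
          have := h.dpos i y; positivity
        refine (pow_le_pow_left₀ h2 h1 (k + 1)).trans ?_
        rw [mul_pow, mul_assoc, pow_succ (G F q p (F^[i] x) - F^[i] x)]
        gcongr
        · exact (hpos i).le
        · exact (hpos i).le
        · exact hM _
    _ ≤ ∑ i ∈ Finset.range q', Real.exp L ^ (k + 1) * M ^ k * (G F q p (F^[i] x) - F^[i] x) := by
        refine Finset.sum_le_sum_of_subset_of_nonneg (by simpa using hl) fun k _ _ => ?_
        have := hpos k
        positivity
    _ ≤ _ := by
        rw [← Finset.mul_sum]
        have := hp.sum_le h.toLift x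
        have h3 : 0 ≤ Real.exp L ^ (k + 1) * M ^ k := by positivity
        nlinarith

lemma Pair.S_le {M : ℝ} (hM : ∀ x, G F q p x - x ≤ M) {x y : ℝ}
    (hy : y ∈ Set.Icc x (G F q p x)) {l : ℕ} (hl : l ≤ q') :
    |SS F l y| ≤ L * Real.exp L ^ 2 * M / (G F q p x - x) ^ 2 := by
  rw [h.S_sum]
  have := hp.sum_pow h hM hy 1 hl
  calc _ ≤ ∑ i ∈ Finset.range l, |SS F 1 (F^[i] y) * deriv (F^[i]) y ^ 2| :=
        Finset.abs_sum_le_sum_abs _ _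
    _ ≤ ∑ i ∈ Finset.range l, L * deriv (F^[i]) y ^ 2 := by
        refine Finset.sum_le_sum fun i _ => ?_
        rw [abs_mul, abs_of_nonneg (sq_nonneg (deriv (F^[i]) y))]
        exact mul_le_mul_of_nonneg_right (h.LS _) (sq_nonneg _)
    _ ≤ _ := by
        rw [← Finset.mul_sum]
        refine (mul_le_mul_of_nonneg_left this h.L0).trans (le_of_eq ?_)
        norm_num; ring

/-- B7 -/
lemma Pair.u_close {M : ℝ} (hM : ∀ x, G F q p x - x ≤ M) {x y z : ℝ}
    (hy : y ∈ Set.Icc x (G F q p x)) (hz : z ∈ Set.Icc x (G F q p x)) {l : ℕ} (hl : l ≤ q') :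
    |uu F l y| ≤ Real.exp L * (|uu F l z| + L * Real.exp L ^ 3 * M / (G F q p x - x)) := by
  have hm : 0 < G F q p x - x := by linarith [hp.g_gt h.toLift x]
  have hM0 : 0 ≤ M := le_trans hm.le (hM x)
  have L0 := h.L0
  have hE : ∀ w ∈ Set.Icc x (G F q p x), Real.exp (-(psi F l w - psi F l z) / 2) ≤ Real.exp L := by
    intro w hw
    have := abs_le.mp (hp.psi_close h hw hz hl)
    exact Real.exp_le_exp.mpr (by linarith [this.1])
  have hd : ∀ w, HasDerivAt (fun w => uu F l w * Real.exp (-(psi F l w - psi F l z) / 2))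
      (SS F l w * Real.exp (-(psi F l w - psi F l z) / 2)) w := by
    intro w
    have h1 := ((((h.psi_has l w).sub_const (psi F l z)).neg.div_const 2).exp)
    have := ((h.ud l w).hasDerivAt).mul h1
    refine this.congr_deriv ?_
    simp only [SS, Pi.neg_apply]; ring
  have hv := abs_sub_le_of_deriv hd (C := L * Real.exp L ^ 3 * M / (G F q p x - x) ^ 2)
    (fun w hw => by
      rw [abs_mul, abs_of_pos (Real.exp_pos _)]
      refine (mul_le_mul (hp.S_le h hM hw hl) (hE w hw) (Real.exp_pos _).le (by positivity)).trans
        (le_of_eq ?_)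
      ring) hz hy
  have hyz : |y - z| ≤ G F q p x - x := by
    rw [abs_le]; constructor <;> linarith [hy.1, hy.2, hz.1, hz.2]
  simp only [sub_self, neg_zero, zero_div, Real.exp_zero, mul_one] at hv
  have hv2 : |uu F l y * Real.exp (-(psi F l y - psi F l z) / 2)| ≤
      |uu F l z| + L * Real.exp L ^ 3 * M / (G F q p x - x) := by
    have h1 : L * Real.exp L ^ 3 * M / (G F q p x - x) ^ 2 * |y - z|
        ≤ L * Real.exp L ^ 3 * M / (G F q p x - x) := by
      calc _ ≤ L * Real.exp L ^ 3 * M / (G F q p x - x) ^ 2 * (G F q p x - x) := by gcongr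
        _ = _ := by field_simp
    have := abs_sub_abs_le_abs_sub (uu F l y * Real.exp (-(psi F l y - psi F l z) / 2)) (uu F l z)
    linarith
  rw [abs_mul, abs_of_pos (Real.exp_pos _)] at hv2
  have hE2 : 1 ≤ Real.exp L * Real.exp (-(psi F l y - psi F l z) / 2) := by
    rw [← Real.exp_add]
    refine Real.one_le_exp ?_
    have := abs_le.mp (hp.psi_close h hy hz hl)
    linarith [this.2]
  calc |uu F l y| = |uu F l y| * 1 := by ring
    _ ≤ |uu F l y| * (Real.exp L * Real.exp (-(psi F l y - psi F l z) / 2)) := by gcongr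
    _ = Real.exp L * (|uu F l y| * Real.exp (-(psi F l y - psi F l z) / 2)) := by ring
    _ ≤ _ := by gcongr

/-- B8a -/
lemma Pair.u_le {M δ : ℝ} (hM : ∀ x, G F q p x - x ≤ M) (hδ : ∀ x, Real.exp |psi F q x| ≤ 1 + δ)
    (x : ℝ) {l : ℕ} (hl : l ≤ q') :
    |uu F l x| * (G F q p x - x) ≤ (2 * Real.exp L + L * Real.exp L ^ 4) * (δ + M) := by
  have hg := hp.g_gt h.toLift x
  have hm : 0 < G F q p x - x := by linarith
  have hM0 : 0 ≤ M := le_trans hm.le (hM x)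
  have L0 := h.L0
  have hδ0 : 0 ≤ δ := by
    have := hδ x; have := Real.one_le_exp (abs_nonneg (psi F q x)); linarith
  obtain ⟨c, hc, e⟩ := mvt hg (h.psi_has l)
  have hps : ∀ y, |psi F q y| ≤ δ := fun y => by
    have := hδ y; have := Real.add_one_le_exp |psi F q y|; linarith
  have h1 : |uu F l c| * (G F q p x - x) ≤ 2 * δ := by
    rw [← abs_of_pos hm, ← abs_mul, ← e, h.psi_comm]
    have := abs_sub (psi F q (F^[l] x)) (psi F q x)
    linarith [hps (F^[l] x), hps x]
  have h2 := hp.u_close h hM (x := x) (y := x) (z := c) ⟨le_rfl, hg.le⟩ hc hl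
  calc _ ≤ Real.exp L * (|uu F l c| + L * Real.exp L ^ 3 * M / (G F q p x - x))
        * (G F q p x - x) := by gcongr
    _ = Real.exp L * (|uu F l c| * (G F q p x - x)) + L * Real.exp L ^ 4 * M := by field_simp
    _ ≤ Real.exp L * (2 * δ) + L * Real.exp L ^ 4 * M := by gcongr
    _ ≤ _ := by
      have := Real.exp_pos L
      have : 0 ≤ L * Real.exp L ^ 4 * δ := by positivity
      nlinarith

end
end HY

namespace HY
section
variable {F : ℝ → ℝ} {ρ L : ℝ} (h : LiftL F ρ L) {q : ℕ} {p : ℤ} {q' : ℕ} {p' : ℤ}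
  (hp : Pair ρ q p q' p')

/-- constant in B8b -/
noncomputable def KD (L : ℝ) : ℝ :=
  (L * Real.exp L ^ 4) * Real.exp (L * Real.exp L ^ 4) * (1 + Real.exp (2 * L))

lemma per_max {f : ℝ → ℝ} (hf : ∀ x, f (x + 1) = f x) (hc : Continuous f) :
    ∃ x, ∀ y, f y ≤ f x := by
  obtain ⟨x, hx, hmax⟩ := (isCompact_Icc (a := (0 : ℝ)) (b := 1)).exists_isMaxOn ⟨0, by simp⟩
    hc.continuousOn
  have hp : Function.Periodic f 1 := hf
  refine ⟨x, fun y => ?_⟩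
  obtain ⟨z, hz, e⟩ := hp.exists_mem_Ico₀ one_pos y
  rw [e]
  exact hmax ⟨hz.1, hz.2.le⟩

lemma real_key {d t r δ : ℝ} (hd : 0 < d) (ht : 0 < t) (hd1 : d ≤ 1 + δ) (hd2 : 1 ≤ d * (1 + δ))
    (hdt : d * t ≤ r) (hr0 : 0 ≤ r) (hr1 : r ≤ 1) (hδ0 : 0 ≤ δ) :
    t * (1 - d) ≤ r * δ ∧ 1 ≤ (1 + r * δ) * (1 + t * (1 - d)) := by
  constructor
  · calc t * (1 - d) ≤ t * (d * δ) := mul_le_mul_of_nonneg_left (by linarith) ht.le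
      _ = (d * t) * δ := by ring
      _ ≤ r * δ := by gcongr
  have hrd := mul_nonneg hr0 hδ0
  rcases le_total d 1 with hd3 | hd3
  · have : 0 ≤ t * (1 - d) := mul_nonneg ht.le (by linarith)
    nlinarith
  · have hd0 : 0 ≤ d - 1 := by linarith
    have h9 : (d - 1) * (1 + r * δ) ≤ d * δ := by
      have h1 : r * δ ≤ δ := by nlinarith
      have h2 : (d - 1) * (r * δ) ≤ (d - 1) * δ := by gcongr
      linarith
    have h10 : d * (t * (d - 1) * (1 + r * δ)) ≤ d * (r * δ) := by
      calc d * (t * (d - 1) * (1 + r * δ)) = (d * t) * ((d - 1) * (1 + r * δ)) := by ring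
        _ ≤ r * (d * δ) := by
          apply mul_le_mul hdt h9 _ hr0
          positivity
        _ = _ := by ring
    have := le_of_mul_le_mul_left h10 hd
    linarith

include h hp

lemma Pair.m_le_one (x : ℝ) : G F q p x - x ≤ 1 := by
  have h1 := hp.sum_le h.toLift x
  have h2 := Finset.single_le_sum (f := fun i => G F q p (F^[i] x) - F^[i] x)
    (s := Finset.range q') (fun i _ => by linarith [hp.g_gt h.toLift (F^[i] x)])
    (a := 0) (by simp; have := hp.q0; have := hp.qq; omega)
  simp only [Function.iterate_zero, id] at h2
  exact h2.trans h1

/-- B8b -/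
lemma Pair.delta_step {M δ r : ℝ} (hM : ∀ x, G F q p x - x ≤ M) (hM1 : M ≤ 1)
    (hδ : ∀ x, Real.exp |psi F q x| ≤ 1 + δ) (hδ1 : δ ≤ Real.exp (2 * L))
    (hr : ∀ w, G F q p w - G F q' p' (G F q p w) ≤ r * (G F q p w - w)) (hr1 : r ≤ 1) (x : ℝ) :
    Real.exp |psi F q' x| ≤ 1 + (r * δ + KD L * M) := by
  obtain ⟨x0, hx0⟩ := per_max (f := fun x => |psi F q' x|) (fun x => by
    show |_| = _; rw [h.psiper]) (h.psism q').continuous.abs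
  refine (Real.exp_le_exp.mpr (hx0 x)).trans ?_
  clear x
  have L0 := h.L0
  have hu0 : uu F q' x0 = 0 := by
    rcases le_total 0 (psi F q' x0) with hs | hs
    · refine IsLocalMax.deriv_eq_zero (Eventually.of_forall fun y => ?_)
      have := hx0 y
      simp only [abs_of_nonneg hs] at this
      exact (le_abs_self _).trans this
    · refine IsLocalMin.deriv_eq_zero (Eventually.of_forall fun y => ?_)
      have := hx0 y
      simp only [abs_of_nonpos hs] at this
      linarith [neg_abs_le (psi F q' y)]
  have hg := hp.g_gt h.toLift x0
  set m := G F q p x0 - x0 with hmdef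
  have hm : 0 < m := by linarith
  have hM0 : 0 ≤ M := le_trans hm.le (hM x0)
  obtain ⟨ξ, hξ, e1⟩ := mvt hg (h.G_has q' p')
  have hξ1 : |psi F q' ξ - psi F q' x0| ≤ L * Real.exp L ^ 4 * M := by
    have := abs_sub_le_of_deriv (h.psi_has q') (C := L * Real.exp L ^ 4 * M / m)
      (fun w hw => by
        have := hp.u_close h hM hw (z := x0) ⟨le_rfl, hg.le⟩ le_rfl
        rw [hu0] at this
        refine this.trans (le_of_eq ?_)
        simp; ring) ⟨le_rfl, hg.le⟩ hξ
    refine this.trans ?_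
    have h2 : |ξ - x0| ≤ m := by rw [abs_le]; constructor <;> linarith [hξ.1, hξ.2]
    calc _ ≤ L * Real.exp L ^ 4 * M / m * m := by gcongr
      _ = _ := by field_simp
  have hg' := hp.g'_lt h.toLift x0
  obtain ⟨ζ, hζ, e2⟩ := mvt hg' (h.G_has q p)
  rw [h.GG_comm] at e2
  have hrx := hr x0
  have hdξ := h.dpos q' ξ
  have hdζ := h.dpos q ζ
  set d := deriv (F^[q]) ζ with hd
  set d' := deriv (F^[q']) ξ with hd'
  -- m'(x0)
  set m' := x0 - G F q' p' x0 with hm'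
  have hm'0 : 0 < m' := by linarith
  have hE1 : d' - 1 = (m' - d * m') / m := by
    field_simp; linarith
  have hdm : d * m' ≤ r * m := by linarith
  have hr0 : 0 ≤ r := by
    by_contra hcon
    push Not at hcon
    nlinarith [mul_pos hdζ hm'0]
  have hδζ := hδ ζ
  have hδ0 : 0 ≤ δ := by
    have := Real.one_le_exp (abs_nonneg (psi F q ζ)); linarith
  have hkey : Real.exp |psi F q' ξ| ≤ 1 + r * δ := by
    have hd1 : d ≤ 1 + δ := by
      rw [hd, ← h.exp_psi]; exact (Real.exp_le_exp.mpr (le_abs_self _)).trans hδζ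
    have hd2 : 1 ≤ d * (1 + δ) := by
      have : Real.exp (- psi F q ζ) ≤ 1 + δ :=
        (Real.exp_le_exp.mpr (neg_le_abs _)).trans hδζ
      rw [Real.exp_neg, h.exp_psi, ← hd] at this
      rw [inv_le_iff_one_le_mul₀ hdζ] at this
      linarith
    have hs : 0 < m' / m := by positivity
    have hE2 : d' = 1 + (m' / m) * (1 - d) := by
      have : (m' - d * m') / m = (m' / m) * (1 - d) := by ring
      linarith
    have hdm2 : d * (m' / m) ≤ r := by
      rw [← mul_div_assoc, div_le_iff₀ hm]; exact hdm
    set t := m' / m with ht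
    rcases le_total 0 (psi F q' ξ) with hs0 | hs0
    · rw [abs_of_nonneg hs0, h.exp_psi, ← hd', hE2]
      linarith [(real_key hdζ hs hd1 hd2 hdm2 hr0 hr1 hδ0).1]
    · rw [abs_of_nonpos hs0, Real.exp_neg, h.exp_psi, ← hd']
      rw [inv_le_iff_one_le_mul₀ hdξ, hE2]
      exact (real_key hdζ hs hd1 hd2 hdm2 hr0 hr1 hδ0).2
  set κ := L * Real.exp L ^ 4 * M with hκ
  have hκ0 : 0 ≤ κ := by positivity
  have hκ1 : Real.exp κ - 1 ≤ κ * Real.exp (L * Real.exp L ^ 4) := by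
    have h1 := Real.add_one_le_exp (-κ)
    have h2 : Real.exp κ ≤ Real.exp (L * Real.exp L ^ 4) := by
      apply Real.exp_le_exp.mpr
      rw [hκ]
      have : 0 ≤ L * Real.exp L ^ 4 := by positivity
      nlinarith
    have h3 : Real.exp κ * Real.exp (-κ) = 1 := by rw [← Real.exp_add]; simp
    have := Real.exp_pos κ
    nlinarith
  have hfin : Real.exp |psi F q' x0| ≤ Real.exp κ * Real.exp |psi F q' ξ| := by
    rw [← Real.exp_add]
    apply Real.exp_le_exp.mpr
    have := abs_sub_abs_le_abs_sub (psi F q' x0) (psi F q' ξ)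
    rw [abs_sub_comm (psi F q' x0)] at this
    linarith
  have hrd : 0 ≤ r * δ := mul_nonneg hr0 hδ0
  have hrd1 : r * δ ≤ Real.exp (2 * L) := by nlinarith
  calc Real.exp |psi F q' x0| ≤ Real.exp κ * (1 + r * δ) :=
        hfin.trans (by gcongr)
    _ = 1 + r * δ + (Real.exp κ - 1) * (1 + r * δ) := by ring
    _ ≤ 1 + r * δ + κ * Real.exp (L * Real.exp L ^ 4) * (1 + Real.exp (2 * L)) := by
        gcongr
    _ = _ := by rw [hκ, KD]; ring

lemma Pair.r_le_one (w : ℝ) : G F q p w - G F q' p' (G F q p w) ≤ G F q p w - w := by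
  rw [← h.GG_comm]
  linarith [hp.gg'_gt h w]

omit hp in
/-- transport of displacement under `G` with bounded distortion -/
lemma LiftL.disp {C : ℝ} {q : ℕ} (hC : ∀ x, |psi F q x| ≤ C) (p : ℤ) (q' : ℕ) (p' : ℤ) (x : ℝ) :
    |G F q' p' (G F q p x) - G F q p x| ≤ Real.exp C * |G F q' p' x - x| ∧
    |G F q' p' x - x| ≤ Real.exp C * |G F q' p' (G F q p x) - G F q p x| := by
  rw [← h.GG_comm]
  have key : ∃ c, G F q p (G F q' p' x) - G F q p x = deriv (F^[q]) c * (G F q' p' x - x) := by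
    rcases lt_trichotomy x (G F q' p' x) with hl | hl | hl
    · obtain ⟨c, -, e⟩ := mvt hl (h.G_has q p); exact ⟨c, e⟩
    · exact ⟨0, by rw [← hl]; simp⟩
    · obtain ⟨c, -, e⟩ := mvt hl (h.G_has q p); exact ⟨c, by linarith⟩
  obtain ⟨c, e⟩ := key
  have hd := h.dpos q c
  have h1 : deriv (F^[q]) c ≤ Real.exp C := by
    rw [← h.exp_psi]; exact Real.exp_le_exp.mpr ((le_abs_self _).trans (hC c))
  have h2 : 1 ≤ Real.exp C * deriv (F^[q]) c := by
    rw [← h.exp_psi, ← Real.exp_add]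
    exact Real.one_le_exp (by linarith [neg_abs_le (psi F q c), hC c])
  rw [e, abs_mul, abs_of_pos hd]
  constructor
  · gcongr
  · rw [← mul_assoc]
    exact le_mul_of_one_le_left (abs_nonneg _) h2

/-- Fact 1 -/
lemma Pair.fact1 {C : ℝ} (hC' : ∀ x, |psi F q' x| ≤ C)
    (hα : 2 * (p' - q' * ρ) < q * ρ - p) (w : ℝ) :
    (1 + Real.exp (-C)) * (G F q p w - G F q' p' (G F q p w)) ≤ G F q p w - w := by
  set y := G F q p w with hy
  have h1 : w < G F q' p' (G F q' p' y) := by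
    rw [hy, h.GG_eq, h.GG_eq]
    have := h.G_lt 0 0 (q' + q' + q) (p' + p' + p) (by push_cast; linarith) w
    rwa [G_zero] at this
  have h2 := (h.disp hC' p' q' p' y).2
  have h3 := hp.g'_lt h.toLift y
  have h4 := hp.g'_lt h.toLift (G F q' p' y)
  rw [abs_of_neg (by linarith), abs_of_neg (by linarith)] at h2
  have h5 : Real.exp (-C) * (y - G F q' p' y) ≤ G F q' p' y - G F q' p' (G F q' p' y) := by
    rw [Real.exp_neg, inv_mul_le_iff₀ (Real.exp_pos _)]; linarith
  linarith

/-- Fact 2 -/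
lemma Pair.fact2 {C : ℝ} (hC : ∀ x, |psi F q x| ≤ C) (hC' : ∀ x, |psi F q' x| ≤ C)
    {q'' : ℕ} {p'' : ℤ} (hC'' : ∀ x, |psi F q'' x| ≤ C) (h0 : 0 < q'' * ρ - p'')
    (hα : p' - q' * ρ ≤ 2 * (q'' * ρ - p''))
    (hα2 : q'' * ρ - p'' ≤ (q * ρ - p) - (p' - q' * ρ)) (w : ℝ) :
    (1 + 1 / ((1 + Real.exp C) * Real.exp C ^ 2)) * (G F q p w - G F q' p' (G F q p w))
      ≤ G F q p w - w := by
  have hg'' : ∀ y, y < G F q'' p'' y := fun y => by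
    have := h.G_lt 0 0 q'' p'' (by push_cast; linarith) y
    rwa [G_zero] at this
  set y := G F q' p' (G F q p w) with hy
  have h1 : G F q'' p'' w ≤ y := by
    rw [hy, h.GG_eq]
    exact h.G_le _ _ _ _ (by push_cast; linarith) w
  have h2 : G F q p w ≤ G F q'' p'' (G F q'' p'' y) := by
    rw [hy, h.GG_eq, h.GG_eq, h.GG_eq]
    exact h.G_le _ _ _ _ (by push_cast; linarith) w
  have h3 := (h.disp hC'' p'' q'' p'' y).1
  have h4 := (h.disp hC' p' q'' p'' (G F q p w)).1
  have h5 := (h.disp hC p q'' p'' w).1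
  rw [← hy] at h4
  have a1 := hg'' y
  have a2 := hg'' (G F q'' p'' y)
  have a3 := hg'' (G F q p w)
  have a4 := hg'' w
  rw [abs_of_pos (by linarith), abs_of_pos (by linarith)] at h3 h4 h5
  have hE := Real.exp_pos C
  have h6 : G F q p w - y ≤ ((1 + Real.exp C) * Real.exp C ^ 2) * (G F q'' p'' w - w) := by
    calc G F q p w - y ≤ (1 + Real.exp C) * (G F q'' p'' y - y) := by linarith
      _ ≤ (1 + Real.exp C) * (Real.exp C * (Real.exp C * (G F q'' p'' w - w))) := by
        gcongr; exact h4.trans (by gcongr)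
      _ = _ := by ring
  have h7 : 1 / ((1 + Real.exp C) * Real.exp C ^ 2) * (G F q p w - y) ≤ G F q'' p'' w - w := by
    rw [one_div, inv_mul_le_iff₀ (by positivity)]; exact h6
  linarith

end
end HY

namespace HY

abbrev Sm (f : ℝ → ℝ) : Prop := ContDiff ℝ (⊤ : ℕ∞) f

lemma Sm.at {f : ℝ → ℝ} (hf : Sm f) (n : ℕ) (x : ℝ) : ContDiffAt ℝ n f x :=
  (hf.of_le (by exact_mod_cast le_top)).contDiffAt

lemma Sm.d {f : ℝ → ℝ} (hf : Sm f) : Sm (deriv f) := (contDiff_infty_iff_deriv.mp hf).2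

lemma Sm.has {f : ℝ → ℝ} (hf : Sm f) (x : ℝ) : HasDerivAt f (deriv f x) x :=
  (hf.differentiable (by simp) x).hasDerivAt

lemma Sm.id_ {n : ℕ} {f : ℝ → ℝ} (hf : Sm f) : Sm (iteratedDeriv n f) := by
  induction n with
  | zero => simpa using hf
  | succ n ih => rw [iteratedDeriv_succ]; exact ih.d

/-- product bound -/
lemma mul_bound {f g : ℝ → ℝ} (hf : Sm f) (hg : Sm g) {x A B E : ℝ} {n : ℕ}
    (hA : ∀ i ≤ n, |iteratedDeriv i f x| ≤ A * E ^ i)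
    (hB : ∀ i ≤ n, |iteratedDeriv i g x| ≤ B * E ^ i) :
    |iteratedDeriv n (fun y => f y * g y) x| ≤ 2 ^ n * (A * B * E ^ n) := by
  have e : (fun y => f y * g y) = f * g := rfl
  rw [e, iteratedDeriv_mul (hf.at n x) (hg.at n x)]
  refine (Finset.abs_sum_le_sum_abs _ _).trans ?_
  have : (2 : ℝ) ^ n = ∑ i ∈ Finset.range (n + 1), (n.choose i : ℝ) := by
    exact_mod_cast (Nat.sum_range_choose n).symm
  rw [this, Finset.sum_mul]
  refine Finset.sum_le_sum fun i hi => ?_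
  have hi' : i ≤ n := by simp at hi; omega
  rw [abs_mul, abs_mul, Nat.abs_cast, mul_assoc]
  refine mul_le_mul_of_nonneg_left ?_ (by positivity)
  calc _ ≤ (A * E ^ i) * (B * E ^ (n - i)) :=
        mul_le_mul (hA i hi') (hB _ (by omega)) (abs_nonneg _) ((abs_nonneg _).trans (hA i hi'))
    _ = A * B * (E ^ i * E ^ (n - i)) := by ring
    _ = _ := by rw [← pow_add, Nat.add_sub_cancel' hi']

/-- composition bound -/
lemma comp_bound {f g : ℝ → ℝ} (hf : Sm f) (hg : Sm g) {x A N D : ℝ} {n : ℕ} (hn : 1 ≤ n)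
    (hN : 0 < N) (hA : ∀ i, 1 ≤ i → i ≤ n → |iteratedDeriv i g (f x)| ≤ A * N ^ i)
    (hD : ∀ i, 1 ≤ i → i ≤ n → N * |iteratedDeriv i f x| ≤ D ^ i) :
    |iteratedDeriv n (fun y => g (f y)) x| ≤ n.factorial * A * D ^ n := by
  have hA0 : 0 ≤ A := by
    have := (abs_nonneg _).trans (hA 1 le_rfl hn)
    simp at this
    exact nonneg_of_mul_nonneg_left this hN
  let g1 : ℝ → ℝ := fun y => g (N⁻¹ * y)
  let c := g (f x)
  let g2 : ℝ → ℝ := fun y => g1 y - c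
  let f1 : ℝ → ℝ := fun y => N * f y
  have hg1 : Sm g1 := hg.comp (contDiff_const.mul contDiff_id)
  have hf1 : Sm f1 := contDiff_const.mul hf
  have hg2 : Sm g2 := hg1.sub contDiff_const
  have e1 : (fun y => g (f y)) = fun y => c + (g2 ∘ f1) y := by
    ext y; simp only [g2, g1, f1, Function.comp]; rw [inv_mul_cancel_left₀ hN.ne']; ring
  rw [e1, iteratedDeriv_const_add (by omega), ← Real.norm_eq_abs,
    ← norm_iteratedFDeriv_eq_norm_iteratedDeriv]
  have hle : (n : WithTop ℕ∞) ≤ ((⊤ : ℕ∞) : WithTop ℕ∞) := by exact_mod_cast le_top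
  refine norm_iteratedFDeriv_comp_le hg2 hf1 hle x (fun i hi => ?_) (fun i hi1 hi => ?_)
  · rw [norm_iteratedFDeriv_eq_norm_iteratedDeriv, Real.norm_eq_abs]
    rcases Nat.eq_zero_or_pos i with h0 | h0
    · subst h0
      simp only [iteratedDeriv_zero, g2, g1, f1, c]
      rw [inv_mul_cancel_left₀ hN.ne']; simpa using hA0
    · have e2 : g2 = fun y => -c + g1 y := by ext y; simp only [g2]; ring
      rw [e2, iteratedDeriv_const_add h0]
      simp only [g1]
      rw [iteratedDeriv_comp_const_mul (hg.of_le (by exact_mod_cast le_top))]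
      simp only [f1]
      rw [inv_mul_cancel_left₀ hN.ne', abs_mul, abs_of_pos (by positivity), inv_pow,
        inv_mul_le_iff₀ (by positivity)]
      linarith [hA i h0 hi]
  · rw [norm_iteratedFDeriv_eq_norm_iteratedDeriv, Real.norm_eq_abs]
    simp only [f1]
    rw [iteratedDeriv_const_mul_field, abs_mul, abs_of_pos hN]
    exact hD i hi1 hi

/-- interpolation on points -/
lemma interp (R : ℕ) (K : ℝ) (hK : 0 ≤ K) : ∃ C : ℝ, 0 ≤ C ∧ ∀ f : ℝ → ℝ, Sm f → ∀ a b s η Λ : ℝ,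
    0 < s → b - a ≤ K * s → ∀ z : ℕ → ℝ, (∀ i, i + 1 < 2 ^ R → z i + s ≤ z (i + 1)) →
    (∀ i < 2 ^ R, z i ∈ Set.Icc a b) → (∀ i < 2 ^ R, |f (z i)| ≤ η) →
    (∀ x ∈ Set.Icc a b, |iteratedDeriv R f x| ≤ Λ) →
    ∀ j ≤ R, ∀ x ∈ Set.Icc a b, |iteratedDeriv j f x| * s ^ j ≤ C * (η + Λ * s ^ R) := by
  induction R with
  | zero =>
    refine ⟨1, zero_le_one, fun f hf a b s η Λ hs hab z hz1 hz2 hz3 hΛ j hj x hx => ?_⟩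
    obtain rfl : j = 0 := by omega
    have h1 := hΛ x hx
    have h2 := (abs_nonneg _).trans (hz3 0 (by norm_num))
    simp at h1 ⊢; linarith
  | succ R ih =>
    obtain ⟨C, hC, IH⟩ := ih
    refine ⟨2 * C + 1 + 2 * K * C, by positivity,
      fun f hf a b s η Λ hs hab z hz1 hz2 hz3 hΛ j hj x hx => ?_⟩
    have hη : 0 ≤ η := (abs_nonneg _).trans (hz3 0 (by positivity))
    have hΛ0 : 0 ≤ Λ := (abs_nonneg _).trans (hΛ x hx)
    have hpow : (2 : ℕ) ^ (R + 1) = 2 * 2 ^ R := by ring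
    have hex : ∀ k, ∃ ξ, k < 2 ^ R → ξ ∈ Set.Icc (z (2 * k)) (z (2 * k + 1)) ∧
        |deriv f ξ| ≤ 2 * η / s := by
      intro k
      by_cases hk : k < 2 ^ R
      · have h1 := hz1 (2 * k) (by omega)
        obtain ⟨ξ, hξ, e⟩ := mvt (by linarith : z (2 * k) < z (2 * k + 1)) hf.has
        refine ⟨ξ, fun _ => ⟨hξ, ?_⟩⟩
        rw [le_div_iff₀ hs]
        have h2 : |deriv f ξ| * (z (2 * k + 1) - z (2 * k)) ≤ 2 * η := by
          rw [← abs_of_pos (by linarith : 0 < z (2 * k + 1) - z (2 * k)), ← abs_mul, ← e]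
          have := abs_sub (f (z (2 * k + 1))) (f (z (2 * k)))
          linarith [hz3 (2 * k) (by omega), hz3 (2 * k + 1) (by omega)]
        have := abs_nonneg (deriv f ξ)
        nlinarith
      · exact ⟨0, fun h => absurd h hk⟩
    choose ξ hξ using hex
    have key := IH (deriv f) hf.d a b s (2 * η / s) Λ hs hab ξ
      (fun i hi => by
        have h1 := (hξ i (by omega)).1.2
        have h2 := (hξ (i + 1) (by omega)).1.1
        have h3 := hz1 (2 * i + 1) (by omega)
        have e : 2 * (i + 1) = 2 * i + 1 + 1 := by ring
        rw [e] at h2; linarith)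
      (fun i hi => by
        have h1 := (hξ i hi).1
        exact ⟨(hz2 (2 * i) (by omega)).1.trans h1.1, h1.2.trans (hz2 (2 * i + 1) (by omega)).2⟩)
      (fun i hi => (hξ i hi).2)
      (fun x hx => by rw [← iteratedDeriv_succ']; exact hΛ x hx)
    have hP : 0 ≤ Λ * s ^ (R + 1) := by positivity
    have key2 : ∀ j ≤ R, ∀ x ∈ Set.Icc a b, |iteratedDeriv (j + 1) f x| * s ^ (j + 1)
        ≤ C * (2 * η + Λ * s ^ (R + 1)) := by
      intro j hj x hx
      have := mul_le_mul_of_nonneg_right (key j hj x hx) hs.le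
      rw [iteratedDeriv_succ']
      calc _ = |iteratedDeriv j (deriv f) x| * s ^ j * s := by ring
        _ ≤ _ := this
        _ = _ := by field_simp; ring
    rcases Nat.eq_zero_or_pos j with h0 | h0
    · subst h0
      simp only [iteratedDeriv_zero, pow_zero, mul_one]
      have hd : ∀ w ∈ Set.Icc a b, |deriv f w| ≤ C * (2 * η + Λ * s ^ (R + 1)) / s := by
        intro w hw
        have := key2 0 (Nat.zero_le _) w hw
        simp [iteratedDeriv_one] at this
        rw [le_div_iff₀ hs]; exact this
      have hz0 := hz2 0 (by positivity)
      have h1 := abs_sub_le_of_deriv hf.has hd hz0 hx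
      have h2 : |x - z 0| ≤ K * s := by
        rw [abs_le]; constructor <;> linarith [hz0.1, hz0.2, hx.1, hx.2]
      have h3 : C * (2 * η + Λ * s ^ (R + 1)) / s * |x - z 0| ≤ C * (2 * η + Λ * s ^ (R + 1)) * K := by
        calc _ ≤ C * (2 * η + Λ * s ^ (R + 1)) / s * (K * s) := by gcongr
          _ = _ := by field_simp
      have h4 := abs_sub_abs_le_abs_sub (f x) (f (z 0))
      have h5 := hz3 0 (by positivity)
      have h6 : 0 ≤ C * η := by positivity
      have h7 : 0 ≤ C * (Λ * s ^ (R + 1)) := by positivity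
      have h8 : 0 ≤ K * C * (Λ * s ^ (R + 1)) := by positivity
      nlinarith
    · obtain ⟨i, rfl⟩ : ∃ i, j = i + 1 := ⟨j - 1, by omega⟩
      refine (key2 i (by omega) x hx).trans ?_
      have h6 : 0 ≤ C * η := by positivity
      have h7 : 0 ≤ C * (Λ * s ^ (R + 1)) := by positivity
      have h8 : 0 ≤ K * C * (Λ * s ^ (R + 1)) := by positivity
      have h9 : 0 ≤ K * C * η := by positivity
      nlinarith

/-- global interpolation -/
lemma interpg (R : ℕ) : ∃ C : ℝ, 0 ≤ C ∧ ∀ f : ℝ → ℝ, Sm f → ∀ s η Λ : ℝ,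
    0 < s → (∀ x, |f x| ≤ η) → (∀ x, |iteratedDeriv R f x| ≤ Λ) →
    ∀ j ≤ R, ∀ x, |iteratedDeriv j f x| * s ^ j ≤ C * (η + Λ * s ^ R) := by
  obtain ⟨C, hC, h⟩ := interp R (2 ^ R) (by positivity)
  refine ⟨C, hC, fun f hf s η Λ hs hη hΛ j hj x => ?_⟩
  refine h f hf x (x + 2 ^ R * s) s η Λ hs (by linarith) (fun i => x + i * s)
    (fun i _ => by push_cast; linarith) (fun i hi => ⟨by simp; positivity, ?_⟩) (fun i _ => hη _)
    (fun x _ => hΛ x) j hj x ⟨le_rfl, by simp; positivity⟩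
  have : (i : ℝ) ≤ 2 ^ R := by exact_mod_cast hi.le
  gcongr

end HY

namespace HY

structure Good (F : ℝ → ℝ) (ρ : ℝ) (q : ℕ) (p : ℤ) (q' : ℕ) (p' : ℤ) (Φ : ℝ) : Prop
    extends Pair ρ q p q' p' where
  Φ0 : 0 < Φ
  Φ1 : Φ ≤ 1
  gM : ∀ x, G F q p x - x ≤ Φ ^ 2
  gδ : ∀ x, Real.exp |psi F q x| ≤ 1 + Φ

/-- `v' = u v` -/
lemma expbound (r : ℕ) (C : ℝ) (hC : 1 ≤ C) : ∃ C' : ℝ, 1 ≤ C' ∧ ∀ u v : ℝ → ℝ, Sm u → Sm v →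
    deriv v = (fun y => u y * v y) → ∀ x E : ℝ, 0 ≤ E →
    (∀ j ≤ r, |iteratedDeriv j u x| ≤ C * E ^ (j + 1)) →
    ∀ j ≤ r + 1, |iteratedDeriv j v x| ≤ C' * |v x| * E ^ j := by
  have : ∀ n ≤ r + 1, ∃ C' : ℝ, 1 ≤ C' ∧ ∀ u v : ℝ → ℝ, Sm u → Sm v →
    deriv v = (fun y => u y * v y) → ∀ x E : ℝ, 0 ≤ E →
    (∀ j ≤ r, |iteratedDeriv j u x| ≤ C * E ^ (j + 1)) →
    ∀ j ≤ n, |iteratedDeriv j v x| ≤ C' * |v x| * E ^ j := by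
    intro n
    induction n with
    | zero =>
      refine fun _ => ⟨1, le_rfl, fun u v _ _ _ x E _ _ j hj => ?_⟩
      obtain rfl : j = 0 := by omega
      simp
    | succ n ih =>
      intro hn
      obtain ⟨C', hC', IH⟩ := ih (by omega)
      have hD : C' ≤ 2 ^ n * C * C' := by
        have h1 : (1 : ℝ) ≤ 2 ^ n := one_le_pow₀ (by norm_num)
        have : (1 : ℝ) ≤ 2 ^ n * C := one_le_mul_of_one_le_of_one_le h1 hC
        nlinarith
      refine ⟨2 ^ n * C * C', hC'.trans hD, fun u v hu hv huv x E hE hj j hjn => ?_⟩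
      rcases Nat.lt_or_ge j (n + 1) with h1 | h1
      · refine (IH u v hu hv huv x E hE hj j (by omega)).trans ?_
        gcongr
      · obtain rfl : j = n + 1 := by omega
        rw [iteratedDeriv_succ', huv]
        refine (mul_bound hu hv (A := C * E) (B := C' * |v x|) (E := E) (fun i hi => ?_)
          (fun i hi => IH u v hu hv huv x E hE hj i hi)).trans (le_of_eq ?_)
        · refine (hj i (by omega)).trans (le_of_eq ?_); ring
        · ring
  exact this (r + 1) le_rfl

lemma per_idb {f : ℝ → ℝ} (hf : Sm f) (hper : ∀ x, f (x + 1) = f x) (r : ℕ) :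
    ∃ A, 1 ≤ A ∧ ∀ j ≤ r, ∀ x, |iteratedDeriv j f x| ≤ A := by
  have : ∀ j, ∃ A, 0 ≤ A ∧ ∀ x, |iteratedDeriv j f x| ≤ A := by
    intro j
    refine per_bdd (fun x => ?_) hf.id_.continuous
    have : (fun z => f (z + 1)) = f := by ext z; exact hper z
    have h2 := iteratedDeriv_comp_add_const j f 1
    rw [this] at h2
    exact (congrFun h2 x).symm
  choose A hA0 hA using this
  refine ⟨1 + ∑ j ∈ Finset.range (r + 1), A j, ?_, fun j hj x => (hA j x).trans ?_⟩
  · have := Finset.sum_nonneg (fun j (_ : j ∈ Finset.range (r + 1)) => hA0 j)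
    linarith
  · have := Finset.single_le_sum (fun j (_ : j ∈ Finset.range (r + 1)) => hA0 j)
      (a := j) (by simp; omega)
    linarith

section
variable {F : ℝ → ℝ} {ρ L : ℝ} (h : LiftL F ρ L)
include h

lemma LiftL.dd (l : ℕ) : deriv (deriv (F^[l])) = fun y => uu F l y * deriv (F^[l]) y := by
  ext y; exact (h.d_has l y).deriv

/-- derivative estimate for a single term -/
lemma LiftL.term (r : ℕ) (C : ℝ) (hC : 1 ≤ C) : ∃ K : ℝ, 0 ≤ K ∧ ∀ i : ℕ, ∀ x E : ℝ, 0 ≤ E →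
    (∀ j ≤ r, |iteratedDeriv j (uu F i) x| ≤ C * E ^ (j + 1)) →
    |iteratedDeriv r (fun y => SS F 1 (F^[i] y) * (deriv (F^[i]) y * deriv (F^[i]) y)) x| ≤
      K * (deriv (F^[i]) x ^ (r + 2) + deriv (F^[i]) x ^ 2 * E ^ r) := by
  obtain ⟨C', hC', H⟩ := expbound r C hC
  obtain ⟨A, hA1, hA⟩ := per_idb (h.Ssm 1) (h.Sper 1) r
  refine ⟨2 ^ r * ((r.factorial * A * C' ^ r) * (2 ^ r * (C' * C'))), by positivity,
    fun i x E hE hu => ?_⟩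
  set d := deriv (F^[i]) x with hd
  have hd0 : 0 < d := h.dpos i x
  set W := max d E with hW
  have hW0 : 0 < W := lt_max_of_lt_left hd0
  have hdW : d ≤ W := le_max_left _ _
  have hEW : E ≤ W := le_max_right _ _
  have hv : ∀ j ≤ r + 1, |iteratedDeriv j (deriv (F^[i])) x| ≤ C' * d * E ^ j := by
    intro j hj
    have := H _ _ (h.usm i) (h.dsm i) (h.dd i) x E hE hu j hj
    rwa [← hd, abs_of_pos hd0] at this
  have hv2 : ∀ j ≤ r, |iteratedDeriv j (deriv (F^[i])) x| ≤ (C' * d) * W ^ j := fun j hj =>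
    (hv j (by omega)).trans (by gcongr)
  have h1 : ∀ k ≤ r, |iteratedDeriv k (fun y => deriv (F^[i]) y * deriv (F^[i]) y) x| ≤
      (2 ^ r * (C' * d * (C' * d))) * W ^ k := by
    intro k hk
    refine (mul_bound (h.dsm i) (h.dsm i) (fun j hj => hv2 j (by omega))
      (fun j hj => hv2 j (by omega))).trans ?_
    rw [← mul_assoc]
    have : (2 : ℝ) ^ k ≤ 2 ^ r := pow_le_pow_right₀ (by norm_num) hk
    gcongr
  have h2 : ∀ k ≤ r, |iteratedDeriv k (fun y => SS F 1 (F^[i] y)) x| ≤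
      (r.factorial * A * C' ^ r) * W ^ k := by
    intro k hk
    rcases Nat.eq_zero_or_pos k with h0 | h0
    · subst h0
      simp only [iteratedDeriv_zero, pow_zero, mul_one]
      have h3 := hA 0 (by omega) (F^[i] x)
      simp only [iteratedDeriv_zero] at h3
      refine h3.trans ?_
      have h4 : (1 : ℝ) ≤ r.factorial := by exact_mod_cast r.factorial_pos
      have h5 : (1 : ℝ) ≤ C' ^ r := one_le_pow₀ hC'
      have : A * 1 ≤ A * (r.factorial * C' ^ r) :=
        mul_le_mul_of_nonneg_left (one_le_mul_of_one_le_of_one_le h4 h5) (by linarith)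
      linarith
    · refine (comp_bound (h.itsm i) (h.Ssm 1) (A := A) (N := 1) (D := C' * W) h0 one_pos
        (fun j _ hj => by simpa using hA j (by omega) _) (fun j hj1 hj => ?_)).trans ?_
      · obtain ⟨n, rfl⟩ : ∃ n, j = n + 1 := ⟨j - 1, by omega⟩
        rw [one_mul, iteratedDeriv_succ']
        refine (hv n (by omega)).trans ?_
        have h5 : C' ≤ C' ^ (n + 1) := le_self_pow₀ hC' (by omega)
        calc C' * d * E ^ n ≤ C' ^ (n + 1) * W * W ^ n := by gcongr
          _ = _ := by ring
      · rw [mul_pow, ← mul_assoc]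
        have h6 : (k.factorial : ℝ) ≤ r.factorial := by exact_mod_cast Nat.factorial_le hk
        have h5 : C' ^ k ≤ C' ^ r := pow_le_pow_right₀ hC' hk
        gcongr
  have h3 := mul_bound ((h.Ssm 1).comp (h.itsm i)) ((h.dsm i).mul (h.dsm i)) h2 h1
  refine h3.trans ?_
  have hWr : W ^ r ≤ d ^ r + E ^ r := by
    rcases max_cases d E with ⟨e, -⟩ | ⟨e, -⟩ <;> rw [hW, e]
    · have : 0 ≤ E ^ r := by positivity
      linarith
    · have : 0 ≤ d ^ r := by positivity
      linarith
  calc _ = 2 ^ r * ((r.factorial * A * C' ^ r) * (2 ^ r * (C' * C'))) * (d ^ 2 * W ^ r) := by ring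
    _ ≤ 2 ^ r * ((r.factorial * A * C' ^ r) * (2 ^ r * (C' * C'))) * (d ^ 2 * (d ^ r + E ^ r)) := by
      gcongr
    _ = _ := by ring

/-- B9 -/
lemma LiftL.b9 (r : ℕ) : ∃ C : ℝ, 1 ≤ C ∧ ∀ q p q' p' Φ, Good F ρ q p q' p' Φ →
    ∀ l ≤ q', ∀ x, ∀ j ≤ r, |iteratedDeriv j (uu F l) x| ≤ C * (Φ / (G F q p x - x)) ^ (j + 1) := by
  have L0 := h.L0
  induction r with
  | zero =>
    refine ⟨1 + (2 * Real.exp L + L * Real.exp L ^ 4) * 2,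
      by have := Real.exp_pos L; have : 0 ≤ (2 * Real.exp L + L * Real.exp L ^ 4) * 2 := (by positivity)
         linarith,
      fun q p q' p' Φ hg l hl x j hj => ?_⟩
    obtain rfl : j = 0 := by omega
    have hm : 0 < G F q p x - x := by linarith [hg.g_gt h.toLift x]
    have h1 := hg.toPair.u_le h hg.gM hg.gδ x hl
    have h0 := hg.Φ0
    have h2 := hg.Φ1
    simp only [iteratedDeriv_zero, zero_add, pow_one]
    rw [← mul_div_assoc, le_div_iff₀ hm]
    refine h1.trans ?_
    have h3 : Φ + Φ ^ 2 ≤ 2 * Φ := by nlinarith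
    have h4 : 0 ≤ (2 * Real.exp L + L * Real.exp L ^ 4) := by positivity
    nlinarith
  | succ r ih =>
    obtain ⟨C, hC, IH⟩ := ih
    obtain ⟨K, hK, HK⟩ := h.term r C hC
    refine ⟨C + (K * (Real.exp L ^ (r + 2) + Real.exp L ^ 2) + 2 ^ r * C ^ 2), ?_,
      fun q p q' p' Φ hg l hl x j hj => ?_⟩
    · have : 0 ≤ K * (Real.exp L ^ (r + 2) + Real.exp L ^ 2) + 2 ^ r * C ^ 2 := by positivity
      linarith
    have hm : 0 < G F q p x - x := by linarith [hg.g_gt h.toLift x]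
    have h0 := hg.Φ0
    set m := G F q p x - x with hmd
    set E := Φ / m with hE
    have hE0 : 0 < E := by positivity
    have hK1 : 0 ≤ K * (Real.exp L ^ (r + 2) + Real.exp L ^ 2) + 2 ^ r * C ^ 2 := by positivity
    rcases Nat.lt_or_ge j (r + 1) with h1 | h1
    · refine (IH q p q' p' Φ hg l hl x j (by omega)).trans ?_
      rw [← hmd, ← hE]
      gcongr; linarith
    obtain rfl : j = r + 1 := by omega
    have hdu : deriv (uu F l) = fun y => SS F l y + (1 / 2) * (uu F l y * uu F l y) := by
      ext y; rw [SS]; ring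
    have hu2 : |iteratedDeriv r (fun y => uu F l y * uu F l y) x| ≤ 2 ^ r * (C * E * (C * E) * E ^ r) :=
      mul_bound (h.usm l) (h.usm l)
        (fun i hi => (IH q p q' p' Φ hg l hl x i hi).trans (le_of_eq (by rw [← hmd, ← hE]; ring)))
        (fun i hi => (IH q p q' p' Φ hg l hl x i hi).trans (le_of_eq (by rw [← hmd, ← hE]; ring)))
    have hS : |iteratedDeriv r (SS F l) x| ≤ K * (Real.exp L ^ (r + 2) + Real.exp L ^ 2) * E ^ (r + 2) := by
      have e : SS F l = fun y => ∑ i ∈ Finset.range l,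
          SS F 1 (F^[i] y) * (deriv (F^[i]) y * deriv (F^[i]) y) := by
        ext y; rw [h.S_sum]; simp only [pow_two]
      have hsm : ∀ i, Sm (fun y => SS F 1 (F^[i] y) * (deriv (F^[i]) y * deriv (F^[i]) y)) :=
        fun i => ((h.Ssm 1).comp (h.itsm i)).mul ((h.dsm i).mul (h.dsm i))
      rw [e, iteratedDeriv_fun_sum (fun i _ => (hsm i).at r x)]
      refine (Finset.abs_sum_le_sum_abs _ _).trans ?_
      refine (Finset.sum_le_sum fun i hi => HK i x E hE0.le
        (fun j hj => IH q p q' p' Φ hg i (by simp at hi; omega) x j hj)).trans ?_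
      rw [← Finset.mul_sum, Finset.sum_add_distrib, ← Finset.sum_mul, mul_assoc]
      refine mul_le_mul_of_nonneg_left ?_ hK
      have hx : x ∈ Set.Icc x (G F q p x) := ⟨le_rfl, by linarith⟩
      have s1 := hg.toPair.sum_pow h hg.gM hx (r + 1) hl
      have s2 := hg.toPair.sum_pow h hg.gM hx 1 hl
      rw [← hmd] at s1 s2
      have t1 : Real.exp L ^ (r + 1 + 1) * (Φ ^ 2) ^ (r + 1) / m ^ (r + 1 + 1)
          ≤ Real.exp L ^ (r + 2) * E ^ (r + 2) := by
        rw [hE, div_pow, mul_div_assoc]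
        have : (Φ ^ 2) ^ (r + 1) ≤ Φ ^ (r + 2) := by
          rw [← pow_mul]; exact pow_le_pow_of_le_one h0.le hg.Φ1 (by omega)
        gcongr
      have t2 : Real.exp L ^ (1 + 1) * (Φ ^ 2) ^ 1 / m ^ (1 + 1) = Real.exp L ^ 2 * E ^ 2 := by
        rw [hE, div_pow]; ring
      rw [t2] at s2
      calc _ ≤ Real.exp L ^ (r + 2) * E ^ (r + 2) + Real.exp L ^ 2 * E ^ 2 * E ^ r := by
            refine add_le_add (s1.trans t1) ?_
            gcongr
        _ = _ := by ring
    rw [iteratedDeriv_succ', hdu]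
    have e2 : iteratedDeriv r (fun y => SS F l y + (1 / 2) * (uu F l y * uu F l y)) x
        = iteratedDeriv r (SS F l) x + (1 / 2) * iteratedDeriv r (fun y => uu F l y * uu F l y) x := by
      rw [← iteratedDeriv_const_mul_field]
      exact iteratedDeriv_add (Sm.at (h.Ssm l) r x)
        (Sm.at (contDiff_const.mul ((h.usm l).mul (h.usm l))) r x)
    rw [e2]
    refine (abs_add_le _ _).trans ?_
    rw [abs_mul, abs_of_pos (by norm_num : (0 : ℝ) < 1 / 2)]
    have hX : 0 ≤ 2 ^ r * C ^ 2 * E ^ (r + 2) := by positivity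
    have hY : 0 ≤ C * E ^ (r + 2) := by positivity
    have e3 : 2 ^ r * (C * E * (C * E) * E ^ r) = 2 ^ r * C ^ 2 * E ^ (r + 2) := by ring
    rw [e3] at hu2
    have e4 : r + 1 + 1 = r + 2 := rfl
    rw [e4]
    linarith

/-- B9, derivatives of iterates -/
lemma LiftL.b9' (r : ℕ) : ∃ C : ℝ, 1 ≤ C ∧ ∀ q p q' p' Φ, Good F ρ q p q' p' Φ →
    ∀ l ≤ q', ∀ x, ∀ j ≤ r, |iteratedDeriv j (deriv (F^[l])) x| ≤
      C * deriv (F^[l]) x * (Φ / (G F q p x - x)) ^ j := by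
  obtain ⟨C, hC, H⟩ := h.b9 r
  obtain ⟨C', hC', H'⟩ := expbound r C hC
  refine ⟨C', hC', fun q p q' p' Φ hg l hl x j hj => ?_⟩
  have hm : 0 < G F q p x - x := by linarith [hg.g_gt h.toLift x]
  have h0 := hg.Φ0
  have := H' _ _ (h.usm l) (h.dsm l) (h.dd l) x (Φ / (G F q p x - x)) (by positivity)
    (fun j hj => H q p q' p' Φ hg l hl x j hj) j (by omega)
  rwa [abs_of_pos (h.dpos l x)] at this

end
end HY

namespace HY

lemma arch_le {a b c : ℝ} (h : ∀ N : ℕ, N * a ≤ N * b + c) : a ≤ b := by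
  by_contra hcon
  push Not at hcon
  obtain ⟨N, hN⟩ := exists_nat_gt (c / (a - b))
  rw [div_lt_iff₀ (by linarith)] at hN
  nlinarith [h N]

lemma b10_alg {C3 Φ b m lam κ : ℝ} (hC3p : 1 ≤ C3) (h0 : 0 < Φ) (hΦ8 : Φ ≤ 1 / 8)
    (hΦC : Φ * C3 ≤ 1 / 2) (hm : 0 < m) (hb : 0 < b) (hlam : 0 < lam) (K : ℕ)
    (hκ : κ = C3 * (Φ * b + Φ ^ K * m)) (hup : lam * (m * (1 - Φ)) ≤ b + κ)
    (hlo : b - κ ≤ lam * (m * (1 + Φ))) :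
    |b - lam * m| ≤ (1 + 5 * C3 ^ 2) * (Φ * lam + Φ ^ K) * m := by
  have hlm : 0 < lam * m := by positivity
  have hP : 0 ≤ Φ ^ K * m := by positivity
  have hCP : 0 ≤ C3 * (Φ ^ K * m) := by positivity
  have hb2 : b ≤ 4 * (lam * m) + 2 * C3 * (Φ ^ K * m) := by
    have e1 : C3 * (Φ * b) ≤ 1 / 2 * b := by
      have := mul_le_mul_of_nonneg_right hΦC hb.le
      linarith
    have e2 : lam * (m * (1 + Φ)) ≤ 2 * (lam * m) := by
      have := mul_le_mul_of_nonneg_left hΦ8 hlm.le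
      linarith
    rw [hκ] at hlo
    linarith
  have hκb : κ ≤ 4 * C3 * (Φ * (lam * m)) + 2 * C3 * (Φ ^ K * m) := by
    have h1 : C3 * (Φ * b) ≤ C3 * (Φ * (4 * (lam * m) + 2 * C3 * (Φ ^ K * m))) := by gcongr
    have h2 : C3 * (Φ * (2 * C3 * (Φ ^ K * m))) = 2 * (Φ * C3) * (C3 * (Φ ^ K * m)) := by ring
    have h3 : 2 * (Φ * C3) * (C3 * (Φ ^ K * m)) ≤ 1 * (C3 * (Φ ^ K * m)) :=
      mul_le_mul_of_nonneg_right (by linarith) hCP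
    rw [hκ]
    linarith
  have hfin : |b - lam * m| ≤ Φ * (lam * m) + κ := by
    rw [abs_le]; constructor <;> linarith
  refine hfin.trans ?_
  have hZ : 0 ≤ Φ * (lam * m) := by positivity
  have hC33 : C3 ≤ C3 ^ 2 := by nlinarith
  have h6 : 4 * C3 * (Φ * (lam * m)) ≤ 5 * C3 ^ 2 * (Φ * (lam * m)) :=
    mul_le_mul_of_nonneg_right (by nlinarith) hZ
  have h7 : 2 * C3 * (Φ ^ K * m) ≤ 5 * C3 ^ 2 * (Φ ^ K * m) :=
    mul_le_mul_of_nonneg_right (by nlinarith) hP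
  linarith

section
variable {F : ℝ → ℝ} {ρ L : ℝ} (h : LiftL F ρ L) {q : ℕ} {p : ℤ} {q' : ℕ} {p' : ℤ} {Φ : ℝ}

include h

lemma Good.dG (hg : Good F ρ q p q' p' Φ) (x : ℝ) :
    |deriv (F^[q]) x - 1| ≤ Φ := by
  have h1 := hg.gδ x
  have h0 := hg.Φ0
  rw [← h.exp_psi q x, abs_le]
  have h2 : Real.exp (psi F q x) ≤ 1 + Φ := (Real.exp_le_exp.mpr (le_abs_self _)).trans h1
  have h3 : Real.exp (-psi F q x) ≤ 1 + Φ := (Real.exp_le_exp.mpr (neg_le_abs _)).trans h1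
  rw [Real.exp_neg] at h3
  have h4 := Real.exp_pos (psi F q x)
  rw [inv_le_iff_one_le_mul₀ h4] at h3
  constructor
  · nlinarith
  · linarith

lemma Good.G_lip (hg : Good F ρ q p q' p' Φ) {x y : ℝ} (hxy : x ≤ y) :
    |(G F q p y - y) - (G F q p x - x)| ≤ Φ * (y - x) := by
  have := abs_sub_le_of_deriv (f := fun z => G F q p z - z) (a := x) (b := y) (C := Φ)
    (fun z => (h.G_has q p z).sub (hasDerivAt_id z)) (fun z _ => hg.dG h z)
    (x := x) (y := y) ⟨le_rfl, hxy⟩ ⟨hxy, le_rfl⟩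
  rwa [abs_of_nonneg (by linarith : 0 ≤ y - x)] at this

/-- rotation argument, upper -/
lemma Good.rot_up (hg : Good F ρ q p q' p' Φ) {x β : ℝ} (hΦ : Φ < 1) (hβ0 : 0 ≤ β)
    (hβ : ∀ y ∈ Set.Icc x (G F q p (G F q p x)), y - G F q' p' y ≤ β) :
    (p' - q' * ρ) / (q * ρ - p) * ((G F q p x - x) * (1 - Φ)) ≤ β := by
  have a0 := hg.a0
  have a1 := hg.a1
  have h0 := hg.Φ0
  have hm : 0 < G F q p x - x := by linarith [hg.g_gt h.toLift x]
  have hgg := hg.g_gt h.toLift (G F q p x)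
  set m := G F q p x - x with hmd
  have hm1 : 0 < m * (1 - Φ) := mul_pos hm (by linarith)
  rw [← le_div_iff₀ hm1]
  set c := β / (m * (1 - Φ)) with hc
  have hc0 : 0 ≤ c := by positivity
  have hcβ : c * (m * (1 - Φ)) = β := div_mul_cancel₀ _ hm1.ne'
  rcases le_total 1 c with hc1 | hc1
  · refine le_trans ?_ hc1
    rw [div_le_one (by linarith)]; exact a1.le
  have P : ∀ N : ℕ, ∃ (j : ℕ) (t : ℝ), 0 ≤ t ∧ t ≤ 1 ∧ j + t ≤ c * N ∧
      x ≤ G F (N * q' + j * q) (N * p' + j * p) (x + t * m) := by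
    intro N
    induction N with
    | zero => exact ⟨0, 0, le_rfl, by norm_num, by simp, by simp [G]⟩
    | succ N ih =>
      obtain ⟨j, t, t0, t1, hjt, hx⟩ := ih
      rcases le_total (t + c) 1 with h1 | h1
      · refine ⟨j, t + c, by linarith, h1, by push_cast; linarith, ?_⟩
        refine hx.trans ?_
        have e := h.GG_eq (N * q' + j * q) (N * p' + j * p) q' p' (x + (t + c) * m)
        have e1 : N * q' + j * q + q' = (N + 1) * q' + j * q := by ring
        have e2 : (N * p' + j * p + p' : ℤ) = ((N + 1 : ℕ) : ℤ) * p' + j * p := by push_cast; ring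
        rw [e1, e2] at e
        rw [← e]
        refine (h.G_mono _ _).monotone ?_
        have hb := hβ (x + (t + c) * m) ⟨by nlinarith, by nlinarith⟩
        have : β ≤ c * m := by rw [← hcβ]; nlinarith [mul_nonneg hc0 (mul_nonneg hm.le h0.le)]
        linarith
      · refine ⟨j + 1, t + c - 1, by linarith, by linarith, by push_cast; linarith, ?_⟩
        refine hx.trans ?_
        set t' := t + c - 1 with ht'
        have e := h.GG_eq (N * q' + j * q) (N * p' + j * p) (q' + q) (p' + p) (x + t' * m)
        have e1 : N * q' + j * q + (q' + q) = (N + 1) * q' + (j + 1) * q := by ring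
        have e2 : (N * p' + j * p + (p' + p) : ℤ) = ((N + 1 : ℕ) : ℤ) * p' + ((j + 1 : ℕ) : ℤ) * p := by
          push_cast; ring
        rw [e1, e2] at e
        rw [← e, ← h.GG_eq q' p' q p]
        refine (h.G_mono _ _).monotone ?_
        have t'0 : 0 ≤ t' := by linarith
        have t'1 : t' ≤ 1 := by linarith
        have hl := hg.G_lip h (x := x) (y := x + t' * m) (by nlinarith)
        rw [abs_le] at hl
        have hle : x + t' * m ≤ G F q p x := by nlinarith
        have hin : G F q p (x + t' * m) ∈ Set.Icc x (G F q p (G F q p x)) :=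
          ⟨(by linarith : x ≤ G F q p x).trans ((h.G_mono q p).monotone (by nlinarith)),
            (h.G_mono q p).monotone hle⟩
        have hb := hβ _ hin
        have : (1 - t) * (m * Φ) ≥ 0 := mul_nonneg (by linarith) (by positivity)
        nlinarith
  have hkey : ∀ N : ℕ, N * ((p' - q' * ρ) / (q * ρ - p)) ≤ N * c + 1 := by
    intro N
    obtain ⟨j, t, t0, t1, hjt, hx⟩ := P N
    have h1 : x ≤ G F (N * q' + j * q) (N * p' + j * p) (G F q p x) :=
      hx.trans ((h.G_mono _ _).monotone (by nlinarith))
    rw [h.GG_eq] at h1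
    have h2 := h.G_le_inv _ _ _ h1
    push_cast at h2
    rw [← mul_div_assoc, div_le_iff₀ (by linarith)]
    have h3 : ((j : ℝ) + 1) * (q * ρ - p) ≤ (N * c + 1) * (q * ρ - p) :=
      mul_le_mul_of_nonneg_right (by linarith) (by linarith)
    linarith
  exact arch_le hkey

/-- rotation argument, lower -/
lemma Good.rot_lo (hg : Good F ρ q p q' p' Φ) {x β : ℝ} (hβ0 : 0 ≤ β)
    (hβ : ∀ y ∈ Set.Icc x (G F q p (G F q p x)), β ≤ y - G F q' p' y) :
    β ≤ (p' - q' * ρ) / (q * ρ - p) * ((G F q p x - x) * (1 + Φ)) := by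
  have a0 := hg.a0
  have a1 := hg.a1
  have h0 := hg.Φ0
  have hm : 0 < G F q p x - x := by linarith [hg.g_gt h.toLift x]
  have hgg := hg.g_gt h.toLift (G F q p x)
  have hr1 := hg.r_le_one h x
  set m := G F q p x - x with hmd
  have hm1 : 0 < m * (1 + Φ) := mul_pos hm (by linarith)
  rw [← div_le_iff₀ hm1]
  set c := β / (m * (1 + Φ)) with hc
  have hc0 : 0 ≤ c := by positivity
  have hcβ : c * (m * (1 + Φ)) = β := div_mul_cancel₀ _ hm1.ne'
  have hc1 : c ≤ 1 := by
    rw [hc, div_le_one hm1]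
    have := hβ (G F q p x) ⟨by linarith, hgg.le⟩
    nlinarith
  have P : ∀ N : ℕ, ∃ (j : ℕ) (t : ℝ), 0 ≤ t ∧ t ≤ 1 ∧ c * N ≤ j + t ∧
      G F (N * q' + j * q) (N * p' + j * p) (x + t * m) ≤ x := by
    intro N
    induction N with
    | zero => exact ⟨0, 0, le_rfl, by norm_num, by simp, by simp [G]⟩
    | succ N ih =>
      obtain ⟨j, t, t0, t1, hjt, hx⟩ := ih
      rcases le_total (t + c) 1 with h1 | h1
      · refine ⟨j, t + c, by linarith, h1, by push_cast; linarith, ?_⟩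
        refine le_trans ?_ hx
        have e := h.GG_eq (N * q' + j * q) (N * p' + j * p) q' p' (x + (t + c) * m)
        have e1 : N * q' + j * q + q' = (N + 1) * q' + j * q := by ring
        have e2 : (N * p' + j * p + p' : ℤ) = ((N + 1 : ℕ) : ℤ) * p' + j * p := by push_cast; ring
        rw [e1, e2] at e
        rw [← e]
        refine (h.G_mono _ _).monotone ?_
        have hb := hβ (x + (t + c) * m) ⟨by nlinarith, by nlinarith⟩
        have : c * m ≤ β := by rw [← hcβ]; nlinarith [mul_nonneg hc0 (mul_nonneg hm.le h0.le)]
        linarith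
      · refine ⟨j + 1, t + c - 1, by linarith, by linarith, by push_cast; linarith, ?_⟩
        refine le_trans ?_ hx
        set t' := t + c - 1 with ht'
        have e := h.GG_eq (N * q' + j * q) (N * p' + j * p) (q' + q) (p' + p) (x + t' * m)
        have e1 : N * q' + j * q + (q' + q) = (N + 1) * q' + (j + 1) * q := by ring
        have e2 : (N * p' + j * p + (p' + p) : ℤ) = ((N + 1 : ℕ) : ℤ) * p' + ((j + 1 : ℕ) : ℤ) * p := by
          push_cast; ring
        rw [e1, e2] at e
        rw [← e, ← h.GG_eq q' p' q p]
        refine (h.G_mono _ _).monotone ?_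
        have t'0 : 0 ≤ t' := by linarith
        have t'1 : t' ≤ 1 := by linarith
        have hl := hg.G_lip h (x := x) (y := x + t' * m) (by nlinarith)
        rw [abs_le] at hl
        have hle : x + t' * m ≤ G F q p x := by nlinarith
        have hin : G F q p (x + t' * m) ∈ Set.Icc x (G F q p (G F q p x)) :=
          ⟨(by linarith : x ≤ G F q p x).trans ((h.G_mono q p).monotone (by nlinarith)),
            (h.G_mono q p).monotone hle⟩
        have hb := hβ _ hin
        have : (1 - t) * (m * Φ) ≥ 0 := mul_nonneg (by linarith) (by positivity)
        nlinarith
  have hkey : ∀ N : ℕ, N * c ≤ N * ((p' - q' * ρ) / (q * ρ - p)) + 1 := by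
    intro N
    obtain ⟨j, t, t0, t1, hjt, hx⟩ := P N
    have h1 : G F (N * q' + j * q) (N * p' + j * p) x ≤ x :=
      ((h.G_mono _ _).monotone (by nlinarith)).trans hx
    have h2 := h.G_ge_inv _ _ _ h1
    push_cast at h2
    have h3 : (N * c - 1) * (q * ρ - p) ≤ j * (q * ρ - p) :=
      mul_le_mul_of_nonneg_right (by linarith) (by linarith)
    have h4 : N * ((p' - q' * ρ) / (q * ρ - p)) * (q * ρ - p) = N * (p' - q' * ρ) := by
      rw [mul_assoc, div_mul_cancel₀ _ (by linarith : (0 : ℝ) < q * ρ - p).ne']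
    have : (N * c - 1) * (q * ρ - p) ≤ N * ((p' - q' * ρ) / (q * ρ - p)) * (q * ρ - p) := by
      rw [h4]; linarith
    have := le_of_mul_le_mul_right this (by linarith)
    linarith
  exact arch_le hkey

/-- B10 -/
lemma LiftL.b10 (K : ℕ) (hK : 1 ≤ K) : ∃ C e : ℝ, 1 ≤ C ∧ 0 < e ∧ ∀ q p q' p' Φ,
    Good F ρ q p q' p' Φ → Φ ≤ e → ∀ x,
    |(x - G F q' p' x) - (p' - q' * ρ) / (q * ρ - p) * (G F q p x - x)| ≤
      C * (Φ * ((p' - q' * ρ) / (q * ρ - p)) + Φ ^ K) * (G F q p x - x) := by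
  set R := K + 1 with hR
  obtain ⟨C1, hC1, H1⟩ := h.b9' K
  set T : ℝ := 2 * 2 ^ R with hT
  have hT2 : (4 : ℝ) ≤ T := by
    have : (2 : ℝ) ^ 1 ≤ 2 ^ R := pow_le_pow_right₀ (by norm_num) (by omega)
    rw [hT]; linarith
  obtain ⟨C2, hC2, H2⟩ := interp R (2 * T) (by positivity)
  set C3 : ℝ := 1 + C2 * (2 ^ (2 ^ R) + C1 * Real.exp (2 * L) * 2 ^ K) with hC3
  have hC3p : 1 ≤ C3 := by
    have : 0 ≤ C2 * (2 ^ (2 ^ R) + C1 * Real.exp (2 * L) * 2 ^ K) := by positivity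
    linarith
  set e : ℝ := min (1 / (2 * T)) (1 / (2 * C3)) with he
  refine ⟨1 + 5 * C3 ^ 2, e, by nlinarith, by positivity, fun q p q' p' Φ hg hΦe x => ?_⟩
  have hT0 : 0 < T := by linarith
  have hC30 : 0 < C3 := by linarith
  rw [he] at hΦe
  clear_value C3 T e
  have hΦT : Φ * T ≤ 1 / 2 := by
    have := hΦe.trans (min_le_left _ _)
    rw [le_div_iff₀ (by positivity)] at this
    linarith
  have hΦC : Φ * C3 ≤ 1 / 2 := by
    have := hΦe.trans (min_le_right _ _)
    rw [le_div_iff₀ (by positivity)] at this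
    linarith
  have h0 := hg.Φ0
  have hΦ8 : Φ ≤ 1 / 8 := by
    have := mul_le_mul_of_nonneg_left hT2 h0.le
    linarith
  have a0 := hg.a0
  have a1 := hg.a1
  have hm : 0 < G F q p x - x := by linarith [hg.g_gt h.toLift x]
  have hb : 0 < x - G F q' p' x := by linarith [hg.g'_lt h.toLift x]
  set m := G F q p x - x with hmd
  set b := x - G F q' p' x with hbd
  clear_value m b
  have hTm : 4 * m ≤ T * m := mul_le_mul_of_nonneg_right hT2 hm.le
  have hΦTm : Φ * T * m ≤ 1 / 2 * m := mul_le_mul_of_nonneg_right hΦT hm.le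
  have hiTm : ∀ i : ℕ, i ≤ 2 ^ R → (3 / 2) * i * m ≤ T * m := by
    intro i hi
    have hiT : (i : ℝ) ≤ 2 ^ R := by exact_mod_cast hi
    refine mul_le_mul_of_nonneg_right ?_ hm.le
    rw [hT]
    have : (0 : ℝ) ≤ i := Nat.cast_nonneg i
    linarith
  -- comparison of m on J
  have hJ : ∀ y ∈ Set.Icc x (x + T * m), |(G F q p y - y) - m| ≤ m / 2 := by
    intro y hy
    have := hg.G_lip h hy.1
    rw [← hmd] at this
    refine this.trans ?_
    have : Φ * (y - x) ≤ Φ * (T * m) := mul_le_mul_of_nonneg_left (by linarith [hy.2]) h0.le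
    linarith
  set z : ℕ → ℝ := fun i => (G F q p)^[i] x with hz
  have hzs : ∀ i, z (i + 1) = G F q p (z i) := fun i => Function.iterate_succ_apply' _ _ _
  have hzb : ∀ i, i ≤ 2 ^ R → x ≤ z i ∧ z i ≤ x + (3 / 2) * i * m := by
    intro i
    induction i with
    | zero => intro _; simp [hz]
    | succ i ih =>
      intro hi
      obtain ⟨i1, i2⟩ := ih (by omega)
      have := hJ (z i) ⟨i1, by linarith [hiTm i (by omega)]⟩
      rw [abs_le] at this
      rw [hzs]
      push_cast
      constructor <;> linarith
  have hzJ : ∀ i, i ≤ 2 ^ R → z i ∈ Set.Icc x (x + T * m) := by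
    intro i hi
    obtain ⟨i1, i2⟩ := hzb i hi
    exact ⟨i1, by linarith [hiTm i hi]⟩
  have hBstep : ∀ y, |(G F q p y - G F q' p' (G F q p y)) - (y - G F q' p' y)| ≤
      Φ * (y - G F q' p' y) := by
    intro y
    have := hg.G_lip h (hg.g'_lt h.toLift y).le
    rw [h.GG_comm] at this
    convert this using 2
    ring
  have hBz : ∀ i, z i - G F q' p' (z i) ≤ 2 ^ i * b ∧
      |(z i - G F q' p' (z i)) - b| ≤ (2 ^ i - 1) * (Φ * b) := by
    intro i
    induction i with
    | zero => simp [hz, hbd]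
    | succ i ih =>
      obtain ⟨i1, i2⟩ := ih
      have h3 := hBstep (z i)
      rw [← hzs] at h3
      have h4 : Φ * (z i - G F q' p' (z i)) ≤ Φ * (2 ^ i * b) := mul_le_mul_of_nonneg_left i1 h0.le
      have h5 : Φ * (2 ^ i * b) ≤ 1 * (2 ^ i * b) :=
        mul_le_mul_of_nonneg_right (by linarith) (by positivity)
      rw [abs_le] at h3 i2
      rw [abs_le, pow_succ]
      refine ⟨by linarith, by linarith, by linarith⟩
  have hBsm : Sm (fun y => (y - G F q' p' y) - b) :=
    (contDiff_id.sub ((h.itsm q').sub contDiff_const)).sub contDiff_const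
  have hder : ∀ y, iteratedDeriv R (fun y => (y - G F q' p' y) - b) y =
      - iteratedDeriv K (deriv (F^[q'])) y := by
    intro y
    obtain ⟨k, rfl⟩ : ∃ k, K = k + 1 := ⟨K - 1, by omega⟩
    rw [hR, iteratedDeriv_succ', iteratedDeriv_succ']
    have e1 : deriv (fun y => (y - G F q' p' y) - b) = fun y => 1 - deriv (F^[q']) y := by
      ext y
      exact (((hasDerivAt_id y).sub (h.G_has q' p' y)).sub_const b).deriv
    have e2 : deriv (fun y => 1 - deriv (F^[q']) y) = fun y => - deriv (deriv (F^[q'])) y := by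
      ext y
      rw [deriv_const_sub]
    rw [e1, e2, iteratedDeriv_fun_neg, ← iteratedDeriv_succ', iteratedDeriv_succ']
  have hΛ : ∀ y ∈ Set.Icc x (x + T * m),
      |iteratedDeriv R (fun y => (y - G F q' p' y) - b) y| ≤
        C1 * Real.exp (2 * L) * (2 * Φ / m) ^ K := by
    intro y hy
    rw [hder, abs_neg]
    have hmy := hJ y hy
    rw [abs_le] at hmy
    refine (H1 q p q' p' Φ hg q' le_rfl y K le_rfl).trans ?_
    have hd : deriv (F^[q']) y ≤ Real.exp (2 * L) := by
      rw [← h.exp_psi]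
      exact Real.exp_le_exp.mpr ((le_abs_self _).trans (hg.toPair.denjoy h y))
    have hd0 := h.dpos q' y
    have hq : Φ / (G F q p y - y) ≤ 2 * Φ / m := by
      rw [div_le_div_iff₀ (by linarith) hm]
      have : Φ * m ≤ Φ * (2 * (G F q p y - y)) := mul_le_mul_of_nonneg_left (by linarith) h0.le
      linarith
    have hq0 : 0 ≤ Φ / (G F q p y - y) := div_nonneg h0.le (by linarith)
    gcongr
  have hI := H2 _ hBsm x (x + T * m) (m / 2) (2 ^ (2 ^ R) * (Φ * b))
    (C1 * Real.exp (2 * L) * (2 * Φ / m) ^ K) (by positivity) (by linarith) z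
    (fun i hi => by
      have := hJ (z i) (hzJ i (by omega))
      rw [abs_le] at this
      rw [hzs]; linarith)
    (fun i hi => hzJ i hi.le)
    (fun i hi => by
      refine (hBz i).2.trans ?_
      have : (2 : ℝ) ^ i ≤ 2 ^ (2 ^ R) := pow_le_pow_right₀ (by norm_num) hi.le
      exact mul_le_mul_of_nonneg_right (by linarith) (by positivity))
    hΛ 0 (by omega)
  obtain ⟨κ, hκ⟩ : ∃ κ, κ = C3 * (Φ * b + Φ ^ K * m) := ⟨_, rfl⟩
  have hB : ∀ y ∈ Set.Icc x (x + T * m), |(y - G F q' p' y) - b| ≤ κ := by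
    intro y hy
    have := hI y hy
    simp only [iteratedDeriv_zero, pow_zero, mul_one] at this
    refine this.trans ?_
    have e1 : C1 * Real.exp (2 * L) * (2 * Φ / m) ^ K * (m / 2) ^ R =
        C1 * Real.exp (2 * L) * 2 ^ K * (1 / 2) ^ R * (Φ ^ K * m) := by
      rw [hR, div_pow, mul_pow, div_pow, div_pow]
      field_simp
      ring
    rw [e1]
    have h2 : ((1 : ℝ) / 2) ^ R ≤ 1 := pow_le_one₀ (by norm_num) (by norm_num)
    have hP : 0 ≤ Φ ^ K * m := by positivity
    have hQ : 0 ≤ Φ * b := by positivity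
    have hE : 0 ≤ C1 * Real.exp (2 * L) * 2 ^ K := by positivity
    have h3 : C1 * Real.exp (2 * L) * 2 ^ K * (1 / 2) ^ R * (Φ ^ K * m) ≤
        C1 * Real.exp (2 * L) * 2 ^ K * (Φ ^ K * m) := by
      exact mul_le_mul_of_nonneg_right (mul_le_of_le_one_right hE h2) hP
    have h4 : 2 ^ (2 ^ R) * (Φ * b) + C1 * Real.exp (2 * L) * 2 ^ K * (Φ ^ K * m) ≤
      (2 ^ (2 ^ R) + C1 * Real.exp (2 * L) * 2 ^ K) * (Φ * b + Φ ^ K * m) := by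
      have : (0 : ℝ) ≤ 2 ^ (2 ^ R) * (Φ ^ K * m) := by positivity
      have := mul_nonneg hE hQ
      linarith
    have h5 : C2 * (2 ^ (2 ^ R) * (Φ * b) + C1 * Real.exp (2 * L) * 2 ^ K * (1 / 2) ^ R * (Φ ^ K * m))
       ≤ C2 * ((2 ^ (2 ^ R) + C1 * Real.exp (2 * L) * 2 ^ K) * (Φ * b + Φ ^ K * m)) :=
      mul_le_mul_of_nonneg_left (by linarith) hC2
    rw [hκ, hC3]
    linarith
  have hsub : ∀ y ∈ Set.Icc x (G F q p (G F q p x)), y ∈ Set.Icc x (x + T * m) := by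
    intro y hy
    refine ⟨hy.1, hy.2.trans ?_⟩
    have := hJ (G F q p x) ⟨by linarith, by linarith⟩
    rw [abs_le] at this
    linarith
  have hκ0 : 0 ≤ κ := by
    rw [hκ]
    exact mul_nonneg (by linarith) (add_nonneg (mul_nonneg h0.le hb.le)
      (mul_nonneg (pow_nonneg h0.le K) hm.le))
  have hup := hg.rot_up h (x := x) (β := b + κ) (by linarith) (by linarith)
    (fun y hy => by have := hB y (hsub y hy); rw [abs_le] at this; linarith)
  rw [← hmd] at hup
  have hlam : 0 < (p' - q' * ρ) / (q * ρ - p) := div_pos a0 (by linarith)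
  set lam := (p' - q' * ρ) / (q * ρ - p) with hlamd
  have hlo : b - κ ≤ lam * (m * (1 + Φ)) := by
    rcases le_total 0 (b - κ) with h1 | h1
    · rw [hmd]
      exact hg.rot_lo h h1
        (fun y hy => by have := hB y (hsub y hy); rw [abs_le] at this; linarith)
    · refine h1.trans (by positivity)
  exact b10_alg hC3p h0 hΦ8 hΦC hm hb hlam K hκ hup hlo

end
end HY

namespace HY

def rf (F : ℝ → ℝ) (x : ℝ) : ℝ := -F (-x)

lemma rf_it (F : ℝ → ℝ) (n : ℕ) (x : ℝ) : (rf F)^[n] x = -F^[n] (-x) := by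
  induction n with
  | zero => simp
  | succ n ih => rw [Function.iterate_succ_apply', Function.iterate_succ_apply', ih, rf, neg_neg]

lemma rf_it' (F : ℝ → ℝ) (n : ℕ) : (rf F)^[n] = fun x => -F^[n] (-x) := by
  ext x; exact rf_it F n x

lemma rf_d (F : ℝ → ℝ) (n : ℕ) (x : ℝ) : deriv ((rf F)^[n]) x = deriv (F^[n]) (-x) := by
  rw [rf_it', deriv.fun_neg, deriv_comp_neg, neg_neg]

lemma rf_psi (F : ℝ → ℝ) (n : ℕ) (x : ℝ) : psi (rf F) n x = psi F n (-x) := by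
  rw [psi, psi, rf_d]

lemma rf_G (F : ℝ → ℝ) (q : ℕ) (p : ℤ) (x : ℝ) : G (rf F) q (-p) x = -G F q p (-x) := by
  rw [G, G, rf_it]; push_cast; ring

lemma Lift.rf {F : ℝ → ℝ} {ρ : ℝ} (h : Lift F ρ) : Lift (rf F) (-ρ) where
  sm := (h.sm.comp contDiff_neg).neg
  per := fun x => by
    have := h.fsub 1 (-x) 1
    simp only [Function.iterate_one, Int.cast_one] at this
    rw [HY.rf, HY.rf, neg_add, ← sub_eq_add_neg, this]; ring
  pos := fun x => by
    have := rf_d F 1 x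
    simp only [Function.iterate_one] at this
    rw [this]; exact h.pos _
  rot := by
    have := h.rot.neg
    refine this.congr fun n => ?_
    rw [rf_it]; simp [neg_div]
  irr := h.irr.neg

structure Bi (F : ℝ → ℝ) (ρ L : ℝ) : Prop where
  h : LiftL F ρ L
  h' : LiftL (rf F) (-ρ) L

lemma Lift.bi {F : ℝ → ℝ} {ρ : ℝ} (h : Lift F ρ) : ∃ L, Bi F ρ L := by
  obtain ⟨L, hL⟩ := h.exL
  obtain ⟨L', hL'⟩ := h.rf.exL
  exact ⟨max L L', ⟨h, hL.L0.trans (le_max_left _ _), fun x => (hL.Lu x).trans (le_max_left _ _),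
    fun x => (hL.LS x).trans (le_max_left _ _)⟩,
    ⟨h.rf, hL'.L0.trans (le_max_right _ _), fun x => (hL'.Lu x).trans (le_max_right _ _),
    fun x => (hL'.LS x).trans (le_max_right _ _)⟩⟩

def SPair (ρ : ℝ) (q : ℕ) (p : ℤ) (q' : ℕ) (p' : ℤ) : Prop :=
  Pair ρ q p q' p' ∨ Pair (-ρ) q (-p) q' (-p')

/-- displacement -/
def mu (F : ℝ → ℝ) (q : ℕ) (p : ℤ) (x : ℝ) : ℝ := |G F q p x - x|

def al (ρ : ℝ) (q : ℕ) (p : ℤ) : ℝ := |q * ρ - p|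

lemma mu_rf (F : ℝ → ℝ) (q : ℕ) (p : ℤ) (x : ℝ) : mu (rf F) q (-p) (-x) = mu F q p x := by
  rw [mu, mu, rf_G, neg_neg, ← abs_neg]; congr 1; ring

lemma al_rf (ρ : ℝ) (q : ℕ) (p : ℤ) : al (-ρ) q (-p) = al ρ q p := by
  rw [al, al, ← abs_neg]; congr 1; push_cast; ring

section
variable {F : ℝ → ℝ} {ρ L : ℝ} {q : ℕ} {p : ℤ} {q' : ℕ} {p' : ℤ}

lemma Pair.al_eq (hp : Pair ρ q p q' p') : al ρ q p = q * ρ - p :=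
  abs_of_pos (by linarith [hp.a0, hp.a1])
lemma Pair.al_eq' (hp : Pair ρ q p q' p') : al ρ q' p' = p' - q' * ρ := by
  rw [al, abs_of_neg (by linarith [hp.a0]), neg_sub]
lemma Pair.mu_eq (h : Lift F ρ) (hp : Pair ρ q p q' p') (x : ℝ) :
    mu F q p x = G F q p x - x := abs_of_pos (by linarith [hp.g_gt h x])
lemma Pair.mu_eq' (h : Lift F ρ) (hp : Pair ρ q p q' p') (x : ℝ) :
    mu F q' p' x = x - G F q' p' x := by
  rw [mu, abs_of_neg (by linarith [hp.g'_lt h x]), neg_sub]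

lemma SPair.q0 (hp : SPair ρ q p q' p') : 0 < q := by rcases hp with hp | hp <;> exact hp.q0
lemma SPair.qq (hp : SPair ρ q p q' p') : q ≤ q' := by rcases hp with hp | hp <;> exact hp.qq
lemma SPair.a1 (hp : SPair ρ q p q' p') : al ρ q' p' < al ρ q p := by
  rcases hp with hp | hp
  · rw [hp.al_eq, hp.al_eq']; exact hp.a1
  · rw [← al_rf, ← al_rf ρ q p, hp.al_eq, hp.al_eq']; exact hp.a1
lemma SPair.a0 (hp : SPair ρ q p q' p') : 0 < al ρ q' p' := by
  rcases hp with hp | hp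
  · rw [hp.al_eq']; exact hp.a0
  · rw [← al_rf, hp.al_eq']; exact hp.a0

lemma SPair.unit (hp : SPair ρ q p q' p') : q' * al ρ q p + q * al ρ q' p' = 1 := by
  rcases hp with hp | hp
  · rw [hp.al_eq, hp.al_eq']
    have : (q * p' - q' * p : ℝ) = 1 := by exact_mod_cast hp.det
    linarith
  · rw [← al_rf, ← al_rf ρ q' p', hp.al_eq, hp.al_eq']
    have : (q * (-p' : ℤ) - q' * (-p : ℤ) : ℝ) = 1 := by exact_mod_cast hp.det
    linarith

variable (hB : Bi F ρ L) (hp : SPair ρ q p q' p')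
include hB hp

lemma SPair.mu_pos (x : ℝ) : 0 < mu F q p x := by
  rcases hp with hp | hp
  · rw [hp.mu_eq hB.h.toLift]; linarith [hp.g_gt hB.h.toLift x]
  · rw [← mu_rf, hp.mu_eq hB.h'.toLift]; linarith [hp.g_gt hB.h'.toLift (-x)]

lemma SPair.mu_pos' (x : ℝ) : 0 < mu F q' p' x := by
  rcases hp with hp | hp
  · rw [hp.mu_eq' hB.h.toLift]; linarith [hp.g'_lt hB.h.toLift x]
  · rw [← mu_rf, hp.mu_eq' hB.h'.toLift]; linarith [hp.g'_lt hB.h'.toLift (-x)]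

lemma SPair.mu_le_one (x : ℝ) : mu F q p x ≤ 1 := by
  rcases hp with hp | hp
  · rw [hp.mu_eq hB.h.toLift]; exact hp.m_le_one hB.h x
  · rw [← mu_rf, hp.mu_eq hB.h'.toLift]; exact hp.m_le_one hB.h' (-x)

lemma SPair.denjoy (x : ℝ) : |psi F q' x| ≤ 2 * L := by
  rcases hp with hp | hp
  · exact hp.denjoy hB.h x
  · have := hp.denjoy hB.h' (-x)
    rwa [rf_psi, neg_neg] at this

lemma SPair.r_le_one (w : ℝ) : mu F q' p' (G F q p w) ≤ mu F q p w := by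
  rcases hp with hp | hp
  · rw [hp.mu_eq hB.h.toLift, hp.mu_eq' hB.h.toLift]; exact hp.r_le_one hB.h w
  · rw [← mu_rf, ← mu_rf F q p, hp.mu_eq hB.h'.toLift, hp.mu_eq' hB.h'.toLift]
    have := hp.r_le_one hB.h' (-w)
    rwa [rf_G F q p, neg_neg] at this ⊢

lemma SPair.delta_step {M δ r : ℝ} (hM : ∀ x, mu F q p x ≤ M) (hM1 : M ≤ 1)
    (hδ : ∀ x, Real.exp |psi F q x| ≤ 1 + δ) (hδ1 : δ ≤ Real.exp (2 * L))
    (hr : ∀ w, mu F q' p' (G F q p w) ≤ r * mu F q p w) (hr1 : r ≤ 1) (x : ℝ) :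
    Real.exp |psi F q' x| ≤ 1 + (r * δ + KD L * M) := by
  rcases hp with hp | hp
  · refine hp.delta_step hB.h (fun x => ?_) hM1 hδ hδ1 (fun w => ?_) hr1 x
    · rw [← hp.mu_eq hB.h.toLift]; exact hM x
    · rw [← hp.mu_eq hB.h.toLift, ← hp.mu_eq' hB.h.toLift]; exact hr w
  · have := hp.delta_step hB.h' (M := M) (δ := δ) (r := r) (fun x => ?_) hM1 (fun x => ?_) hδ1
      (fun w => ?_) hr1 (-x)
    · rwa [rf_psi, neg_neg] at this
    · rw [← hp.mu_eq hB.h'.toLift, ← neg_neg x, mu_rf]; exact hM _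
    · rw [rf_psi]; exact hδ _
    · rw [← hp.mu_eq hB.h'.toLift, ← hp.mu_eq' hB.h'.toLift]
      have := hr (-w)
      rw [← mu_rf, ← mu_rf F q p] at this
      rwa [← rf_G, neg_neg] at this

lemma SPair.fact1 {C : ℝ} (hC' : ∀ x, |psi F q' x| ≤ C)
    (hα : 2 * al ρ q' p' < al ρ q p) (w : ℝ) :
    (1 + Real.exp (-C)) * mu F q' p' (G F q p w) ≤ mu F q p w := by
  rcases hp with hp | hp
  · rw [hp.mu_eq hB.h.toLift, hp.mu_eq' hB.h.toLift]
    rw [hp.al_eq, hp.al_eq'] at hα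
    exact hp.fact1 hB.h hC' hα w
  · rw [← mu_rf, ← mu_rf F q p, hp.mu_eq hB.h'.toLift, hp.mu_eq' hB.h'.toLift]
    rw [← al_rf, ← al_rf ρ q, hp.al_eq, hp.al_eq'] at hα
    have := hp.fact1 hB.h' (C := C) (fun x => by rw [rf_psi]; exact hC' _) hα (-w)
    rwa [rf_G F q p, neg_neg] at this ⊢

lemma SPair.fact2 {C : ℝ} (hC : ∀ x, |psi F q x| ≤ C) (hC' : ∀ x, |psi F q' x| ≤ C)
    {q'' : ℕ} {p'' : ℤ} (hp2 : SPair ρ q' p' q'' p'') (hC'' : ∀ x, |psi F q'' x| ≤ C)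
    (hα : al ρ q' p' ≤ 2 * al ρ q'' p'')
    (hα2 : al ρ q'' p'' ≤ al ρ q p - al ρ q' p') (w : ℝ) :
    (1 + 1 / ((1 + Real.exp C) * Real.exp C ^ 2)) * mu F q' p' (G F q p w) ≤ mu F q p w := by
  rcases hp with hp | hp
  · rw [hp.mu_eq hB.h.toLift, hp.mu_eq' hB.h.toLift]
    rcases hp2 with hp2 | hp2
    · exfalso; have := hp2.a0; have := hp2.a1; have := hp.a0; linarith
    rw [hp.al_eq'] at hα
    rw [hp.al_eq, hp.al_eq'] at hα2
    rw [← al_rf, hp2.al_eq'] at hα hα2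
    push_cast at hα hα2
    have := hp2.a0
    push_cast at this
    exact hp.fact2 hB.h (p'' := p'') hC hC' hC'' (by linarith) (by linarith) (by linarith) w
  · rw [← mu_rf, ← mu_rf F q p, hp.mu_eq hB.h'.toLift, hp.mu_eq' hB.h'.toLift]
    rcases hp2 with hp2 | hp2
    swap
    · exfalso; have := hp2.a0; have := hp2.a1; have := hp.a0; linarith
    rw [← al_rf, hp.al_eq'] at hα
    rw [← al_rf ρ q p, ← al_rf ρ q' p', hp.al_eq, hp.al_eq'] at hα2
    rw [hp2.al_eq'] at hα hα2
    have := hp2.a0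
    push_cast at hα hα2
    have := hp.fact2 hB.h' (C := C) (q'' := q'') (p'' := -p'') (fun x => by rw [rf_psi]; exact hC _)
      (fun x => by rw [rf_psi]; exact hC' _) (fun x => by rw [rf_psi]; exact hC'' _)
      (by push_cast; linarith) (by push_cast; linarith) (by push_cast; linarith) (-w)
    rwa [rf_G F q p, neg_neg] at this ⊢

omit hp in
lemma Bi.b10 (K : ℕ) (hK : 1 ≤ K) : ∃ C e : ℝ, 1 ≤ C ∧ 0 < e ∧ ∀ q p q' p' Φ,
    SPair ρ q p q' p' → 0 < Φ → Φ ≤ 1 → (∀ x, mu F q p x ≤ Φ ^ 2) →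
    (∀ x, Real.exp |psi F q x| ≤ 1 + Φ) → Φ ≤ e → ∀ x,
    |mu F q' p' x - al ρ q' p' / al ρ q p * mu F q p x| ≤
      C * (Φ * (al ρ q' p' / al ρ q p) + Φ ^ K) * mu F q p x := by
  obtain ⟨C, e, hC, he, H⟩ := hB.h.b10 K hK
  obtain ⟨C', e', hC', he', H'⟩ := hB.h'.b10 K hK
  refine ⟨max C C', min e e', hC.trans (le_max_left _ _), lt_min he he',
    fun q p q' p' Φ hp h0 h1 hM hδ hΦ x => ?_⟩
  have hlam : 0 < al ρ q' p' / al ρ q p := div_pos hp.a0 (hp.a0.trans hp.a1)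
  have hm := hp.mu_pos hB x
  rcases hp with hp | hp
  · have := H q p q' p' Φ ⟨hp, h0, h1, fun x => by rw [← hp.mu_eq hB.h.toLift]; exact hM x, hδ⟩
      (hΦ.trans (min_le_left _ _)) x
    rw [← hp.mu_eq hB.h.toLift, ← hp.mu_eq' hB.h.toLift, ← hp.al_eq, ← hp.al_eq'] at this
    refine this.trans ?_
    have := le_max_left C C'
    gcongr
  · have := H' q (-p) q' (-p') Φ ⟨hp, h0, h1, fun x => by
      rw [← hp.mu_eq hB.h'.toLift, ← neg_neg x, mu_rf]; exact hM _,
      fun x => by rw [rf_psi]; exact hδ _⟩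
      (hΦ.trans (min_le_right _ _)) (-x)
    rw [← hp.mu_eq hB.h'.toLift, ← hp.mu_eq' hB.h'.toLift, ← hp.al_eq, ← hp.al_eq',
      mu_rf, mu_rf, al_rf, al_rf] at this
    refine this.trans ?_
    have := le_max_right C C'
    gcongr

omit hp in
lemma Bi.b9 (r : ℕ) : ∃ C : ℝ, 1 ≤ C ∧ ∀ q p q' p' Φ,
    SPair ρ q p q' p' → 0 < Φ → Φ ≤ 1 → (∀ x, mu F q p x ≤ Φ ^ 2) →
    (∀ x, Real.exp |psi F q x| ≤ 1 + Φ) → ∀ x, ∀ j ≤ r,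
    |iteratedDeriv j (deriv (F^[q'])) x| ≤ C * deriv (F^[q']) x * (Φ / mu F q p x) ^ j := by
  obtain ⟨C, hC, H⟩ := hB.h.b9' r
  obtain ⟨C', hC', H'⟩ := hB.h'.b9' r
  refine ⟨max C C', hC.trans (le_max_left _ _),
    fun q p q' p' Φ hp h0 h1 hM hδ x j hj => ?_⟩
  have hm := hp.mu_pos hB x
  have hd := hB.h.dpos q' x
  rcases hp with hp | hp
  · have := H q p q' p' Φ ⟨hp, h0, h1, fun x => by rw [← hp.mu_eq hB.h.toLift]; exact hM x, hδ⟩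
      q' le_rfl x j hj
    rw [← hp.mu_eq hB.h.toLift] at this
    refine this.trans ?_
    have := le_max_left C C'
    gcongr
  · have := H' q (-p) q' (-p') Φ ⟨hp, h0, h1, fun x => by
      rw [← hp.mu_eq hB.h'.toLift, ← neg_neg x, mu_rf]; exact hM _,
      fun x => by rw [rf_psi]; exact hδ _⟩ q' le_rfl (-x) j hj
    have e : deriv ((rf F)^[q']) = fun x => deriv (F^[q']) (-x) := by ext x; exact rf_d F q' x
    rw [← hp.mu_eq hB.h'.toLift, mu_rf, e, iteratedDeriv_comp_neg] at this
    simp only [neg_neg, smul_eq_mul, abs_mul, abs_pow, abs_neg, abs_one, one_pow, one_mul] at this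
    refine this.trans ?_
    have := le_max_right C C'
    gcongr

end
end HY

namespace HY

lemma Pair.next {ρ : ℝ} (hρ : Irrational ρ) {q : ℕ} {p : ℤ} {q' : ℕ} {p' : ℤ}
    (hp : Pair ρ q p q' p') :
    ∃ a : ℕ, 1 ≤ a ∧ Pair (-ρ) q' (-p') (q + a * q') (-(p + a * p')) := by
  have a0 := hp.a0
  have a1 := hp.a1
  have hq0 := hp.q0
  have hqq := hp.qq
  set A := q * ρ - p with hA
  set B := p' - q' * ρ with hBd
  set a := ⌊A / B⌋₊ with ha
  have hA0 : 0 < A := by linarith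
  have h1 : (a : ℝ) ≤ A / B := Nat.floor_le (by positivity)
  have h2 : A / B < a + 1 := Nat.lt_floor_add_one _
  rw [le_div_iff₀ a0] at h1
  rw [div_lt_iff₀ a0] at h2
  have hage : 1 ≤ a := Nat.le_floor (by rw [Nat.cast_one, le_div_iff₀ a0]; linarith)
  have hne : (a : ℝ) * B ≠ A := by
    intro e
    have h3 : ((q + a * q' : ℕ) : ℝ) * ρ = ((p + a * p' : ℤ) : ℝ) := by
      push_cast; linarith
    have := hρ.natCast_mul (m := q + a * q') (by omega)
    exact this ⟨((p + a * p' : ℤ) : ℚ), by rw [h3]; push_cast; rfl⟩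
  refine ⟨a, hage, by omega, by nlinarith, ?_, ?_, ?_⟩
  · have := hp.det
    push_cast
    linear_combination this
  · push_cast; linarith
  · push_cast
    have : (a : ℝ) * B < A := lt_of_le_of_ne h1 hne
    linarith

lemma SPair.next {ρ : ℝ} (hρ : Irrational ρ) {q : ℕ} {p : ℤ} {q' : ℕ} {p' : ℤ}
    (hp : SPair ρ q p q' p') :
    ∃ a : ℕ, 1 ≤ a ∧ SPair ρ q' p' (q + a * q') (p + a * p') ∧
      al ρ (q + a * q') (p + a * p') = al ρ q p - a * al ρ q' p' := by
  rcases hp with hp | hp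
  · obtain ⟨a, ha, h⟩ := hp.next hρ
    refine ⟨a, ha, Or.inr h, ?_⟩
    rw [← al_rf, h.al_eq', hp.al_eq, hp.al_eq']; push_cast; ring
  · obtain ⟨a, ha, h⟩ := hp.next hρ.neg
    have e : -(-p + a * -p') = p + a * p' := by ring
    rw [neg_neg, neg_neg, e] at h
    refine ⟨a, ha, Or.inl h, ?_⟩
    rw [h.al_eq', ← al_rf ρ q p, ← al_rf ρ q' p', hp.al_eq, hp.al_eq']; push_cast; ring

structure CF (ρ : ℝ) (Q : ℕ → ℕ) (P : ℕ → ℤ) (a : ℕ → ℕ) : Prop where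
  sp : ∀ n, SPair ρ (Q n) (P n) (Q (n + 1)) (P (n + 1))
  a1 : ∀ n, 1 ≤ a n
  Qs : ∀ n, Q (n + 2) = Q n + a n * Q (n + 1)
  Ps : ∀ n, P (n + 2) = P n + a n * P (n + 1)
  als : ∀ n, al ρ (Q (n + 2)) (P (n + 2)) = al ρ (Q n) (P n) - a n * al ρ (Q (n + 1)) (P (n + 1))
  al0 : al ρ (Q 0) (P 0) < 1

lemma exCF {ρ : ℝ} (hρ : Irrational ρ) : ∃ Q P a, CF ρ Q P a := by
  -- initial pair
  have hf0 : 0 < Int.fract ρ := by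
    rcases (Int.fract_nonneg ρ).lt_or_eq with h | h
    · exact h
    · exfalso
      refine hρ ⟨(⌊ρ⌋ : ℚ), ?_⟩
      have := Int.self_sub_floor ρ
      push_cast; linarith
  have hf1 := Int.fract_lt_one ρ
  obtain ⟨b, p', h0⟩ : ∃ (b : ℕ) (p' : ℤ), SPair ρ 1 ⌊ρ⌋ b p' := by
    set f := Int.fract ρ with hf
    have hfe : ρ = ⌊ρ⌋ + f := (Int.floor_add_fract ρ).symm
    set b := ⌊1 / f⌋₊ with hb
    have h1 : (b : ℝ) ≤ 1 / f := Nat.floor_le (by positivity)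
    have h2 : 1 / f < b + 1 := Nat.lt_floor_add_one _
    rw [le_div_iff₀ hf0] at h1
    rw [div_lt_iff₀ hf0] at h2
    have hbge : 1 ≤ b := Nat.le_floor (by rw [Nat.cast_one, le_div_iff₀ hf0]; linarith)
    have hne : (b : ℝ) * f ≠ 1 := by
      intro e
      have h3 : (b : ℝ) * ρ = ((1 + b * ⌊ρ⌋ : ℤ) : ℝ) := by
        push_cast; linear_combination (b : ℝ) * hfe + e
      have := hρ.natCast_mul (m := b) (by omega)
      exact this ⟨((1 + b * ⌊ρ⌋ : ℤ) : ℚ), by rw [h3]; push_cast; rfl⟩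
    have hlt : (b : ℝ) * f < 1 := lt_of_le_of_ne h1 hne
    have hbr : (b : ℝ) * ρ = b * ⌊ρ⌋ + b * f := by linear_combination (b : ℝ) * hfe
    refine ⟨b, 1 + b * ⌊ρ⌋, Or.inl ⟨one_pos, hbge, by push_cast; ring, ?_, ?_⟩⟩
    · push_cast; linarith
    · push_cast; linarith
  let S := {v : (ℕ × ℤ) × (ℕ × ℤ) // SPair ρ v.1.1 v.1.2 v.2.1 v.2.2}
  have nx : ∀ v : S, ∃ a : ℕ, 1 ≤ a ∧ SPair ρ v.1.2.1 v.1.2.2 (v.1.1.1 + a * v.1.2.1) (v.1.1.2 + a * v.1.2.2) ∧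
      al ρ (v.1.1.1 + a * v.1.2.1) (v.1.1.2 + a * v.1.2.2) =
        al ρ v.1.1.1 v.1.1.2 - a * al ρ v.1.2.1 v.1.2.2 := fun v => v.2.next hρ
  choose A hA1 hA2 hA3 using nx
  let st : ℕ → S := fun n => Nat.rec ⟨((1, ⌊ρ⌋), (b, p')), h0⟩
    (fun _ v => ⟨(v.1.2, (v.1.1.1 + A v * v.1.2.1, v.1.1.2 + A v * v.1.2.2)), hA2 v⟩) n
  have hst : ∀ n, (st (n + 1)).1 = ((st n).1.2, ((st n).1.1.1 + A (st n) * (st n).1.2.1,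
    (st n).1.1.2 + A (st n) * (st n).1.2.2)) := fun n => rfl
  refine ⟨fun n => (st n).1.1.1, fun n => (st n).1.1.2, fun n => A (st n),
    fun n => (st n).2, fun n => hA1 _, fun n => rfl, fun n => rfl, fun n => hA3 (st n), ?_⟩
  change al ρ 1 ⌊ρ⌋ < 1
  rw [al, Nat.cast_one, one_mul, Int.self_sub_floor, abs_of_pos hf0]; exact hf1

/-- Diophantine consequence -/
lemma CF.dio {ρ : ℝ} {Q : ℕ → ℕ} {P : ℕ → ℤ} {a : ℕ → ℕ} (hc : CF ρ Q P a) {k : ℕ} (hk : 2 ≤ k)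
    {ε : ℝ}
    (hdio : ∀ p : ℤ, ∀ q : ℕ, 1 ≤ q → ε / (q : ℝ) ^ k < |ρ - (p : ℝ) / (q : ℝ)|) (n : ℕ) :
    ε * al ρ (Q n) (P n) ^ (k - 1) ≤ al ρ (Q (n + 1)) (P (n + 1)) := by
  obtain ⟨j, rfl⟩ : ∃ j, k = j + 1 := ⟨k - 1, by omega⟩
  have hu := (hc.sp n).unit
  have a0 := (hc.sp n).a0
  have a1 := (hc.sp n).a1
  have hq : 1 ≤ Q (n + 1) := le_trans (hc.sp n).q0 (hc.sp n).qq
  have h1 := hdio (P (n + 1)) (Q (n + 1)) hq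
  set q := Q (n + 1)
  have hq1 : (1 : ℝ) ≤ q := by exact_mod_cast hq
  have hq0 : (0 : ℝ) < q := by linarith
  have e : |ρ - (P (n + 1) : ℝ) / q| = al ρ q (P (n + 1)) / q := by
    rw [al]
    rw [← abs_of_pos hq0, ← abs_div, abs_of_pos hq0]; congr 1; field_simp
  rw [e, div_lt_div_iff₀ (by positivity) hq0, pow_succ] at h1
  have h2 : q * al ρ (Q n) (P n) ≤ 1 := by
    have : (0 : ℝ) ≤ Q n * al ρ q (P (n + 1)) := by positivity
    linarith
  have h3 : (q * al ρ (Q n) (P n)) ^ j ≤ 1 := pow_le_one₀ (mul_nonneg hq0.le (a0.trans a1).le) h2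
  rw [mul_pow] at h3
  simp only [Nat.add_sub_cancel]
  have h4 : ε < al ρ q (P (n + 1)) * q ^ j := by
    have : ε * q < (al ρ q (P (n + 1)) * q ^ j) * q := by linarith
    exact lt_of_mul_lt_mul_right this hq0.le
  have h5 : 0 ≤ al ρ (Q n) (P n) ^ j := pow_nonneg (a0.trans a1).le _
  calc _ ≤ al ρ q (P (n + 1)) * q ^ j * al ρ (Q n) (P n) ^ j :=
        mul_le_mul_of_nonneg_right h4.le h5
    _ = al ρ q (P (n + 1)) * (q ^ j * al ρ (Q n) (P n) ^ j) := by ring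
    _ ≤ al ρ q (P (n + 1)) * 1 := mul_le_mul_of_nonneg_left h3 a0.le
    _ = _ := mul_one _

end HY

namespace HY

structure SQ (α M δ R : ℕ → ℝ) (c θ C1 : ℝ) (t : ℕ) : Prop where
  αpos : ∀ n, 0 < α n
  α1 : ∀ n, α n < 1
  αdec : ∀ n, α (n + 1) < α n
  dio : ∀ n, c * α n ^ t ≤ α (n + 1)
  c0 : 0 < c
  c1 : c ≤ 1
  t1 : 1 ≤ t
  M0 : ∀ n, 0 < M n
  MR : ∀ n, M (n + 1) ≤ R n * M n
  δ0 : ∀ n, 0 ≤ δ n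
  δR : ∀ n, δ (n + 1) ≤ R n * δ n + C1 * M n
  R0 : ∀ n, 0 ≤ R n
  R1 : ∀ n, R n ≤ 1
  RR : ∀ n, R (n + 1) * R n ≤ θ
  θ0 : 0 ≤ θ
  θ1 : θ < 1
  C10 : 0 ≤ C1

lemma summable_two {W : ℕ → ℝ} {κ : ℝ} (hW : ∀ n, 0 ≤ W n) (h1 : κ < 1)
    (h : ∀ n, W (n + 2) ≤ κ * W n) : Summable W := by
  refine summable_of_sum_range_le (c := (W 0 + W 1) / (1 - κ)) hW fun N => ?_
  rw [le_div_iff₀ (by linarith)]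
  have e : ∑ i ∈ Finset.range (N + 2), W i = ∑ i ∈ Finset.range N, W (i + 2) + W 1 + W 0 := by
    rw [Finset.sum_range_succ', Finset.sum_range_succ']
  have h2 : ∑ i ∈ Finset.range N, W i ≤ ∑ i ∈ Finset.range (N + 2), W i :=
    Finset.sum_le_sum_of_subset_of_nonneg (by simp) fun i _ _ => hW i
  have h3 : ∑ i ∈ Finset.range N, W (i + 2) ≤ κ * ∑ i ∈ Finset.range N, W i := by
    rw [Finset.mul_sum]; exact Finset.sum_le_sum fun i _ => h i
  linarith

noncomputable def Ph (M δ : ℕ → ℝ) (n : ℕ) : ℝ := δ n + √(M n)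

section
variable {α M δ R : ℕ → ℝ} {c θ C1 : ℝ} {t : ℕ} (h : SQ α M δ R c θ C1 t)
include h

lemma SQ.Ph0 (n : ℕ) : 0 < Ph M δ n :=
  add_pos_of_nonneg_of_pos (h.δ0 n) (Real.sqrt_pos.mpr (h.M0 n))

lemma SQ.sum : Summable (Ph M δ) := by
  have h0 := h.θ0
  have h1 := h.θ1
  have C0 := h.C10
  set A : ℝ := 1 + 4 * C1 / (1 - θ) with hA
  have hAC : 2 * C1 ≤ A * ((1 - θ) / 2) := by
    have : 4 * C1 / (1 - θ) * ((1 - θ) / 2) = 2 * C1 := by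
      field_simp [(by linarith : (1 - θ) ≠ 0)]; ring
    rw [hA, add_mul, this]; linarith
  have hA1 : 1 ≤ A := by
    have : 0 ≤ 4 * C1 / (1 - θ) := div_nonneg (by linarith) (by linarith)
    linarith
  set V : ℕ → ℝ := fun n => δ n + A * M n with hV
  have hV0 : ∀ n, 0 ≤ V n := fun n => by
    have := h.δ0 n; have := (h.M0 n).le; positivity
  have hVs : ∀ n, V (n + 2) ≤ (1 + θ) / 2 * V n := by
    intro n
    have m0 := (h.M0 n).le
    have m1 := (h.M0 (n + 1)).le
    have hm1 : M (n + 1) ≤ M n := (h.MR n).trans (mul_le_of_le_one_left m0 (h.R1 n))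
    have hm2 : M (n + 2) ≤ θ * M n := by
      refine (h.MR (n + 1)).trans ?_
      have := mul_le_mul_of_nonneg_left (h.MR n) (h.R0 (n + 1))
      have := mul_le_mul_of_nonneg_right (h.RR n) m0
      linarith
    have hd : δ (n + 2) ≤ θ * δ n + 2 * C1 * M n := by
      refine (h.δR (n + 1)).trans ?_
      have e1 := mul_le_mul_of_nonneg_left (h.δR n) (h.R0 (n + 1))
      have e2 := mul_le_mul_of_nonneg_right (h.RR n) (h.δ0 n)
      have e3 := mul_le_of_le_one_left (mul_nonneg C0 m0) (h.R1 (n + 1))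
      have e4 := mul_le_mul_of_nonneg_left hm1 C0
      linarith
    have e5 := mul_le_mul_of_nonneg_right hAC m0
    have e6 := mul_le_mul_of_nonneg_left hm2 (by linarith : 0 ≤ A)
    have e7 : 0 ≤ (1 - θ) * δ n := mul_nonneg (by linarith) (h.δ0 n)
    simp only [hV]
    linarith
  have s1 : Summable V := summable_two hV0 (by linarith) hVs
  have s2 : Summable (fun n => √(V n)) := by
    refine summable_two (κ := √((1 + θ) / 2)) (fun n => Real.sqrt_nonneg _) ?_ fun n => ?_
    · rw [Real.sqrt_lt' one_pos]; linarith
    · rw [← Real.sqrt_mul (by linarith)]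
      exact Real.sqrt_le_sqrt (hVs n)
  refine Summable.of_nonneg_of_le (fun n => (h.Ph0 n).le) (fun n => ?_) (s1.add s2)
  have := (h.M0 n).le
  refine add_le_add ?_ (Real.sqrt_le_sqrt ?_)
  · simp only [hV]
    have : 0 ≤ A * M n := by positivity
    linarith
  · simp only [hV]
    have := h.δ0 n
    nlinarith

/-- sequence lemma C -/
lemma SQ.decay (hb10 : ∀ K : ℕ, 1 ≤ K → ∃ C e : ℝ, 1 ≤ C ∧ 0 < e ∧ ∀ n, Ph M δ n ≤ e →
      R n ≤ α (n + 1) / α n * (1 + C * Ph M δ n) + C * Ph M δ n ^ K) :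
    ∃ σ C : ℝ, 0 < σ ∧ 0 < C ∧ ∀ n, Ph M δ n ≤ C * α n ^ σ := by
  set K : ℕ := 2 * t ^ 2 + 2 with hK
  obtain ⟨C, e, hC, he, H⟩ := hb10 K (by omega)
  set Φ := Ph M δ with hΦd
  have hΦ0 := h.Ph0
  have C0 := h.C10
  set C3 := 2 * C + 2 * C1 with hC3
  have hC30 : 0 < C3 := by linarith
  -- choose n0
  obtain ⟨n0, hn0⟩ : ∃ n0, ∀ n, ∑ i ∈ Finset.range n, Φ (n0 + i) ≤ min e (min (1 / (12 * C)) (1 / (2 * C3))) := by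
    have hpos : 0 < min e (min (1 / (12 * C)) (1 / (2 * C3))) := by positivity
    have h2 := (tendsto_sum_nat_add Φ).eventually (gt_mem_nhds hpos)
    obtain ⟨n0, h3⟩ := h2.exists
    refine ⟨n0, fun n => ?_⟩
    refine le_trans ?_ h3.le
    have hs : Summable (fun k => Φ (k + n0)) := (summable_nat_add_iff n0).mpr h.sum
    have := hs.sum_le_tsum (Finset.range n) (fun i _ => (hΦ0 _).le)
    simpa [add_comm] using this
  have hsm : ∀ n, Φ (n0 + n) ≤ min e (min (1 / (12 * C)) (1 / (2 * C3))) := fun n => by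
    refine le_trans ?_ (hn0 (n + 1))
    exact Finset.single_le_sum (f := fun i => Φ (n0 + i)) (fun i _ => (hΦ0 _).le)
      (Finset.self_mem_range_succ n)
  have hsme : ∀ n, Φ (n0 + n) ≤ e := fun n => (hsm n).trans (min_le_left _ _)
  have hsmC : ∀ n, C * Φ (n0 + n) ≤ 1 / 12 := fun n => by
    have := (hsm n).trans ((min_le_right _ _).trans (min_le_left _ _))
    rw [le_div_iff₀ (by linarith)] at this
    linarith
  have hsm12 : ∀ n, Φ (n0 + n) ≤ 1 / 12 := fun n => by
    have := hsmC n
    have := le_mul_of_one_le_left (hΦ0 (n0 + n)).le hC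
    linarith
  set P : ℕ → ℝ := fun n => Real.exp (C3 * ∑ i ∈ Finset.range n, Φ (n0 + i)) with hP
  have hP1 : ∀ n, 1 ≤ P n := fun n => Real.one_le_exp
    (mul_nonneg hC30.le (Finset.sum_nonneg fun i _ => (hΦ0 _).le))
  have hP2 : ∀ n, P n ≤ 2 := fun n => by
    have h1 := (hn0 n).trans ((min_le_right _ _).trans (min_le_right _ _))
    rw [le_div_iff₀ (by linarith)] at h1
    have h2 : P n ≤ Real.exp (1 / 2) := Real.exp_le_exp.mpr (by linarith)
    refine h2.trans ?_
    have h3 : Real.exp (1 / 2) ^ 2 = Real.exp 1 := by rw [← Real.exp_nat_mul]; norm_num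
    have h4 := Real.exp_one_lt_d9
    by_contra hcon
    push Not at hcon
    nlinarith
  have hPs : ∀ n, P n * (1 + C3 * Φ (n0 + n)) ≤ P (n + 1) := fun n => by
    have e : P (n + 1) = P n * Real.exp (C3 * Φ (n0 + n)) := by
      simp only [hP]; rw [Finset.sum_range_succ, mul_add, Real.exp_add]
    rw [e]
    refine mul_le_mul_of_nonneg_left ?_ (Real.exp_pos _).le
    have := Real.add_one_le_exp (C3 * Φ (n0 + n))
    linarith
  -- choose s
  have c0 := h.c0
  obtain ⟨s, hs0, hs1, hsα, hsc⟩ : ∃ s : ℝ, 0 < s ∧ s ≤ 1 ∧ 1 / 2 ≤ α n0 ^ s ∧ 1 / 2 ≤ c ^ s := by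
    have e1 : ∀ y : ℝ, 0 < y → ∀ᶠ s in nhdsWithin (0 : ℝ) (Set.Ioi 0), 1 / 2 ≤ y ^ s := by
      intro y hy
      have : Tendsto (fun s : ℝ => y ^ s) (nhds 0) (nhds 1) := by
        have := (Real.continuous_const_rpow hy.ne').tendsto 0
        simpa using this
      have := this.eventually (lt_mem_nhds (by norm_num : (1 / 2 : ℝ) < 1))
      exact (this.filter_mono nhdsWithin_le_nhds).mono fun s hs => hs.le
    have e2 : ∀ᶠ s in nhdsWithin (0 : ℝ) (Set.Ioi 0), s < 1 :=
      (gt_mem_nhds one_pos).filter_mono nhdsWithin_le_nhds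
    have e3 : ∀ᶠ s in nhdsWithin (0 : ℝ) (Set.Ioi 0), 0 < s := self_mem_nhdsWithin
    obtain ⟨s, h1, h2, h3, h4⟩ := ((e1 _ (h.αpos n0)).and ((e1 _ c0).and (e2.and e3))).exists
    exact ⟨s, h4, h3.le, h1, h2⟩
  have ht1 : (1 : ℝ) ≤ t := by exact_mod_cast h.t1
  have ht0 : (0 : ℝ) < t := by linarith
  set σ : ℝ := s / (2 * t) with hσ
  have hσ0 : 0 < σ := by positivity
  have hσt : t * σ = s / 2 := by rw [hσ]; field_simp
  have hσs : σ ≤ s / 2 := by rw [← hσt]; nlinarith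
  have hσ1 : σ ≤ 1 := by linarith
  set v := Φ n0 with hv
  have hv0 : 0 < v := hΦ0 n0
  have hv12 : v ≤ 1 / 12 := hsm12 0
  have ασ : ∀ n, ∀ r : ℝ, 0 < α n ^ r := fun n r => Real.rpow_pos_of_pos (h.αpos n) r
  have hpow : ∀ n, ∀ r r' : ℝ, r ≤ r' → α n ^ r' ≤ α n ^ r := fun n r r' hr =>
    Real.rpow_le_rpow_of_exponent_ge (h.αpos n) (h.α1 n).le hr
  -- α_n^(t r) ≤ 2 α_{n+1}^r for r ≤ s
  have hdio : ∀ n, ∀ r : ℝ, 0 < r → r ≤ s → α n ^ (t * r) ≤ 2 * α (n + 1) ^ r := by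
    intro n r hr0 hr
    have e1 : (c * α n ^ t) ^ r ≤ α (n + 1) ^ r :=
      Real.rpow_le_rpow (mul_nonneg c0.le (pow_nonneg (h.αpos n).le _)) (h.dio n) hr0.le
    rw [Real.mul_rpow c0.le (pow_nonneg (h.αpos n).le _), ← Real.rpow_natCast,
      ← Real.rpow_mul (h.αpos n).le] at e1
    have e2 : c ^ s ≤ c ^ r := Real.rpow_le_rpow_of_exponent_ge c0 h.c1 hr
    have e3 := mul_le_mul_of_nonneg_right (hsc.trans e2) (ασ n (t * r)).le
    linarith
  have hΦδ : ∀ n, δ n ≤ Φ n := fun n => by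
    have := Real.sqrt_nonneg (M n); simp only [hΦd, Ph]; linarith
  have hΦM : ∀ n, √(M n) ≤ Φ n := fun n => by
    have := h.δ0 n; simp only [hΦd, Ph]; linarith
  have key : ∀ n, M (n0 + n) ≤ 2 * v ^ 2 * P n * α (n0 + n) ^ s ∧
      δ (n0 + n) ≤ 2 * v * P n * α (n0 + n) ^ σ := by
    intro n
    induction n with
    | zero =>
      simp only [hP, Finset.range_zero, Finset.sum_empty, mul_zero, Real.exp_zero, mul_one, add_zero]
      constructor
      · have h1 : M n0 ≤ v ^ 2 := by
          rw [← Real.sq_sqrt (h.M0 n0).le]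
          exact pow_le_pow_left₀ (Real.sqrt_nonneg _) (hΦM n0) 2
        have := mul_le_mul_of_nonneg_left hsα (by positivity : 0 ≤ 2 * v ^ 2)
        linarith
      · have h1 := hΦδ n0
        have h2 := hsα.trans (hpow n0 σ s (by linarith))
        have := mul_le_mul_of_nonneg_left h2 (by positivity : 0 ≤ 2 * v)
        linarith
    | succ n ih =>
      obtain ⟨iM, iδ⟩ := ih
      rw [← add_assoc]
      set N := n0 + n with hN
      have hP0 : 0 < P n := by linarith [hP1 n]
      have hMN := h.M0 N
      have hsq : √(M N) ≤ 2 * v * α N ^ (s / 2) := by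
        rw [Real.sqrt_le_left (by have := ασ N (s / 2); positivity), mul_pow, ← Real.rpow_natCast,
          ← Real.rpow_natCast (α N ^ (s / 2)), ← Real.rpow_mul (h.αpos N).le]
        have : s / 2 * ((2 : ℕ) : ℝ) = s := by push_cast; ring
        rw [this, Real.rpow_natCast]
        refine iM.trans (mul_le_mul_of_nonneg_right ?_ (ασ N s).le)
        have := mul_le_mul_of_nonneg_left (hP2 n) (by positivity : 0 ≤ 2 * v ^ 2)
        linarith
      have hδ4 : δ N ≤ 4 * v * α N ^ σ := by
        refine iδ.trans (mul_le_mul_of_nonneg_right ?_ (ασ N σ).le)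
        have := mul_le_mul_of_nonneg_left (hP2 n) (by positivity : 0 ≤ 2 * v)
        linarith
      have hΦN : Φ N ≤ 6 * v * α N ^ σ := by
        have := hpow N σ (s / 2) hσs
        have := mul_le_mul_of_nonneg_left this (by positivity : 0 ≤ 2 * v)
        simp only [hΦd, Ph]
        linarith
      have hΦN2 : Φ N ≤ 1 / 2 * α N ^ σ := hΦN.trans
        (mul_le_mul_of_nonneg_right (by linarith) (ασ N σ).le)
      set lam := α (N + 1) / α N with hlam
      have hlam0 : 0 < lam := div_pos (h.αpos _) (h.αpos _)
      have hlam1 : lam ≤ 1 := by rw [hlam, div_le_one (h.αpos _)]; exact (h.αdec N).le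
      have hCΦ : C * Φ N ≤ 1 / 12 := hsmC n
      have hΦ12 : Φ N ≤ 1 / 12 := hsm12 n
      have hΦN0 := hΦ0 N
      have hR : R N ≤ lam ^ s * (1 + 2 * C * Φ N) := by
        have h1 := H N (hsme n)
        have hCΦ0 : 0 ≤ C * Φ N := by positivity
        rcases le_total (Φ N ^ (K - 1)) lam with h2 | h2
        · have e1 : Φ N ^ K = Φ N ^ (K - 1) * Φ N := by
            rw [← pow_succ]; congr 1
          have e2 : C * Φ N ^ K ≤ C * Φ N * lam := by
            rw [e1]
            have := mul_le_mul_of_nonneg_left h2 hCΦ0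
            linarith
          have e3 : lam ≤ lam ^ s := by
            simpa using Real.rpow_le_rpow_of_exponent_ge hlam0 hlam1 hs1
          have e4 := mul_le_mul_of_nonneg_right e3 (by linarith : 0 ≤ 1 + 2 * C * Φ N)
          simp only [← hlam] at h1
          linarith
        · have e1 : Φ N ^ K = Φ N ^ (K - 2) * Φ N * Φ N := by
            rw [← pow_succ, ← pow_succ]; congr 1
          have e2 : Φ N ^ (K - 1) = Φ N ^ (K - 2) * Φ N := by
            rw [← pow_succ]; congr 1
          have hX : 0 < Φ N ^ (K - 2) := by positivity
          have e3 : R N ≤ Φ N ^ (K - 2) * (Φ N * (1 + 2 * (C * Φ N))) := by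
            refine h1.trans ?_
            have := mul_le_mul_of_nonneg_right h2 (by linarith : 0 ≤ 1 + C * Φ N)
            rw [e2] at this
            rw [e1, ← hlam]
            linarith
          have e4 : Φ N * (1 + 2 * (C * Φ N)) ≤ 1 := by nlinarith
          have e5 : R N ≤ Φ N ^ (K - 2) := e3.trans (mul_le_of_le_one_right hX.le e4)
          have hK2 : K - 2 = 2 * t ^ 2 := by omega
          have ht2 : 1 ≤ 2 * t ^ 2 := by
            have : 0 < t ^ 2 := pow_pos (lt_of_lt_of_le one_pos h.t1) 2
            omega
          have e6 : Φ N ^ (K - 2) ≤ 1 / 2 * α N ^ (t * s) := by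
            rw [hK2]
            refine (pow_le_pow_left₀ hΦN0.le hΦN2 _).trans ?_
            rw [mul_pow, ← Real.rpow_natCast (α N ^ σ), ← Real.rpow_mul (h.αpos N).le]
            have : σ * ((2 * t ^ 2 : ℕ) : ℝ) = t * s := by rw [hσ]; push_cast; field_simp
            rw [this]
            refine mul_le_mul_of_nonneg_right ?_ (ασ N _).le
            exact pow_le_of_le_one (by norm_num) (by norm_num) (by omega)
          have e7 := hdio N s hs0 le_rfl
          have e8 : α (N + 1) ^ s ≤ lam ^ s := by
            refine Real.rpow_le_rpow (h.αpos _).le ?_ hs0.le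
            rw [hlam, le_div_iff₀ (h.αpos N)]
            exact mul_le_of_le_one_right (h.αpos _).le (h.α1 N).le
          have e9 : 0 ≤ lam ^ s * (2 * C * Φ N) := by positivity
          linarith
      have hlms : ∀ r : ℝ, lam ^ r * α N ^ r = α (N + 1) ^ r := fun r => by
        rw [← Real.mul_rpow hlam0.le (h.αpos N).le, hlam, div_mul_cancel₀ _ (h.αpos N).ne']
      have hlσ : lam ^ s ≤ lam ^ σ := Real.rpow_le_rpow_of_exponent_ge hlam0 hlam1 (by linarith)
      have hls0 : 0 < lam ^ s := Real.rpow_pos_of_pos hlam0 _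
      have hCΦ0 : 0 ≤ C * Φ N := by positivity
      have hC1Φ0 : 0 ≤ C1 * Φ N := by positivity
      have hPP : P n * (1 + C3 * Φ N) ≤ P (n + 1) := hPs n
      constructor
      · refine (h.MR N).trans ((mul_le_mul hR iM hMN.le (by positivity)).trans ?_)
        have e1 : lam ^ s * (1 + 2 * C * Φ N) * (2 * v ^ 2 * P n * α N ^ s) =
          2 * v ^ 2 * (P n * (1 + 2 * C * Φ N)) * (lam ^ s * α N ^ s) := by ring
        rw [e1, hlms]
        refine mul_le_mul_of_nonneg_right (mul_le_mul_of_nonneg_left ?_ (by positivity)) (ασ _ s).le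
        refine le_trans (mul_le_mul_of_nonneg_left ?_ hP0.le) hPP
        rw [hC3]; linarith
      · have hR2 : R N ≤ lam ^ σ * (1 + 2 * C * Φ N) :=
          hR.trans (mul_le_mul_of_nonneg_right hlσ (by linarith))
        have e0 : R N * δ N ≤ lam ^ σ * (1 + 2 * C * Φ N) * (2 * v * P n * α N ^ σ) :=
          mul_le_mul hR2 iδ (h.δ0 N) ((h.R0 N).trans hR2)
        have e1 : lam ^ σ * (1 + 2 * C * Φ N) * (2 * v * P n * α N ^ σ) =
          2 * v * (P n * (1 + 2 * C * Φ N)) * (lam ^ σ * α N ^ σ) := by ring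
        rw [e1, hlms] at e0
        have e2 : M N ≤ Φ N * (4 * v * α (N + 1) ^ σ) := by
          have e3 : M N = √(M N) * √(M N) := (Real.mul_self_sqrt hMN.le).symm
          have e4 := hdio N σ hσ0 (by linarith)
          rw [hσt] at e4
          have e5 : √(M N) ≤ 4 * v * α (N + 1) ^ σ := by
            have := mul_le_mul_of_nonneg_left e4 (by positivity : 0 ≤ 2 * v)
            linarith
          rw [e3]
          exact mul_le_mul (hΦM N) e5 (Real.sqrt_nonneg _) hΦN0.le
        have e6 := mul_le_mul_of_nonneg_left e2 C0
        have hW := ασ (N + 1) σ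
        have e7 : C1 * (Φ N * (4 * v * α (N + 1) ^ σ)) ≤
            2 * v * (P n * (2 * C1 * Φ N)) * α (N + 1) ^ σ := by
          have : 0 ≤ C1 * Φ N * (4 * v * α (N + 1) ^ σ) := by positivity
          have := mul_le_mul_of_nonneg_right (hP1 n) this
          linarith
        have e8 : 2 * v * (P n * (1 + C3 * Φ N)) * α (N + 1) ^ σ ≤
            2 * v * P (n + 1) * α (N + 1) ^ σ :=
          mul_le_mul_of_nonneg_right (mul_le_mul_of_nonneg_left hPP (by positivity)) hW.le
        refine (h.δR N).trans ?_
        rw [hC3] at e8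
        linarith
  -- conclusion
  have hfin : ∀ n, Φ (n0 + n) ≤ α (n0 + n) ^ σ := by
    intro n
    obtain ⟨iM, iδ⟩ := key n
    set N := n0 + n with hN
    have hsq : √(M N) ≤ 2 * v * α N ^ (s / 2) := by
      rw [Real.sqrt_le_left (by have := ασ N (s / 2); positivity), mul_pow, ← Real.rpow_natCast,
        ← Real.rpow_natCast (α N ^ (s / 2)), ← Real.rpow_mul (h.αpos N).le]
      have : s / 2 * ((2 : ℕ) : ℝ) = s := by push_cast; ring
      rw [this, Real.rpow_natCast]
      refine iM.trans (mul_le_mul_of_nonneg_right ?_ (ασ N s).le)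
      have := mul_le_mul_of_nonneg_left (hP2 n) (by positivity : 0 ≤ 2 * v ^ 2)
      linarith
    have hδ4 : δ N ≤ 4 * v * α N ^ σ := by
      refine iδ.trans (mul_le_mul_of_nonneg_right ?_ (ασ N σ).le)
      have := mul_le_mul_of_nonneg_left (hP2 n) (by positivity : 0 ≤ 2 * v)
      linarith
    have := hpow N σ (s / 2) hσs
    have := mul_le_mul_of_nonneg_left this (by positivity : 0 ≤ 2 * v)
    have := mul_le_mul_of_nonneg_right (by linarith : 6 * v ≤ 1) (ασ N σ).le
    change δ N + √(M N) ≤ _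
    linarith
  refine ⟨σ, 1 + ∑ i ∈ Finset.range n0, Φ i / α i ^ σ, hσ0, ?_, fun n => ?_⟩
  · have : 0 ≤ ∑ i ∈ Finset.range n0, Φ i / α i ^ σ :=
      Finset.sum_nonneg fun i _ => div_nonneg (hΦ0 i).le (ασ i σ).le
    linarith
  have hS : 0 ≤ ∑ i ∈ Finset.range n0, Φ i / α i ^ σ :=
      Finset.sum_nonneg fun i _ => div_nonneg (hΦ0 i).le (ασ i σ).le
  rcases Nat.lt_or_ge n n0 with h1 | h1
  · have h2 := Finset.single_le_sum (f := fun i => Φ i / α i ^ σ)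
      (fun i _ => div_nonneg (hΦ0 i).le (ασ i σ).le) (Finset.mem_range.mpr h1)
    have h2 : Φ n / α n ^ σ ≤ ∑ i ∈ Finset.range n0, Φ i / α i ^ σ := h2
    rw [← div_le_iff₀ (ασ n σ)]
    linarith
  · obtain ⟨k, rfl⟩ := Nat.exists_eq_add_of_le h1
    refine (hfin k).trans ?_
    exact le_mul_of_one_le_left (ασ _ σ).le (by linarith)

end
end HY

namespace HY

lemma CF.shift {ρ : ℝ} {Q : ℕ → ℕ} {P : ℕ → ℤ} {a : ℕ → ℕ} (hc : CF ρ Q P a) :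
    CF ρ (fun n => Q (n + 1)) (fun n => P (n + 1)) (fun n => a (n + 1)) where
  sp := fun n => hc.sp _
  a1 := fun n => hc.a1 _
  Qs := fun n => hc.Qs _
  Ps := fun n => hc.Ps _
  als := fun n => hc.als _
  al0 := (hc.sp 0).a1.trans hc.al0

noncomputable def seqd (E K : ℝ) (R M : ℕ → ℝ) : ℕ → ℝ
  | 0 => E
  | n + 1 => min E (R n * seqd E K R M n + K * M n)

/-- the data obtained from the renormalisation part -/
structure DC (F : ℝ → ℝ) (ρ L : ℝ) (Q : ℕ → ℕ) (P : ℕ → ℤ) (a : ℕ → ℕ) (Φ : ℕ → ℝ)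
    (σ C c : ℝ) (t : ℕ) : Prop where
  hB : Bi F ρ L
  cf : CF ρ Q P a
  Φ0 : ∀ n, 0 < Φ n
  Φs : Summable Φ
  Φα : ∀ n, Φ n ≤ C * al ρ (Q n) (P n) ^ σ
  σ0 : 0 < σ
  C0 : 0 < C
  c0 : 0 < c
  dio : ∀ n, c * al ρ (Q n) (P n) ^ t ≤ al ρ (Q (n + 1)) (P (n + 1))
  muΦ : ∀ n x, mu F (Q n) (P n) x ≤ Φ n ^ 2
  psΦ : ∀ n x, Real.exp |psi F (Q n) x| ≤ 1 + Φ n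

lemma Lift.exDC {F : ℝ → ℝ} {ρ : ℝ} (h : Lift F ρ) {k : ℕ} (hk : 2 ≤ k) {ε : ℝ} (hε : 0 < ε)
    (hdio : ∀ p : ℤ, ∀ q : ℕ, 1 ≤ q → ε / (q : ℝ) ^ k < |ρ - (p : ℝ) / (q : ℝ)|) :
    ∃ L Q P a Φ σ C c t, DC F ρ L Q P a Φ σ C c t := by
  obtain ⟨L, hB⟩ := h.bi
  obtain ⟨Q0, P0, a0, hc0⟩ := exCF h.irr
  have hden : ∀ n x, |psi F (Q0 (n + 1)) x| ≤ 2 * L := fun n x => (hc0.sp n).denjoy hB x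
  have hc := hc0.shift
  generalize hQ : (fun n => Q0 (n + 1)) = Q at hc
  generalize hP : (fun n => P0 (n + 1)) = P at hc
  generalize (fun n => a0 (n + 1)) = a at hc
  have hden : ∀ n x, |psi F (Q n) x| ≤ 2 * L := by rw [← hQ]; exact hden
  clear hQ hP hc0
  have hmu : ∀ n x, 0 < mu F (Q n) (P n) x := fun n x => (hc.sp n).mu_pos hB x
  set R : ℕ → ℝ := fun n => ⨆ w, mu F (Q (n + 1)) (P (n + 1)) (G F (Q n) (P n) w) / mu F (Q n) (P n) w
    with hR
  have hle1 : ∀ n w, mu F (Q (n + 1)) (P (n + 1)) (G F (Q n) (P n) w) / mu F (Q n) (P n) w ≤ 1 :=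
    fun n w => (div_le_one (hmu n w)).mpr ((hc.sp n).r_le_one hB w)
  have hbdd : ∀ n, BddAbove (Set.range fun w => mu F (Q (n + 1)) (P (n + 1)) (G F (Q n) (P n) w) /
      mu F (Q n) (P n) w) := fun n => ⟨1, by rintro _ ⟨w, rfl⟩; exact hle1 n w⟩
  have hRle : ∀ n b, (∀ w, mu F (Q (n + 1)) (P (n + 1)) (G F (Q n) (P n) w) ≤ b * mu F (Q n) (P n) w) →
      R n ≤ b := fun n b hb => ciSup_le fun w => (div_le_iff₀ (hmu n w)).mpr (hb w)
  have hRw : ∀ n w, mu F (Q (n + 1)) (P (n + 1)) (G F (Q n) (P n) w) ≤ R n * mu F (Q n) (P n) w :=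
    fun n w => (div_le_iff₀ (hmu n w)).mp (le_ciSup (hbdd n) w)
  have hR1 : ∀ n, R n ≤ 1 := fun n => ciSup_le (hle1 n)
  have hR0 : ∀ n, 0 < R n := fun n => by
    have h1 := hRw n 0
    have h2 := hmu (n + 1) (G F (Q n) (P n) 0)
    have h3 := hmu n 0
    by_contra hcon
    push Not at hcon
    have := mul_nonpos_of_nonpos_of_nonneg hcon h3.le
    linarith
  clear_value R
  have hL0 := hB.h.L0
  set E := Real.exp (2 * L) with hE
  have hE1 : 1 ≤ E := Real.one_le_exp (by linarith)
  have hKD : 0 ≤ KD L := by unfold KD; positivity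
  set M : ℕ → ℝ := fun n => ∏ i ∈ Finset.range n, R i with hM
  have hM0 : ∀ n, 0 < M n := fun n => Finset.prod_pos fun i _ => hR0 i
  have hMs : ∀ n, M (n + 1) = R n * M n := fun n => by
    simp only [hM]; rw [Finset.prod_range_succ, mul_comm]
  have hM1 : ∀ n, M n ≤ 1 := fun n => Finset.prod_le_one (fun i _ => (hR0 i).le) fun i _ => hR1 i
  set δ := seqd E (KD L) R M with hδ
  have hδs : ∀ n, δ (n + 1) = min E (R n * δ n + KD L * M n) := fun n => rfl
  have hδ0 : ∀ n, 0 ≤ δ n := fun n => by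
    induction n with
    | zero => exact (by linarith : 0 ≤ E)
    | succ n ih =>
      rw [hδs]
      refine le_min (by linarith) ?_
      have := (hR0 n).le
      have := (hM0 n).le
      positivity
  have hδE : ∀ n, δ n ≤ E := fun n => by
    cases n with
    | zero => exact le_rfl
    | succ n => rw [hδs]; exact min_le_left _ _
  have hmuM : ∀ n x, mu F (Q n) (P n) x ≤ M n := fun n => by
    induction n with
    | zero =>
      intro x
      have : M 0 = 1 := by simp [hM]
      rw [this]; exact (hc.sp 0).mu_le_one hB x
    | succ n ih =>
      intro x
      obtain ⟨w, rfl⟩ := h.surj (Q n) (P n) x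
      rw [hMs]
      exact (hRw n w).trans (mul_le_mul_of_nonneg_left (ih w) (hR0 n).le)
  have hpsE : ∀ n x, Real.exp |psi F (Q n) x| ≤ 1 + E := fun n x => by
    have := Real.exp_le_exp.mpr (hden n x)
    linarith
  have hpsδ : ∀ n x, Real.exp |psi F (Q n) x| ≤ 1 + δ n := fun n => by
    induction n with
    | zero => exact hpsE 0
    | succ n ih =>
      intro x
      rw [hδs]
      rcases min_choice E (R n * δ n + KD L * M n) with e | e <;> rw [e]
      · exact hpsE _ x
      · exact (hc.sp n).delta_step hB (hmuM n) (hM1 n) ih (hδE n) (hRw n) (hR1 n) x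
  set η := min (Real.exp (-(2 * L))) (1 / ((1 + E) * E ^ 2)) with hη
  have hη0 : 0 < η := lt_min (Real.exp_pos _) (by positivity)
  have hapos : ∀ n, 0 < al ρ (Q n) (P n) := fun n => (hc.sp n).a0.trans (hc.sp n).a1
  have ha1 : ∀ n, al ρ (Q n) (P n) < 1 := fun n => by
    induction n with
    | zero => exact hc.al0
    | succ n ih => exact (hc.sp n).a1.trans ih
  have hSQ : SQ (fun n => al ρ (Q n) (P n)) M δ R (min ε 1) (1 / (1 + η)) (KD L) (k - 1) :=
    { αpos := hapos
      α1 := ha1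
      αdec := fun n => (hc.sp n).a1
      dio := fun n => (mul_le_mul_of_nonneg_right (min_le_left _ _) (pow_nonneg (hapos n).le _)).trans
        (hc.dio hk hdio n)
      c0 := lt_min hε one_pos
      c1 := min_le_right _ _
      t1 := by omega
      M0 := hM0
      MR := fun n => (hMs n).le
      δ0 := hδ0
      δR := fun n => by rw [hδs]; exact min_le_right _ _
      R0 := fun n => (hR0 n).le
      R1 := hR1
      RR := fun n => by
        have key : R (n + 1) ≤ 1 / (1 + η) ∨ R n ≤ 1 / (1 + η) := by
          rcases lt_or_ge (2 * al ρ (Q (n + 2)) (P (n + 2))) (al ρ (Q (n + 1)) (P (n + 1))) with h1 | h1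
          · left
            refine hRle _ _ fun w => ?_
            have h2 := (hc.sp (n + 1)).fact1 hB (hden (n + 2)) h1 w
            rw [div_mul_eq_mul_div, one_mul, le_div_iff₀ (by linarith), mul_comm]
            refine (mul_le_mul_of_nonneg_right ?_ (hmu _ _).le).trans h2
            linarith [min_le_left (Real.exp (-(2 * L))) (1 / ((1 + E) * E ^ 2))]
          · right
            refine hRle _ _ fun w => ?_
            have h3 : al ρ (Q (n + 2)) (P (n + 2)) ≤ al ρ (Q n) (P n) - al ρ (Q (n + 1)) (P (n + 1)) := by
              rw [hc.als]
              have : (1 : ℝ) ≤ a n := by exact_mod_cast hc.a1 n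
              have := le_mul_of_one_le_left (hapos (n + 1)).le this
              linarith
            have h2 := (hc.sp n).fact2 hB (hden n) (hden (n + 1)) (hc.sp (n + 1)) (hden (n + 2)) h1 h3 w
            rw [div_mul_eq_mul_div, one_mul, le_div_iff₀ (by linarith), mul_comm]
            refine (mul_le_mul_of_nonneg_right ?_ (hmu _ _).le).trans h2
            linarith [min_le_right (Real.exp (-(2 * L))) (1 / ((1 + E) * E ^ 2))]
        rcases key with e | e
        · exact (mul_le_of_le_one_right (hR0 _).le (hR1 n)).trans e
        · exact (mul_le_of_le_one_left (hR0 _).le (hR1 _)).trans e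
      θ0 := by positivity
      θ1 := by rw [div_lt_one (by linarith)]; linarith
      C10 := hKD }
  have hPmu : ∀ n x, mu F (Q n) (P n) x ≤ Ph M δ n ^ 2 := fun n x => by
    refine (hmuM n x).trans ?_
    have h1 := Real.sq_sqrt (hM0 n).le
    rw [← h1]
    exact pow_le_pow_left₀ (Real.sqrt_nonneg _) (le_add_of_nonneg_left (hδ0 n)) 2
  have hPps : ∀ n x, Real.exp |psi F (Q n) x| ≤ 1 + Ph M δ n := fun n x =>
    (hpsδ n x).trans (by have := Real.sqrt_nonneg (M n); unfold Ph; linarith)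
  obtain ⟨σ, C, hσ, hC, H⟩ := hSQ.decay (fun K hK => by
    obtain ⟨C, e, hC, he, H⟩ := hB.b10 K hK
    refine ⟨2 * C + 1, min e 1, by linarith, lt_min he one_pos, fun n hn => ?_⟩
    have hP0 := hSQ.Ph0 n
    have hP1 := hn.trans (min_le_right _ _)
    have hPe := hn.trans (min_le_left _ _)
    have b := H _ _ _ _ _ (hc.sp n) hP0 hP1 (hPmu n) (hPps n) hPe
    refine hRle n _ fun w => ?_
    have b1 := (abs_le.mp (b (G F (Q n) (P n) w))).2
    have d := (hB.h.disp (C := Real.log (1 + Ph M δ n)) (q := Q n)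
      (fun x => by rw [Real.le_log_iff_exp_le (by linarith)]; exact hPps n x) (P n) (Q n) (P n) w).1
    rw [Real.exp_log (by linarith)] at d
    change mu F (Q n) (P n) (G F (Q n) (P n) w) ≤ _ * mu F (Q n) (P n) w at d
    set Φ := Ph M δ n
    set lam := al ρ (Q (n + 1)) (P (n + 1)) / al ρ (Q n) (P n) with hlam
    have hl : 0 < lam := div_pos (hapos _) (hapos _)
    have hPK : 0 < Φ ^ K := pow_pos hP0 K
    have h1 : mu F (Q (n + 1)) (P (n + 1)) (G F (Q n) (P n) w) ≤
        (lam + C * (Φ * lam + Φ ^ K)) * mu F (Q n) (P n) (G F (Q n) (P n) w) := by linarith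
    have h2 : 0 ≤ lam + C * (Φ * lam + Φ ^ K) := by positivity
    refine h1.trans ((mul_le_mul_of_nonneg_left d h2).trans ?_)
    rw [← mul_assoc]
    refine mul_le_mul_of_nonneg_right ?_ (hmu n w).le
    have i1 : lam * C * Φ * Φ ≤ lam * C * Φ * 1 := mul_le_mul_of_nonneg_left hP1 (by positivity)
    have i2 : C * Φ ^ K * Φ ≤ C * Φ ^ K * 1 := mul_le_mul_of_nonneg_left hP1 (by positivity)
    linarith)
  exact ⟨L, Q, P, a, Ph M δ, σ, C, min ε 1, k - 1, hB, hc, hSQ.Ph0, hSQ.sum, H, hσ, hC,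
    hSQ.c0, hSQ.dio, hPmu, hPps⟩

end HY

namespace HY

structure DD (F : ℝ → ℝ) (ρ L : ℝ) (Q : ℕ → ℕ) (P : ℕ → ℤ) (a : ℕ → ℕ) (Φ y : ℕ → ℝ)
    (m T : ℕ) (A B c : ℝ) : Prop where
  hB : Bi F ρ L
  cf : CF ρ Q P a
  y0 : ∀ n, 0 < y n
  y1 : ∀ n, y n < 1
  ym : ∀ n, al ρ (Q n) (P n) = y n ^ m
  m3 : 3 ≤ m
  c0 : 0 < c
  dio : ∀ n, c * y n ^ T ≤ al ρ (Q (n + 1)) (P (n + 1))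
  Φ0 : ∀ n, 0 < Φ n
  Φ1 : ∀ n, Φ n ≤ 1
  Φy : ∀ n, Φ n ≤ B * y n ^ 2
  muΦ : ∀ n x, mu F (Q n) (P n) x ≤ Φ n ^ 2
  psΦ : ∀ n x, Real.exp |psi F (Q n) x| ≤ 1 + Φ n
  A0 : 0 < A
  B1 : 1 ≤ B
  lo : ∀ n x, A * al ρ (Q n) (P n) ≤ mu F (Q n) (P n) x
  hi : ∀ n x, mu F (Q n) (P n) x ≤ B * al ρ (Q n) (P n)
  xd : ∀ n x, |mu F (Q (n + 1)) (P (n + 1)) x / al ρ (Q (n + 1)) (P (n + 1)) -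
    mu F (Q n) (P n) x / al ρ (Q n) (P n)| ≤ B * y n ^ 2

lemma CF.shiftn {ρ : ℝ} {Q : ℕ → ℕ} {P : ℕ → ℤ} {a : ℕ → ℕ} (hc : CF ρ Q P a) (k : ℕ) :
    CF ρ (fun n => Q (n + k)) (fun n => P (n + k)) (fun n => a (n + k)) := by
  induction k with
  | zero => exact hc
  | succ k ih =>
    have := ih.shift
    simp only [Nat.add_right_comm _ 1 k] at this
    exact this

lemma mu_per {F : ℝ → ℝ} {ρ : ℝ} (h : Lift F ρ) (q : ℕ) (p : ℤ) (x : ℝ) :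
    mu F q p (x + 1) = mu F q p x := by
  have := h.fint q x 1
  rw [Int.cast_one] at this
  unfold mu G
  rw [this]; congr 1; ring

lemma mu_cont {F : ℝ → ℝ} {ρ : ℝ} (h : Lift F ρ) (q : ℕ) (p : ℤ) : Continuous (mu F q p) :=
  ((((h.itsm q).continuous).sub continuous_const).sub continuous_id).abs

section
variable {F : ℝ → ℝ} {ρ L : ℝ} {Q : ℕ → ℕ} {P : ℕ → ℤ} {a : ℕ → ℕ} {Φ : ℕ → ℝ} {σ C c : ℝ} {t : ℕ}

lemma CF.apos (hc : CF ρ Q P a) (n : ℕ) : 0 < al ρ (Q n) (P n) := (hc.sp n).a0.trans (hc.sp n).a1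
lemma CF.alt1 (hc : CF ρ Q P a) (n : ℕ) : al ρ (Q n) (P n) < 1 := by
  induction n with
  | zero => exact hc.al0
  | succ n ih => exact (hc.sp n).a1.trans ih

lemma DC.step (d : DC F ρ L Q P a Φ σ C c t) : ∃ C2 e : ℝ, 0 < C2 ∧ 0 < e ∧ ∀ n, Φ n ≤ e → ∀ x,
    |mu F (Q (n + 1)) (P (n + 1)) x / al ρ (Q (n + 1)) (P (n + 1)) -
    mu F (Q n) (P n) x / al ρ (Q n) (P n)| ≤ C2 * Φ n * (mu F (Q n) (P n) x / al ρ (Q n) (P n)) := by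
  obtain ⟨m, hm⟩ := exists_nat_gt ((t : ℝ) / σ)
  rw [div_lt_iff₀ d.σ0] at hm
  obtain ⟨C1, e, hC1, he, H⟩ := d.hB.b10 (m + 1) (by omega)
  have C0 := d.C0
  have c0 := d.c0
  refine ⟨C1 * (1 + C ^ m / c), min e 1, by positivity, lt_min he one_pos, fun n hn x => ?_⟩
  have h1 := H _ _ _ _ _ (d.cf.sp n) (d.Φ0 n) (hn.trans (min_le_right _ _)) (d.muΦ n) (d.psΦ n)
    (hn.trans (min_le_left _ _)) x
  have a0 := d.cf.apos n
  have a1 := d.cf.apos (n + 1)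
  have hlt := d.cf.alt1 n
  have hd := d.dio n
  have hμ := (d.cf.sp n).mu_pos d.hB x
  have hΦ0 := d.Φ0 n
  have hΦ := d.Φα n
  set α := al ρ (Q n) (P n)
  set β := al ρ (Q (n + 1)) (P (n + 1))
  set μ := mu F (Q n) (P n) x
  set ν := mu F (Q (n + 1)) (P (n + 1)) x
  set φ := Φ n
  have h2 : φ ^ m ≤ C ^ m / c * β := by
    calc φ ^ m ≤ (C * α ^ σ) ^ m := pow_le_pow_left₀ hΦ0.le hΦ m
      _ = C ^ m * α ^ (m * σ) := by
        rw [mul_pow, ← Real.rpow_natCast (α ^ σ), ← Real.rpow_mul a0.le, mul_comm σ]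
      _ ≤ C ^ m * α ^ t := by
        gcongr
        rw [← Real.rpow_natCast α t]
        exact Real.rpow_le_rpow_of_exponent_ge a0 hlt.le hm.le
      _ = C ^ m / c * (c * α ^ t) := by field_simp
      _ ≤ _ := by gcongr
  have h3 : |ν - β / α * μ| / β ≤ C1 * (1 + C ^ m / c) * φ * (μ / α) := by
    rw [div_le_iff₀ a1]
    refine h1.trans ?_
    have e1 : φ ^ (m + 1) ≤ C ^ m / c * β * φ := by rw [pow_succ]; gcongr
    have e2 : C ^ m / c * β * φ ≤ C ^ m / c * φ * (β / α) := by
      have : β ≤ β / α := by rw [le_div_iff₀ a0]; exact mul_le_of_le_one_right a1.le hlt.le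
      calc C ^ m / c * β * φ ≤ C ^ m / c * (β / α) * φ := by gcongr
        _ = _ := by ring
    calc C1 * (φ * (β / α) + φ ^ (m + 1)) * μ ≤ C1 * (φ * (β / α) + C ^ m / c * φ * (β / α)) * μ := by
          gcongr; linarith
      _ = _ := by ring
  refine le_trans (le_of_eq ?_) h3
  rw [← abs_of_pos a1, ← abs_div, abs_of_pos a1]
  congr 1
  field_simp

lemma DC.exDD (d : DC F ρ L Q P a Φ σ C c t) : ∃ L Q P a Φ y m T A B c,
    DD F ρ L Q P a Φ y m T A B c := by
  obtain ⟨C2, e, hC2, he, H⟩ := d.step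
  have hsum := d.Φs
  -- index
  obtain ⟨k, hk⟩ : ∃ k, ∑' n, Φ (n + k) ≤ min (1 / (2 * C2)) (min e 1) := by
    have := tendsto_sum_nat_add Φ
    have h0 : 0 < min (1 / (2 * C2)) (min e 1) := lt_min (by positivity) (lt_min he one_pos)
    exact ((this.eventually (gt_mem_nhds h0)).exists).imp fun k hk => hk.le
  have hsk : Summable fun n => Φ (n + k) := (summable_nat_add_iff k).mpr hsum
  have hΦs : ∀ n, Φ (n + k) ≤ min (1 / (2 * C2)) (min e 1) := fun n =>
    (hsk.le_tsum n fun j _ => (d.Φ0 _).le).trans hk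
  have hps : ∀ n, C2 * ∑ i ∈ Finset.range n, Φ (i + k) ≤ 1 / 2 := fun n => by
    have := ((hsk.sum_le_tsum (Finset.range n) fun j _ => (d.Φ0 _).le).trans hk).trans (min_le_left _ _)
    rw [le_div_iff₀ (by positivity)] at this
    linarith
  have hl := d.hB.h.toLift
  -- bounds at k
  obtain ⟨A, hA0, hA⟩ : ∃ A, 0 < A ∧ ∀ x, A ≤ mu F (Q k) (P k) x / al ρ (Q k) (P k) := by
    obtain ⟨x, hx⟩ := per_max (f := fun x => -mu F (Q k) (P k) x)
      (fun x => by simp only [mu_per hl]) (mu_cont hl _ _).neg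
    refine ⟨mu F (Q k) (P k) x / al ρ (Q k) (P k),
      div_pos ((d.cf.sp k).mu_pos d.hB x) (d.cf.apos k), fun y => ?_⟩
    have := hx y
    exact div_le_div_of_nonneg_right (by linarith) (d.cf.apos k).le
  obtain ⟨B, hB0, hB⟩ : ∃ B, 0 < B ∧ ∀ x, mu F (Q k) (P k) x / al ρ (Q k) (P k) ≤ B := by
    obtain ⟨x, hx⟩ := per_max (f := fun x => mu F (Q k) (P k) x)
      (fun x => by simp only [mu_per hl]) (mu_cont hl _ _)
    refine ⟨mu F (Q k) (P k) x / al ρ (Q k) (P k),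
      div_pos ((d.cf.sp k).mu_pos d.hB x) (d.cf.apos k), fun y => ?_⟩
    exact div_le_div_of_nonneg_right (hx y) (d.cf.apos k).le
  set X : ℕ → ℝ → ℝ := fun n x => mu F (Q n) (P n) x / al ρ (Q n) (P n) with hX
  have hX0 : ∀ n x, 0 < X n x := fun n x => div_pos ((d.cf.sp n).mu_pos d.hB x) (d.cf.apos n)
  have hst : ∀ n x, |X (n + 1 + k) x - X (n + k) x| ≤ C2 * Φ (n + k) * X (n + k) x := fun n x => by
    have := H (n + k) ((hΦs n).trans ((min_le_right _ _).trans (min_le_left _ _))) x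
    rw [Nat.add_right_comm n 1 k]
    exact this
  have hXlo : ∀ n x, A * (1 - C2 * ∑ i ∈ Finset.range n, Φ (i + k)) ≤ X (n + k) x := fun n x => by
    induction n with
    | zero => simpa using hA x
    | succ n ih =>
      have h1 := (abs_le.mp (hst n x)).1
      have h2 : (1 - C2 * Φ (n + k)) * X (n + k) x ≤ X (n + 1 + k) x := by linarith
      have h3 : C2 * Φ (n + k) ≤ 1 / 2 := by
        have := (hΦs n).trans (min_le_left _ _)
        rw [le_div_iff₀ (by positivity)] at this
        linarith
      have h4 := mul_le_mul_of_nonneg_left ih (by linarith : 0 ≤ 1 - C2 * Φ (n + k))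
      rw [Finset.sum_range_succ]
      have h5 : 0 ≤ A * (C2 * Φ (n + k)) * (C2 * ∑ i ∈ Finset.range n, Φ (i + k)) := by
        have := (d.Φ0 (n + k)).le
        have := Finset.sum_nonneg (s := Finset.range n) fun i _ => (d.Φ0 (i + k)).le
        positivity
      linarith
  have hXhi : ∀ n x, X (n + k) x ≤ B * Real.exp (C2 * ∑ i ∈ Finset.range n, Φ (i + k)) := fun n x => by
    induction n with
    | zero => simpa using hB x
    | succ n ih =>
      have h1 := (abs_le.mp (hst n x)).2
      have h2 : X (n + 1 + k) x ≤ (1 + C2 * Φ (n + k)) * X (n + k) x := by linarith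
      refine h2.trans ?_
      rw [Finset.sum_range_succ, mul_add, Real.exp_add, ← mul_assoc, mul_comm]
      have h6 := Real.add_one_le_exp (C2 * Φ (n + k))
      exact mul_le_mul ih (by linarith) (by have := d.Φ0 (n + k); positivity) (by positivity)
  have hlo : ∀ n x, A / 2 ≤ X (n + k) x := fun n x => by
    have := mul_le_mul_of_nonneg_left (hps n) hA0.le
    linarith [hXlo n x]
  have hhi : ∀ n x, X (n + k) x ≤ B * 3 := fun n x => by
    refine (hXhi n x).trans (mul_le_mul_of_nonneg_left ?_ hB0.le)
    have := Real.exp_le_exp.mpr ((hps n).trans (by norm_num : (1 / 2 : ℝ) ≤ 1))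
    linarith [Real.exp_one_lt_d9]
  -- choice of m
  obtain ⟨m0, hm0⟩ := exists_nat_gt (2 / σ)
  set m := max m0 3 with hm
  have hm3 : 3 ≤ m := le_max_right _ _
  have hmr : (3 : ℝ) ≤ m := by exact_mod_cast hm3
  have hmσ : 2 / (m : ℝ) ≤ σ := by
    have h1 : (m0 : ℝ) ≤ m := by exact_mod_cast le_max_left _ _
    have h2 : 2 / σ < m := by linarith
    rw [div_lt_iff₀ d.σ0] at h2
    rw [div_le_iff₀ (by linarith)]
    linarith
  set y : ℕ → ℝ := fun n => al ρ (Q (n + k)) (P (n + k)) ^ ((m : ℝ)⁻¹) with hy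
  have hy0 : ∀ n, 0 < y n := fun n => Real.rpow_pos_of_pos (d.cf.apos _) _
  have hym : ∀ n, al ρ (Q (n + k)) (P (n + k)) = y n ^ m := fun n =>
    (Real.rpow_inv_natCast_pow (d.cf.apos _).le (by omega)).symm
  have hΦy : ∀ n, Φ (n + k) ≤ C * y n ^ 2 := fun n => by
    refine (d.Φα _).trans (mul_le_mul_of_nonneg_left ?_ d.C0.le)
    have : y n ^ 2 = al ρ (Q (n + k)) (P (n + k)) ^ (2 / (m : ℝ)) := by
      simp only [hy]
      rw [← Real.rpow_natCast, ← Real.rpow_mul (d.cf.apos _).le]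
      congr 1; push_cast; ring
    rw [this]
    exact Real.rpow_le_rpow_of_exponent_ge (d.cf.apos _) (d.cf.alt1 _).le hmσ
  have C0 := d.C0
  set B' := 1 + B * 3 + C + C2 * C * (B * 3) with hB'
  have p1 : 0 ≤ C2 * C * (B * 3) := by positivity
  have cf' := d.cf.shiftn k
  refine ⟨L, fun n => Q (n + k), fun n => P (n + k), fun n => a (n + k), fun n => Φ (n + k), y, m,
    m * t, A / 2, B', c, d.hB, cf', hy0, fun n => ?_, hym, hm3, d.c0, fun n => ?_, fun n => d.Φ0 _,
    fun n => (hΦs n).trans ((min_le_right _ _).trans (min_le_right _ _)), fun n => ?_,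
    fun n => d.muΦ _, fun n => d.psΦ _, by linarith, by linarith, fun n x => ?_, fun n x => ?_,
    fun n x => ?_⟩
  · exact Real.rpow_lt_one (d.cf.apos _).le (d.cf.alt1 _) (by positivity)
  · rw [pow_mul, ← hym, Nat.add_right_comm]; exact d.dio _
  · exact (hΦy n).trans (mul_le_mul_of_nonneg_right (by linarith) (by positivity))
  · exact (le_div_iff₀ (d.cf.apos _)).mp (hlo n x)
  · refine ((div_le_iff₀ (d.cf.apos _)).mp (hhi n x)).trans ?_
    exact mul_le_mul_of_nonneg_right (by linarith) (d.cf.apos _).le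
  · refine (hst n x).trans ?_
    have h1 := hΦy n
    have h2 := hhi n x
    have y2 : 0 ≤ y n ^ 2 := by positivity
    calc C2 * Φ (n + k) * X (n + k) x ≤ C2 * (C * y n ^ 2) * (B * 3) := by
          have := hX0 (n + k) x
          gcongr
      _ = C2 * C * (B * 3) * y n ^ 2 := by ring
      _ ≤ _ := mul_le_mul_of_nonneg_right (by linarith) y2

end
end HY

namespace HY

def ds (F : ℝ → ℝ) (q : ℕ) (p : ℤ) (x : ℝ) : ℝ := G F q p x - x

lemma ds_sm {F : ℝ → ℝ} {ρ : ℝ} (h : Lift F ρ) (q : ℕ) (p : ℤ) : Sm (ds F q p) :=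
  ((h.itsm q).sub contDiff_const).sub contDiff_id

lemma ds_d {F : ℝ → ℝ} {ρ : ℝ} (h : Lift F ρ) (q : ℕ) (p : ℤ) :
    deriv (ds F q p) = fun x => deriv (F^[q]) x - 1 := by
  ext x
  exact ((h.G_has q p x).sub (hasDerivAt_id x)).deriv

lemma ds_id {F : ℝ → ℝ} {ρ : ℝ} (h : Lift F ρ) (q : ℕ) (p : ℤ) (n : ℕ) :
    iteratedDeriv (n + 2) (ds F q p) = iteratedDeriv (n + 1) (deriv (F^[q])) := by
  rw [iteratedDeriv_succ', iteratedDeriv_succ', iteratedDeriv_succ', ds_d h]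
  congr 1
  ext x
  exact deriv_sub_const _

lemma log_le2 {z : ℝ} (hz : 1 / 2 ≤ z) : |Real.log z| ≤ 2 * |z - 1| := by
  have h1 := Real.log_le_sub_one_of_pos (by linarith : 0 < z)
  have h2 := Real.one_sub_inv_le_log_of_pos (by linarith : 0 < z)
  rw [abs_le]
  have h3 := le_abs_self (z - 1)
  have h4 := abs_nonneg (z - 1)
  have h6 := neg_abs_le (z - 1)
  refine ⟨?_, by linarith⟩
  have h5 : 1 - z⁻¹ = (z - 1) / z := by field_simp
  rw [h5] at h2
  refine le_trans ?_ h2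
  rw [le_div_iff₀ (by linarith)]
  have := mul_le_mul_of_nonneg_left hz h4
  linarith

section
variable {F : ℝ → ℝ} {ρ L : ℝ} {Q : ℕ → ℕ} {P : ℕ → ℤ} {a : ℕ → ℕ} {Φ y : ℕ → ℝ} {m T : ℕ} {A B c : ℝ}

lemma DD.eta (d : DD F ρ L Q P a Φ y m T A B c) : ∃ C : ℝ, 1 ≤ C ∧
    ∀ n x, a n * |psi F (Q (n + 1)) x| ≤ C * y n := by
  have hl := d.hB.h.toLift
  have A0 := d.A0
  have B1 := d.B1
  have c0 := d.c0
  have hB0 : 0 < B := by linarith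
  obtain ⟨C1, hC1, H9⟩ := d.hB.b9 (T + 1)
  obtain ⟨C2, hC2, HI⟩ := interpg (T + 2)
  set C3 := C1 * 2 * (B / A) ^ (T + 1) with hC3
  have hC30 : 0 < C3 := by positivity
  set C4 := 2 * (C2 * (B + C3 / c)) with hC4
  have hC40 : 0 ≤ C4 := by positivity
  refine ⟨1 + C4, by linarith, fun n x => ?_⟩
  have y0 := d.y0 n
  have y1 := d.y1 n
  have ym := d.ym n
  have m3 := d.m3
  have hdp : ∀ k x, deriv (F^[Q k]) x ≤ 2 ∧ 1 / 2 ≤ deriv (F^[Q k]) x := fun k x => by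
    have h1 := d.psΦ k x
    have h2 := d.Φ1 k
    rw [← hl.exp_psi]
    constructor
    · exact (Real.exp_le_exp.mpr (le_abs_self _)).trans (by linarith)
    · have h3 := Real.exp_le_exp.mpr (neg_abs_le (psi F (Q k) x))
      rw [Real.exp_neg] at h3
      refine le_trans ?_ h3
      rw [one_div]
      exact inv_anti₀ (Real.exp_pos _) (by linarith)
  obtain ⟨i, rfl⟩ : ∃ i, m = i + 3 := ⟨m - 3, by omega⟩
  set Y := y n with hY
  set s := Y ^ (i + 2) with hs
  have hs0 : 0 < s := by positivity
  set β := al ρ (Q (n + 1)) (P (n + 1)) with hβ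
  set Λ := C3 / Y ^ ((i + 1) * (T + 1)) with hΛ
  have hD : ∀ x, |iteratedDeriv (T + 2) (ds F (Q (n + 1)) (P (n + 1))) x| ≤ Λ := fun x => by
    rw [ds_id hl]
    refine (H9 _ _ _ _ _ (d.cf.sp n) (d.Φ0 n) (d.Φ1 n) (d.muΦ n) (d.psΦ n) x (T + 1) le_rfl).trans ?_
    have hμ : Φ n / mu F (Q n) (P n) x ≤ B / A / Y ^ (i + 1) := by
      calc Φ n / mu F (Q n) (P n) x ≤ (B * Y ^ 2) / (A * Y ^ (i + 3)) := by
            refine div_le_div₀ (by positivity) (d.Φy n) (by positivity) ?_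
            rw [← ym]; exact d.lo n x
        _ = _ := by field_simp; ring
    have h0 : 0 ≤ Φ n / mu F (Q n) (P n) x := div_nonneg (d.Φ0 n).le ((d.cf.sp n).mu_pos d.hB x).le
    have h1 := pow_le_pow_left₀ h0 hμ (T + 1)
    rw [div_pow (B / A), ← pow_mul] at h1
    have h2 := (hdp (n + 1) x).1
    have h3 : C1 * deriv (F^[Q (n + 1)]) x ≤ C1 * 2 := by gcongr
    refine (mul_le_mul h3 h1 (pow_nonneg h0 _) (by positivity)).trans (le_of_eq ?_)
    rw [hΛ, hC3]; ring
  have h1 := HI _ (ds_sm hl (Q (n + 1)) (P (n + 1))) s (B * β) Λ hs0 (d.hi (n + 1)) hD 1 (by omega) x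
  rw [iteratedDeriv_one, ds_d hl, pow_one] at h1
  have h2 : Λ * s ^ (T + 2) ≤ C3 / c * β := by
    have e : Λ * s ^ (T + 2) = C3 * (Y ^ (i + 3) * Y ^ T) := by
      rw [hΛ, hs]; field_simp; ring
    rw [e]
    calc C3 * (Y ^ (i + 3) * Y ^ T) ≤ C3 * (1 * Y ^ T) := by
          gcongr; exact pow_le_one₀ y0.le y1.le
      _ = C3 / c * (c * Y ^ T) := by field_simp
      _ ≤ _ := by gcongr; exact d.dio n
  have h3 : |deriv (F^[Q (n + 1)]) x - 1| * s ≤ C2 * (B + C3 / c) * β := by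
    refine h1.trans ?_
    rw [mul_assoc]
    refine mul_le_mul_of_nonneg_left ?_ hC2
    linarith
  have h4 : |psi F (Q (n + 1)) x| * s ≤ C4 * β := by
    have := mul_le_mul_of_nonneg_right (log_le2 (hdp (n + 1) x).2) hs0.le
    change |psi F (Q (n + 1)) x| * s ≤ _ at this
    rw [hC4]; linarith
  have h5 : a n * β ≤ Y ^ (i + 3) := by
    rw [← ym]
    have := d.cf.als n
    have := d.cf.apos (n + 2)
    linarith
  have h6 : (a n * |psi F (Q (n + 1)) x|) * s ≤ (C4 * Y) * s := by
    calc (a n * |psi F (Q (n + 1)) x|) * s = a n * (|psi F (Q (n + 1)) x| * s) := by ring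
      _ ≤ a n * (C4 * β) := by gcongr
      _ = C4 * (a n * β) := by ring
      _ ≤ C4 * Y ^ (i + 3) := by gcongr
      _ = (C4 * Y) * s := by rw [hs]; ring
  have h7 := le_of_mul_le_mul_right h6 hs0
  linarith

end
end HY

namespace HY

/-- crude bound for a composition with a map close to the identity -/
lemma comp_crude {φ f : ℝ → ℝ} (hφ : Sm φ) (hf : Sm f) {x A N : ℝ} (n : ℕ) (hN : 0 < N)
    (hA : ∀ i ≤ n, |iteratedDeriv i φ (f x)| ≤ A * N ^ i)
    (hD : ∀ i < n, |iteratedDeriv i (deriv f) x| ≤ 2 * N ^ i) :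
    |iteratedDeriv n (fun z => φ (f z)) x| ≤ n.factorial * 2 ^ n * (A * N ^ n) := by
  rcases Nat.eq_zero_or_pos n with rfl | hn
  · simpa using hA 0 le_rfl
  refine (comp_bound hf hφ hn hN (fun i _ hi => hA i hi) (D := 2 * N) fun i h1 hi => ?_).trans
    (le_of_eq (by ring))
  obtain ⟨k, rfl⟩ : ∃ k, i = k + 1 := ⟨i - 1, by omega⟩
  rw [iteratedDeriv_succ']
  have h2 := mul_le_mul_of_nonneg_left (hD k (by omega)) hN.le
  refine h2.trans ?_
  rw [mul_pow]
  have : (2 : ℝ) ≤ 2 ^ (k + 1) := by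
    rw [pow_succ]
    have : (1 : ℝ) ≤ 2 ^ k := one_le_pow₀ (by norm_num)
    linarith
  calc N * (2 * N ^ k) = 2 * N ^ (k + 1) := by ring
    _ ≤ _ := by gcongr

lemma comp_d {φ f : ℝ → ℝ} (hφ : Sm φ) (hf : Sm f) :
    deriv (fun z => φ (f z)) = fun z => deriv f z * deriv φ (f z) := by
  ext z
  exact (((hφ.has (f z)).comp z (hf.has z)).deriv).trans (mul_comm _ _)

lemma comp_lead (n : ℕ) : ∃ C : ℝ, 0 ≤ C ∧ ∀ φ f : ℝ → ℝ, Sm φ → Sm f → ∀ x A κ N : ℝ, 0 ≤ A →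
    0 < N → 0 ≤ κ → κ ≤ 1 → (∀ i, 1 ≤ i → i ≤ n → |iteratedDeriv i φ (f x)| ≤ A * N ^ i) →
    |deriv f x - 1| ≤ κ → (∀ i, 1 ≤ i → i < n → |iteratedDeriv i (deriv f) x| ≤ κ * N ^ i) →
    |iteratedDeriv n (fun z => φ (f z)) x| ≤
      (1 + κ) ^ n * |iteratedDeriv n φ (f x)| + C * A * κ * N ^ n := by
  induction n with
  | zero =>
    refine ⟨0, le_rfl, fun φ f _ _ x A κ N _ _ _ _ _ _ _ => ?_⟩
    simp
  | succ n ih =>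
    obtain ⟨C, hC, H⟩ := ih
    set C' : ℝ := 2 ^ n * (n.factorial * 2 ^ n) with hC'
    refine ⟨2 * C + C', by positivity, fun φ f hφ hf x A κ N hA hN hκ hκ1 hφb hf1 hfb => ?_⟩
    have hf2 : |deriv f x| ≤ 1 + κ := by
      have := abs_add_le (deriv f x - 1) 1
      rw [sub_add_cancel, abs_one] at this
      linarith
    have hfD : ∀ i < n + 1, |iteratedDeriv i (deriv f) x| ≤ 2 * N ^ i := fun i hi => by
      rcases Nat.eq_zero_or_pos i with rfl | h0
      · simp; linarith
      · refine (hfb i h0 hi).trans ?_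
        gcongr; linarith
    have hφd : ∀ i ≤ n, |iteratedDeriv i (deriv φ) (f x)| ≤ A * N * N ^ i := fun i hi => by
      have := hφb (i + 1) (by omega) (by omega)
      rw [iteratedDeriv_succ'] at this
      exact this.trans (le_of_eq (by ring))
    have hlead := H (deriv φ) f hφ.d hf x (A * N) κ N (by positivity) hN hκ hκ1
      (fun i _ hi => hφd i hi) hf1 (fun i h1 hi => hfb i h1 (by omega))
    have hcr : ∀ j ≤ n, |iteratedDeriv j (fun z => deriv φ (f z)) x| ≤
        n.factorial * 2 ^ n * (A * N * N ^ j) := fun j hj => by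
      refine (comp_crude hφ.d hf j hN (fun i hi => hφd i (by omega)) fun i hi => hfD i (by omega)).trans ?_
      have h1 : (j.factorial : ℝ) ≤ n.factorial := by exact_mod_cast Nat.factorial_le hj
      have h2 : (2 : ℝ) ^ j ≤ 2 ^ n := pow_le_pow_right₀ (by norm_num) hj
      gcongr
    have hsm : Sm (fun z => deriv φ (f z)) := hφ.d.comp hf
    rw [iteratedDeriv_succ', comp_d hφ hf,
      show (fun z => deriv f z * deriv φ (f z)) = deriv f * (fun z => deriv φ (f z)) from rfl,
      iteratedDeriv_mul (hf.d.at n x) (hsm.at n x), Finset.sum_range_succ']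
    refine (abs_add_le _ _).trans ?_
    have e0 : |((n.choose 0 : ℕ) : ℝ) * iteratedDeriv 0 (deriv f) x *
        iteratedDeriv (n - 0) (fun z => deriv φ (f z)) x| ≤
        (1 + κ) ^ (n + 1) * |iteratedDeriv (n + 1) φ (f x)| + 2 * C * A * κ * N ^ (n + 1) := by
      rw [Nat.choose_zero_right, Nat.cast_one, one_mul, iteratedDeriv_zero, Nat.sub_zero, abs_mul,
        iteratedDeriv_succ']
      refine (mul_le_mul hf2 hlead (abs_nonneg _) (by linarith)).trans ?_
      have p : 0 ≤ C * (A * N) * κ * N ^ n := by positivity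
      have := mul_le_mul_of_nonneg_right hκ1 p
      rw [pow_succ, pow_succ]
      linarith
    have e1 : |∑ k ∈ Finset.range n, ((n.choose (k + 1) : ℕ) : ℝ) * iteratedDeriv (k + 1) (deriv f) x *
        iteratedDeriv (n - (k + 1)) (fun z => deriv φ (f z)) x| ≤ C' * A * κ * N ^ (n + 1) := by
      refine (Finset.abs_sum_le_sum_abs _ _).trans ?_
      have hb : ∑ k ∈ Finset.range n, ((n.choose (k + 1) : ℕ) : ℝ) ≤ 2 ^ n := by
        have e : (2 : ℝ) ^ n = ∑ i ∈ Finset.range (n + 1), ((n.choose i : ℕ) : ℝ) := by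
          exact_mod_cast (Nat.sum_range_choose n).symm
        rw [e, Finset.sum_range_succ']
        simp
      have hs : ∀ k ∈ Finset.range n, |((n.choose (k + 1) : ℕ) : ℝ) * iteratedDeriv (k + 1) (deriv f) x *
        iteratedDeriv (n - (k + 1)) (fun z => deriv φ (f z)) x| ≤ ((n.choose (k + 1) : ℕ) : ℝ) *
          (n.factorial * 2 ^ n * A * κ * N ^ (n + 1)) := fun k hk => by
        have hk' := Finset.mem_range.mp hk
        rw [abs_mul, abs_mul, Nat.abs_cast, mul_assoc]
        refine mul_le_mul_of_nonneg_left ?_ (Nat.cast_nonneg _)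
        refine (mul_le_mul (hfb (k + 1) (by omega) (by omega)) (hcr (n - (k + 1)) (by omega))
          (abs_nonneg _) (by positivity)).trans (le_of_eq ?_)
        have : N ^ (n + 1) = N ^ (k + 1) * (N ^ (n - (k + 1)) * N) := by
          rw [← pow_succ, ← pow_add]; congr 1; omega
        rw [this]; ring
      refine (Finset.sum_le_sum hs).trans ?_
      rw [← Finset.sum_mul]
      refine (mul_le_mul_of_nonneg_right hb (by positivity)).trans (le_of_eq ?_)
      rw [hC']; ring
    linarith

end HY

namespace HY

lemma near_id (r : ℕ) : ∃ K : ℝ, 1 ≤ K ∧ ∀ (F : ℝ → ℝ) (ρ : ℝ), Lift F ρ → ∀ (l : ℕ) (ε N : ℝ),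
    0 < N → 0 < ε → K * ε ≤ 1 → (∀ x, |psi F l x| ≤ ε ^ (r + 2)) →
    (∀ x, |iteratedDeriv (r + 2) (psi F l) x| ≤ N ^ (r + 2)) → ∀ x,
    |deriv (F^[l]) x - 1| ≤ K * ε ∧
    ∀ i, 1 ≤ i → i < r + 2 → |iteratedDeriv i (deriv (F^[l])) x| ≤ K * ε * N ^ i := by
  obtain ⟨C, hC, HI⟩ := interpg (r + 2)
  obtain ⟨C', hC', HE⟩ := expbound r 1 le_rfl
  set K1 := 2 ^ r * (3 * C') with hK1
  have hK10 : 0 < K1 := by positivity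
  refine ⟨1 + (K1 + 2) * (1 + 2 * C), by nlinarith, fun F ρ h l ε N hN hε hKε h0 hR x => ?_⟩
  set κ := (1 + 2 * C) * ε with hκ
  have hκ0 : 0 < κ := by positivity
  have hKκ : (1 + (K1 + 2) * (1 + 2 * C)) * ε = ε + (K1 + 2) * κ := by rw [hκ]; ring
  rw [hKκ] at hKε ⊢
  have pK : 0 < K1 * κ := by positivity
  have hκ1 : κ ≤ 1 := by linarith
  have hε1 : ε ≤ 1 := by linarith
  have hps : ∀ j < r + 2, |iteratedDeriv j (psi F l) x| ≤ κ * N ^ j := fun j hj => by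
    have h1 := HI _ (h.psism l) (ε / N) (ε ^ (r + 2)) (N ^ (r + 2)) (by positivity) h0 hR j hj.le x
    have e1 : N ^ (r + 2) * (ε / N) ^ (r + 2) = ε ^ (r + 2) := by
      rw [← mul_pow, mul_div_cancel₀ _ hN.ne']
    rw [e1, div_pow, ← mul_div_assoc, div_le_iff₀ (by positivity)] at h1
    have e2 : ε ^ (r + 2) ≤ ε * ε ^ j := by
      rw [← pow_succ']
      exact pow_le_pow_of_le_one hε.le hε1 (by omega)
    have e3 : C * (ε ^ (r + 2) + ε ^ (r + 2)) * N ^ j ≤ (κ * N ^ j) * ε ^ j := by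
      calc C * (ε ^ (r + 2) + ε ^ (r + 2)) * N ^ j ≤ C * (ε * ε ^ j + ε * ε ^ j) * N ^ j := by gcongr
        _ = (2 * C * ε) * N ^ j * ε ^ j := by ring
        _ ≤ _ := by gcongr; linarith
    exact le_of_mul_le_mul_right (h1.trans e3) (by positivity)
  have hp0 : |psi F l x| ≤ κ := by simpa using hps 0 (by omega)
  have hd3 : deriv (F^[l]) x ≤ 3 := by
    rw [← h.exp_psi]
    have := Real.exp_le_exp.mpr ((le_abs_self _).trans (hp0.trans hκ1))
    linarith [Real.exp_one_lt_d9]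
  have hv0 := h.dpos l x
  have hu : ∀ j ≤ r, |iteratedDeriv j (uu F l) x| ≤ κ * N * N ^ j := fun j hj => by
    have := hps (j + 1) (by omega)
    rw [iteratedDeriv_succ'] at this
    exact this.trans (le_of_eq (by ring))
  have hde : deriv (deriv (F^[l])) = fun y => uu F l y * deriv (F^[l]) y := by
    ext z
    exact (h.d_has l z).deriv
  have hv := HE (uu F l) (deriv (F^[l])) (h.usm l) (h.dsm l) hde x N hN.le (fun j hj => by
    refine (hu j hj).trans ?_
    calc κ * N * N ^ j ≤ 1 * N * N ^ j := by gcongr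
      _ = _ := by ring)
  rw [abs_of_pos hv0] at hv
  refine ⟨?_, fun i h1 hi => ?_⟩
  · rw [← h.exp_psi]
    have := Real.abs_exp_sub_one_le (hp0.trans hκ1)
    linarith
  · obtain ⟨j, rfl⟩ : ∃ j, i = j + 1 := ⟨i - 1, by omega⟩
    rw [iteratedDeriv_succ', hde]
    refine (mul_bound (h.usm l) (h.dsm l) (E := N) (A := κ * N) (B := 3 * C')
      (fun k hk => hu k (by omega)) fun k hk => ?_).trans ?_
    · refine (hv k (by omega)).trans ?_
      rw [mul_comm 3 C']
      gcongr
    · have e : (2 : ℝ) ^ j ≤ 2 ^ r := pow_le_pow_right₀ (by norm_num) (by omega)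
      calc (2 : ℝ) ^ j * (κ * N * (3 * C') * N ^ j) ≤ 2 ^ r * (κ * N * (3 * C') * N ^ j) := by gcongr
        _ = (K1 * κ) * N ^ (j + 1) := by rw [hK1]; ring
        _ ≤ _ := by gcongr; linarith

lemma growth (r : ℕ) : ∃ e : ℝ, 0 < e ∧ ∀ (F : ℝ → ℝ) (ρ : ℝ), Lift F ρ → ∀ (q q' a : ℕ) (W : ℝ),
    1 ≤ a → 1 ≤ W → (∀ x, a * |psi F q' x| ≤ e) → (∀ x, |psi F q x| ≤ 1) →
    (∀ x, |iteratedDeriv (r + 2) (psi F q) x| ≤ W) →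
    (∀ x, |iteratedDeriv (r + 2) (psi F q') x| ≤ W) →
    ∀ x, |iteratedDeriv (r + 2) (psi F (q + a * q')) x| ≤ 8 * a * W := by
  obtain ⟨K, hK, HN⟩ := near_id r
  obtain ⟨C, hC, HI⟩ := interpg (r + 2)
  obtain ⟨D, hD, HL⟩ := comp_lead (r + 2)
  set ε := 1 / (K * (2 * (r + 2) + 4 * D * C + 1)) with hε
  have hε0 : 0 < ε := by positivity
  set κ := K * ε with hκ
  have hκ0 : 0 < κ := by positivity
  have hκe : κ * (2 * (r + 2) + 4 * D * C + 1) = 1 := by rw [hκ, hε]; field_simp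
  have hDC : 0 ≤ κ * (D * C) := by positivity
  have hr0 : 0 ≤ κ * r := by positivity
  have hκ1 : κ ≤ 1 := by linarith
  have hκ2 : (1 + κ) ^ (r + 2) ≤ 2 := by
    have h1 := Real.add_one_le_exp κ
    have h2 := pow_le_pow_left₀ (by linarith : 0 ≤ 1 + κ) (by linarith : 1 + κ ≤ Real.exp κ) (r + 2)
    rw [← Real.exp_nat_mul] at h2
    refine h2.trans ?_
    have h3 : ((r + 2 : ℕ) : ℝ) * κ ≤ 1 / 2 := by push_cast; linarith
    have h4 := Real.exp_le_exp.mpr h3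
    have h5 := Real.exp_bound_div_one_sub_of_interval (x := 1 / 2) (by norm_num) (by norm_num)
    norm_num at h5
    linarith
  have hκ3 : 4 * (D * C * κ) ≤ 1 := by linarith
  have hε1 : ε ≤ 1 := by
    have := le_mul_of_one_le_left hε0.le hK
    linarith
  refine ⟨ε ^ (r + 2), by positivity, fun F ρ h q q' a W ha hW hq' hq hRq hRq' => ?_⟩
  have ha' : (1 : ℝ) ≤ a := by exact_mod_cast ha
  have ha0 : (0 : ℝ) < a := by linarith
  have hW0 : 0 < W := by linarith
  set N := (4 * a * W) ^ (((r + 2 : ℕ) : ℝ)⁻¹) with hN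
  have hN0 : 0 < N := Real.rpow_pos_of_pos (by positivity) _
  have hNR : N ^ (r + 2) = 4 * a * W := Real.rpow_inv_natCast_pow (by positivity) (by omega)
  clear_value N
  have hεp : ε ^ (r + 2) ≤ 1 := pow_le_one₀ hε0.le hε1
  have hWN : W * (1 / N) ^ (r + 2) = 1 / (4 * a) := by
    rw [div_pow, hNR, one_pow]; field_simp
  -- coefficient bounds
  have hA1 : ∀ x, ∀ i ≤ r + 2, |iteratedDeriv i (psi F q') x| ≤ (2 * C / a) * N ^ i := fun x i hi => by
    have h1 := HI _ (h.psism q') (1 / N) (1 / a) W (by positivity)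
      (fun x => by rw [le_div_iff₀ ha0, mul_comm]; exact (hq' x).trans hεp) hRq' i hi x
    rw [hWN, div_pow, one_pow, mul_one_div, div_le_iff₀ (by positivity)] at h1
    refine h1.trans (mul_le_mul_of_nonneg_right ?_ (by positivity))
    have : 1 / (4 * (a : ℝ)) ≤ 1 / a := one_div_le_one_div_of_le ha0 (by linarith)
    calc C * (1 / a + 1 / (4 * (a : ℝ))) ≤ C * (1 / a + 1 / a) := by gcongr
      _ = _ := by ring
  have hA2 : ∀ x, ∀ i ≤ r + 2, |iteratedDeriv i (psi F q) x| ≤ (2 * C) * N ^ i := fun x i hi => by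
    have h1 := HI _ (h.psism q) (1 / N) 1 W (by positivity) hq hRq i hi x
    rw [hWN, div_pow, one_pow, mul_one_div, div_le_iff₀ (by positivity)] at h1
    refine h1.trans (mul_le_mul_of_nonneg_right ?_ (by positivity))
    have : 1 / (4 * (a : ℝ)) ≤ 1 := by rw [div_le_one (by positivity)]; linarith
    calc C * (1 + 1 / (4 * (a : ℝ))) ≤ C * (1 + 1) := by gcongr
      _ = _ := by ring
  have hsmall : ∀ i ≤ a, ∀ x, |psi F (i * q') x| ≤ ε ^ (r + 2) := fun i hi x => by
    have key : |psi F (i * q') x| ≤ i * (ε ^ (r + 2) / a) := by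
      clear hi
      induction i with
      | zero => simp [psi]
      | succ i ih =>
        rw [Nat.succ_mul, Nat.add_comm, h.psi_add]
        refine (abs_add_le _ _).trans ?_
        have : |psi F q' (F^[i * q'] x)| ≤ ε ^ (r + 2) / a := by
          rw [le_div_iff₀ ha0, mul_comm]; exact hq' _
        push_cast
        linarith
    refine key.trans ?_
    have : (i : ℝ) ≤ a := by exact_mod_cast hi
    calc (i : ℝ) * (ε ^ (r + 2) / a) ≤ a * (ε ^ (r + 2) / a) := by gcongr
      _ = _ := by field_simp
  have hadd : ∀ b l x, iteratedDeriv (r + 2) (psi F (b + l)) x =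
      iteratedDeriv (r + 2) (fun z => psi F b (F^[l] z)) x + iteratedDeriv (r + 2) (psi F l) x := by
    intro b l x
    have e : psi F (b + l) = (fun z => psi F b (F^[l] z)) + psi F l := by
      ext z; exact h.psi_add b l z
    have s1 : Sm (fun z => psi F b (F^[l] z)) := (h.psism b).comp (h.itsm l)
    have s2 : Sm (psi F l) := h.psism l
    rw [e, iteratedDeriv_add (s1.at _ x) (s2.at _ x)]
  have hit : ∀ i ≤ a, ∀ x, |iteratedDeriv (r + 2) (psi F (i * q')) x| ≤ 4 * i * W := fun i => by
    induction i with
    | zero =>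
      intro _ x
      have e : psi F (0 * q') = fun _ => 0 := by ext z; simp [psi]
      rw [e, iteratedDeriv_const]; simp
    | succ i ih =>
      intro hi x
      have ih' := ih (by omega)
      have hiN : ∀ x, |iteratedDeriv (r + 2) (psi F (i * q')) x| ≤ N ^ (r + 2) := fun x => by
        refine (ih' x).trans ?_
        rw [hNR]
        have : (i : ℝ) ≤ a := by exact_mod_cast (by omega : i ≤ a)
        gcongr
      obtain ⟨n1, n2⟩ := HN F ρ h (i * q') ε N hN0 hε0 hκ1 (hsmall i (by omega)) hiN x
      have hl := HL (psi F q') (F^[i * q']) (h.psism q') (h.itsm _) x (2 * C / a) κ N (by positivity)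
        hN0 hκ0.le hκ1 (fun j _ hj => hA1 _ j hj) n1 n2
      rw [show (i + 1) * q' = q' + i * q' by ring, hadd]
      refine (abs_add_le _ _).trans ?_
      have e1 : D * (2 * C / a) * κ * N ^ (r + 2) ≤ 2 * W := by
        rw [hNR]
        have : D * (2 * C / a) * κ * (4 * a * W) = 2 * (4 * (D * C * κ)) * W := by field_simp
        rw [this]
        have := mul_le_mul_of_nonneg_right hκ3 hW0.le
        linarith
      have e2 := mul_le_mul hκ2 (hRq' (F^[i * q'] x)) (abs_nonneg _) zero_le_two
      have := ih' x
      push_cast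
      linarith
  intro x
  obtain ⟨n1, n2⟩ := HN F ρ h (a * q') ε N hN0 hε0 hκ1 (hsmall a le_rfl) (fun x => by
    rw [hNR]; exact hit a le_rfl x) x
  have hl := HL (psi F q) (F^[a * q']) (h.psism q) (h.itsm _) x (2 * C) κ N (by positivity)
    hN0 hκ0.le hκ1 (fun j _ hj => hA2 _ j hj) n1 n2
  rw [hadd]
  refine (abs_add_le _ _).trans ?_
  have haW : W ≤ a * W := le_mul_of_one_le_left hW0.le ha'
  have e1 : D * (2 * C) * κ * N ^ (r + 2) ≤ 2 * (a * W) := by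
    rw [hNR]
    have := mul_le_mul_of_nonneg_right hκ3 (by positivity : 0 ≤ a * W)
    linarith
  have e2 := mul_le_mul hκ2 (hRq (F^[a * q'] x)) (abs_nonneg _) zero_le_two
  have := hit a le_rfl x
  linarith

end HY

namespace HY

section
variable {F : ℝ → ℝ} {ρ L : ℝ} {Q : ℕ → ℕ} {P : ℕ → ℤ} {a : ℕ → ℕ} {Φ y : ℕ → ℝ} {m T : ℕ} {A B c : ℝ}

lemma CF.al2 (hc : CF ρ Q P a) (n : ℕ) : 2 ^ n * al ρ (Q n) (P n) ^ 2 ≤ 2 := by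
  induction n using Nat.twoStepInduction with
  | zero =>
    have := pow_le_one₀ (n := 2) (hc.apos 0).le (hc.alt1 0).le
    linarith
  | one =>
    have := pow_le_one₀ (n := 2) (hc.apos 1).le (hc.alt1 1).le
    linarith
  | more n ih _ =>
    have h1 := hc.als n
    have h2 : (1 : ℝ) ≤ a n := by exact_mod_cast hc.a1 n
    have h3 := le_mul_of_one_le_left (hc.apos (n + 1)).le h2
    have h4 := (hc.sp (n + 1)).a1
    have h5 : 2 * al ρ (Q (n + 2)) (P (n + 2)) ≤ al ρ (Q n) (P n) := by
      simp only [Nat.add_assoc, Nat.reduceAdd] at h4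
      linarith
    have h6 := pow_le_pow_left₀ (by linarith [hc.apos (n + 2)]) h5 2
    have h7 := mul_le_mul_of_nonneg_left h6 (by positivity : (0 : ℝ) ≤ 2 ^ n)
    refine le_trans (le_of_eq ?_) (h7.trans ih)
    ring

lemma CF.pa (hc : CF ρ Q P a) (n : ℕ) :
    (∏ i ∈ Finset.range n, (a i : ℝ)) * al ρ (Q n) (P n) ≤ 1 := by
  induction n with
  | zero => simpa using (hc.alt1 0).le
  | succ n ih =>
    refine le_trans ?_ ih
    rw [Finset.prod_range_succ, mul_assoc]
    have h1 := hc.als n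
    have h2 := hc.apos (n + 2)
    refine mul_le_mul_of_nonneg_left (by linarith) (Finset.prod_nonneg fun i _ => Nat.cast_nonneg _)

lemma DD.ysum (d : DD F ρ L Q P a Φ y m T A B c) : Summable y := by
  have m3 := d.m3
  set θ : ℝ := (1 / 2) ^ (((2 * m : ℕ) : ℝ)⁻¹) with hθ
  have hθ0 : 0 ≤ θ := Real.rpow_nonneg (by norm_num) _
  have hm : 0 < 2 * m := by omega
  have hθ1 : θ < 1 := Real.rpow_lt_one (by norm_num) (by norm_num) (by positivity)
  have hθm : θ ^ (2 * m) = 1 / 2 := Real.rpow_inv_natCast_pow (by norm_num) (by omega)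
  refine Summable.of_nonneg_of_le (fun n => (d.y0 n).le) (fun n => ?_)
    ((summable_geometric_of_lt_one hθ0 hθ1).mul_left 2)
  have h1 := d.cf.al2 n
  rw [d.ym, ← pow_mul, mul_comm m 2] at h1
  rw [← pow_le_pow_iff_left₀ (d.y0 n).le (by positivity) hm.ne', mul_pow, ← pow_mul, mul_comm n,
    pow_mul θ, hθm]
  have h2 : (2 : ℝ) ≤ 2 ^ (2 * m) := by
    calc (2 : ℝ) = 2 ^ 1 := by norm_num
      _ ≤ _ := pow_le_pow_right₀ (by norm_num) (by omega)
  have h3 : y n ^ (2 * m) ≤ 2 * (1 / 2) ^ n := by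
    rw [one_div, inv_pow, ← div_eq_mul_inv, le_div_iff₀ (by positivity)]
    linarith
  exact h3.trans (mul_le_mul_of_nonneg_right h2 (by positivity))

lemma DD.psi1 (d : DD F ρ L Q P a Φ y m T A B c) (n : ℕ) (x : ℝ) : |psi F (Q n) x| ≤ 1 := by
  have h1 := d.psΦ n x
  have h2 := d.Φ1 n
  have h3 := Real.add_one_le_exp |psi F (Q n) x|
  linarith

lemma DD.T_bound (d : DD F ρ L Q P a Φ y m T A B c) (r : ℕ) : ∃ W : ℝ, 1 ≤ W ∧
    ∀ n x, |iteratedDeriv (r + 2) (psi F (Q n)) x| ≤ W / al ρ (Q n) (P n) ^ 7 := by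
  have hl := d.hB.h.toLift
  obtain ⟨e, he, H⟩ := growth r
  obtain ⟨C, hC, hη⟩ := d.eta
  obtain ⟨n0, hn0⟩ : ∃ n0, ∀ n ≥ n0, C * y n ≤ e := by
    have h1 : Tendsto (fun n => C * y n) atTop (nhds (C * 0)) :=
      d.ysum.tendsto_atTop_zero.const_mul C
    rw [mul_zero] at h1
    obtain ⟨n0, h⟩ := (h1.eventually (gt_mem_nhds he)).exists_forall_of_atTop
    exact ⟨n0, fun n hn => (h n hn).le⟩
  have hex : ∀ n, ∃ A, 1 ≤ A ∧ ∀ x, |iteratedDeriv (r + 2) (psi F (Q n)) x| ≤ A := fun n => by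
    obtain ⟨A, h1, h2⟩ := per_idb (hl.psism (Q n)) (hl.psiper (Q n)) (r + 2)
    exact ⟨A, h1, h2 _ le_rfl⟩
  choose A' hA1 hA' using hex
  set W0 : ℝ := 1 + ∑ i ∈ Finset.range (n0 + 2), A' i with hW0
  have hA0 : ∀ n, 0 ≤ A' n := fun n => by linarith [hA1 n]
  have hW01 : 1 ≤ W0 := by
    have := Finset.sum_nonneg (s := Finset.range (n0 + 2)) fun i _ => hA0 i
    linarith
  have hW0n : ∀ n < n0 + 2, A' n ≤ W0 := fun n hn => by
    have := Finset.single_le_sum (f := A') (fun i _ => hA0 i) (Finset.mem_range.mpr hn)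
    linarith
  set W : ℕ → ℝ := fun n => W0 * (8 ^ n * ∏ i ∈ Finset.range n, (a i : ℝ)) with hW
  have hWs : ∀ n, W (n + 1) = 8 * a n * W n := fun n => by
    simp only [hW]; rw [Finset.prod_range_succ]; ring
  have ha : ∀ n, (1 : ℝ) ≤ a n := fun n => by exact_mod_cast d.cf.a1 n
  have hWW : ∀ n, W0 ≤ W n := fun n => by
    induction n with
    | zero => simp [hW]
    | succ n ih =>
      rw [hWs]
      have h1 := ha n
      have : 1 * W n ≤ 8 * a n * W n := mul_le_mul_of_nonneg_right (by linarith) (by linarith)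
      linarith
  have key : ∀ n, (∀ x, |iteratedDeriv (r + 2) (psi F (Q n)) x| ≤ W n) ∧
      ∀ x, |iteratedDeriv (r + 2) (psi F (Q (n + 1))) x| ≤ W n := fun n => by
    induction n with
    | zero => exact ⟨fun x => (hA' 0 x).trans ((hW0n _ (by omega)).trans (hWW 0)),
        fun x => (hA' 1 x).trans ((hW0n _ (by omega)).trans (hWW 0))⟩
    | succ n ih =>
      have hmono : W n ≤ W (n + 1) := by
        rw [hWs]
        have h1 := ha n
        have := hWW n
        have : 1 * W n ≤ 8 * a n * W n := mul_le_mul_of_nonneg_right (by linarith) (by linarith)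
        linarith
      refine ⟨fun x => (ih.2 x).trans hmono, fun x => ?_⟩
      rcases Nat.lt_or_ge n n0 with hn | hn
      · exact (hA' _ x).trans ((hW0n _ (by omega)).trans (hWW _))
      · have := H F ρ hl (Q n) (Q (n + 1)) (a n) (W n) (d.cf.a1 n) (hW01.trans (hWW n))
          (fun x => (hη n x).trans (hn0 n hn)) (d.psi1 n) ih.1 ih.2 x
        rw [hWs, show n + 1 + 1 = n + 2 from rfl, d.cf.Qs n]
        exact this
  refine ⟨8 * W0, by linarith, fun n x => ((key n).1 x).trans ?_⟩
  have a0 := d.cf.apos n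
  rw [le_div_iff₀ (by positivity)]
  have h1 := d.cf.al2 n
  have h2 := d.cf.pa n
  have h3 := pow_le_pow_left₀ (by positivity) h1 3
  set α := al ρ (Q n) (P n)
  have e1 : W n * α ^ 7 = W0 * ((2 ^ n * α ^ 2) ^ 3 * ((∏ i ∈ Finset.range n, (a i : ℝ)) * α)) := by
    simp only [hW]
    have : (8 : ℝ) ^ n = (2 ^ n) ^ 3 := by rw [← pow_mul, mul_comm, pow_mul]; norm_num
    rw [this]; ring
  rw [e1]
  have h4 : (2 ^ n * α ^ 2) ^ 3 * ((∏ i ∈ Finset.range n, (a i : ℝ)) * α) ≤ 2 ^ 3 * 1 :=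
    mul_le_mul h3 h2 (mul_nonneg (Finset.prod_nonneg fun i _ => Nat.cast_nonneg _) a0.le) (by norm_num)
  have := mul_le_mul_of_nonneg_left h4 (by linarith : 0 ≤ W0)
  linarith

/-- bound on high derivatives of the displacement -/
lemma ds_bound (r : ℕ) : ∃ C : ℝ, 1 ≤ C ∧ ∀ (F : ℝ → ℝ) (ρ : ℝ), Lift F ρ → ∀ (q : ℕ) (p : ℤ) (W : ℝ),
    1 ≤ W → (∀ x, |psi F q x| ≤ 1) → (∀ x, |iteratedDeriv (r + 2) (psi F q) x| ≤ W) →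
    ∀ x, |iteratedDeriv (r + 3) (ds F q p) x| ≤ C * W := by
  obtain ⟨C, hC, HI⟩ := interpg (r + 2)
  obtain ⟨C', hC', HE⟩ := expbound (r + 1) (1 + 2 * C) (by linarith)
  refine ⟨C' * 3, by linarith, fun F ρ h q p W hW h1 hR x => ?_⟩
  set N := W ^ (((r + 2 : ℕ) : ℝ)⁻¹) with hN
  have hN0 : 0 < N := Real.rpow_pos_of_pos (by positivity) _
  have hNR : N ^ (r + 2) = W := Real.rpow_inv_natCast_pow (by positivity) (by omega)
  clear_value N
  have hWN : W * (1 / N) ^ (r + 2) = 1 := by rw [div_pow, hNR, one_pow]; field_simp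
  have hA : ∀ i ≤ r + 2, |iteratedDeriv i (psi F q) x| ≤ (1 + 2 * C) * N ^ i := fun i hi => by
    have h1 := HI _ (h.psism q) (1 / N) 1 W (by positivity) h1 hR i hi x
    rw [hWN, div_pow, one_pow, mul_one_div, div_le_iff₀ (by positivity)] at h1
    exact h1.trans (mul_le_mul_of_nonneg_right (by linarith) (by positivity))
  have hde : deriv (deriv (F^[q])) = fun y => uu F q y * deriv (F^[q]) y := by
    ext z
    exact (h.d_has q z).deriv
  have hv := HE (uu F q) (deriv (F^[q])) (h.usm q) (h.dsm q) hde x N hN0.le (fun j hj => by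
    have := hA (j + 1) (by omega)
    rwa [iteratedDeriv_succ'] at this) (r + 2) le_rfl
  have hd3 : deriv (F^[q]) x ≤ 3 := by
    rw [← h.exp_psi]
    have := Real.exp_le_exp.mpr ((le_abs_self _).trans (h1 x))
    linarith [Real.exp_one_lt_d9]
  rw [abs_of_pos (h.dpos q x), hNR] at hv
  rw [ds_id h]
  refine hv.trans ?_
  gcongr

end
end HY

namespace HY

lemma SPair.sgn {F : ℝ → ℝ} {ρ L : ℝ} (hB : Bi F ρ L) {q q' : ℕ} {p p' : ℤ}
    (hp : SPair ρ q p q' p') : ∃ s : ℝ, |s| = 1 ∧ ∀ x, mu F q p x = s * ds F q p x := by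
  rcases hp with hp | hp
  · exact ⟨1, by simp, fun x => by rw [hp.mu_eq hB.h.toLift, ds, one_mul]⟩
  · refine ⟨-1, by simp, fun x => ?_⟩
    rw [← mu_rf, hp.mu_eq hB.h'.toLift, rf_G, neg_neg, ds]; ring

noncomputable def XX (F : ℝ → ℝ) (ρ : ℝ) (q : ℕ) (p : ℤ) (x : ℝ) : ℝ := mu F q p x / al ρ q p

section
variable {F : ℝ → ℝ} {ρ L : ℝ} {Q : ℕ → ℕ} {P : ℕ → ℤ} {a : ℕ → ℕ} {Φ y : ℕ → ℝ} {m T : ℕ} {A B c : ℝ}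

lemma DD.XX_eq (d : DD F ρ L Q P a Φ y m T A B c) (n : ℕ) : ∃ s : ℝ, |s| = 1 ∧
    XX F ρ (Q n) (P n) = fun x => (s / al ρ (Q n) (P n)) * ds F (Q n) (P n) x := by
  obtain ⟨s, hs, h⟩ := SPair.sgn d.hB (d.cf.sp n)
  refine ⟨s, hs, ?_⟩
  ext x
  rw [XX, h]; ring

lemma DD.XX_sm (d : DD F ρ L Q P a Φ y m T A B c) (n : ℕ) : Sm (XX F ρ (Q n) (P n)) := by
  obtain ⟨s, hs, h⟩ := d.XX_eq n
  rw [h]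
  exact contDiff_const.mul (ds_sm d.hB.h.toLift _ _)

lemma DD.XX_b (d : DD F ρ L Q P a Φ y m T A B c) (r : ℕ) : ∃ K : ℝ, 0 ≤ K ∧
    ∀ n x, |iteratedDeriv (r + 3) (XX F ρ (Q n) (P n)) x| ≤ K / al ρ (Q n) (P n) ^ 8 := by
  obtain ⟨W, hW, h1⟩ := d.T_bound r
  obtain ⟨C, hC, h2⟩ := ds_bound r
  refine ⟨C * W, by positivity, fun n x => ?_⟩
  have a0 := d.cf.apos n
  have a1 := d.cf.alt1 n
  obtain ⟨s, hs, e⟩ := d.XX_eq n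
  have h3 : 1 ≤ W / al ρ (Q n) (P n) ^ 7 := by
    rw [le_div_iff₀ (by positivity)]
    have := pow_le_one₀ (n := 7) a0.le a1.le
    linarith
  have h4 := h2 F ρ d.hB.h.toLift (Q n) (P n) _ h3 (d.psi1 n) (h1 n) x
  rw [e, iteratedDeriv_const_mul_field, abs_mul, abs_div, hs, abs_of_pos a0]
  refine (mul_le_mul_of_nonneg_left h4 (by positivity)).trans (le_of_eq ?_)
  field_simp

lemma DD.Del_b (d : DD F ρ L Q P a Φ y m T A B c) (j : ℕ) : ∃ K : ℝ, 0 ≤ K ∧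
    ∀ n x, |iteratedDeriv j (XX F ρ (Q (n + 1)) (P (n + 1)) - XX F ρ (Q n) (P n)) x| ≤ K * y n := by
  have hB1 := d.B1
  have h0 : ∀ n x, |(XX F ρ (Q (n + 1)) (P (n + 1)) - XX F ρ (Q n) (P n)) x| ≤ B * y n ^ 2 :=
    fun n x => d.xd n x
  rcases Nat.eq_zero_or_pos j with rfl | hj
  · refine ⟨B, by linarith, fun n x => ?_⟩
    rw [iteratedDeriv_zero]
    refine (h0 n x).trans (mul_le_mul_of_nonneg_left ?_ (by linarith))
    have := mul_le_mul_of_nonneg_left (d.y1 n).le (d.y0 n).le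
    rw [pow_two]; linarith
  obtain ⟨K, hK, hX⟩ := d.XX_b (j * (8 * T + 2))
  obtain ⟨C, hC, HI⟩ := interpg (j * (8 * T + 2) + 3)
  have hc := d.c0
  refine ⟨C * (B + 2 * K / c ^ 8), by positivity, fun n x => ?_⟩
  have y0 := d.y0 n
  have y1 := d.y1 n
  set w := y n ^ ((j : ℝ)⁻¹) with hw
  have w0 : 0 < w := Real.rpow_pos_of_pos y0 _
  have w1 : w ≤ 1 := Real.rpow_le_one y0.le y1.le (by positivity)
  have wj : w ^ j = y n := Real.rpow_inv_natCast_pow y0.le (by omega)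
  clear_value w
  have b0 := d.cf.apos (n + 1)
  have hb := (d.cf.sp n).a1
  have hΛ : ∀ x, |iteratedDeriv (j * (8 * T + 2) + 3)
      (XX F ρ (Q (n + 1)) (P (n + 1)) - XX F ρ (Q n) (P n)) x| ≤ 2 * K / c ^ 8 / y n ^ (8 * T) := by
    intro x
    rw [iteratedDeriv_sub ((d.XX_sm _).at _ _) ((d.XX_sm _).at _ _)]
    refine (abs_sub _ _).trans ((add_le_add (hX _ _) (hX _ _)).trans ?_)
    have h1 : K / al ρ (Q n) (P n) ^ 8 ≤ K / al ρ (Q (n + 1)) (P (n + 1)) ^ 8 := by gcongr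
    have h2 : K / al ρ (Q (n + 1)) (P (n + 1)) ^ 8 ≤ K / (c * y n ^ T) ^ 8 := by
      have := d.dio n
      gcongr
    have h3 : 2 * K / c ^ 8 / y n ^ (8 * T) = 2 * (K / (c * y n ^ T) ^ 8) := by
      rw [mul_pow, ← pow_mul, mul_comm T 8]; field_simp
    rw [h3]; linarith
  have h1 := HI _ ((d.XX_sm (n + 1)).sub (d.XX_sm n)) w _ _ w0 (h0 n) hΛ j
    (by nlinarith) x
  have h2 : w ^ (j * (8 * T + 2) + 3) ≤ y n ^ (8 * T) * y n ^ 2 := by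
    rw [pow_add, pow_mul, wj, ← pow_add]
    exact mul_le_of_le_one_right (by positivity) (pow_le_one₀ w0.le w1)
  have h3 : 2 * K / c ^ 8 / y n ^ (8 * T) * w ^ (j * (8 * T + 2) + 3) ≤ 2 * K / c ^ 8 * y n ^ 2 := by
    refine (mul_le_mul_of_nonneg_left h2 (by positivity)).trans (le_of_eq ?_)
    field_simp
  rw [wj] at h1
  have h4 := mul_le_mul_of_nonneg_left (add_le_add_right h3 (B * y n ^ 2)) hC
  refine le_of_mul_le_mul_right (h1.trans (h4.trans (le_of_eq ?_))) y0
  ring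

lemma DD.exY (d : DD F ρ L Q P a Φ y m T A B c) : ∃ Y : ℝ → ℝ, Sm Y ∧ (∀ x, 0 < Y x) ∧
    (∀ x, Y (x + 1) = Y x) ∧ ∀ x, Y (F x) = deriv F x * Y x := by
  have h := d.hB.h.toLift
  choose K hK0 hK using d.Del_b
  set X : ℕ → ℝ → ℝ := fun n => XX F ρ (Q n) (P n) with hX
  set f : ℕ → ℝ → ℝ := fun n => X (n + 1) - X n with hf
  have hfs : ContDiff ℝ (⊤ : ℕ∞) fun x => ∑' i, f i x := by
    refine contDiff_tsum (v := fun k n => K k * y n) (fun i => (d.XX_sm _).sub (d.XX_sm _))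
      (fun k _ => d.ysum.mul_left _) (fun k i x _ => ?_)
    rw [norm_iteratedFDeriv_eq_norm_iteratedDeriv]
    exact hK k i x
  have hsum : ∀ x, Summable fun n => f n x := fun x => by
    refine Summable.of_norm_bounded (d.ysum.mul_left (K 0)) fun n => ?_
    have := hK 0 n x
    rwa [iteratedDeriv_zero] at this
  set Y : ℝ → ℝ := fun x => X 0 x + ∑' i, f i x with hY
  have hlim : ∀ x, Tendsto (fun n => X n x) atTop (nhds (Y x)) := fun x => by
    have h1 := (hsum x).hasSum.tendsto_sum_nat
    have h2 := h1.const_add (X 0 x)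
    refine h2.congr fun n => ?_
    have : ∑ i ∈ Finset.range n, f i x = X n x - X 0 x :=
      Finset.sum_range_sub (fun i => X i x) n
    rw [this]; ring
  have hpos : ∀ x, 0 < Y x := fun x => by
    refine lt_of_lt_of_le d.A0 (ge_of_tendsto (hlim x) (Eventually.of_forall fun n => ?_))
    simp only [hX, XX]
    rw [le_div_iff₀ (d.cf.apos n)]
    exact d.lo n x
  refine ⟨Y, (d.XX_sm 0).add hfs, hpos, fun x => ?_, fun x => ?_⟩
  · refine tendsto_nhds_unique (hlim (x + 1)) ((hlim x).congr fun n => ?_)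
    simp only [hX, XX, mu_per h]
  · have h1 : Tendsto (fun n => X n (F x) / X n x) atTop (nhds (Y (F x) / Y x)) :=
      (hlim (F x)).div (hlim x) (hpos x).ne'
    have hmu : ∀ n, 0 < mu F (Q n) (P n) x := fun n => (d.cf.sp n).mu_pos d.hB x
    have hne : ∀ n, G F (Q n) (P n) x ≠ x := fun n e => by
      have := hmu n
      rw [mu, e, sub_self, abs_zero] at this
      exact lt_irrefl _ this
    have hG : Tendsto (fun n => G F (Q n) (P n) x) atTop (nhds x) := by
      rw [tendsto_iff_norm_sub_tendsto_zero]
      have hy : Tendsto (fun n => B * y n) atTop (nhds 0) := by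
        simpa using d.ysum.tendsto_atTop_zero.const_mul B
      refine squeeze_zero (fun n => norm_nonneg _) (fun n => ?_) hy
      refine (d.hi n x).trans (mul_le_mul_of_nonneg_left ?_ (by linarith [d.B1]))
      rw [d.ym]
      exact pow_le_of_le_one (d.y0 n).le (d.y1 n).le (by have := d.m3; omega)
    have hG' : Tendsto (fun n => G F (Q n) (P n) x) atTop (nhdsWithin x {x}ᶜ) :=
      tendsto_nhdsWithin_iff.mpr ⟨hG, Eventually.of_forall hne⟩
    have h2 := ((hasDerivAt_iff_tendsto_slope.mp (Sm.has h.sm x)).comp hG').abs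
    rw [abs_of_pos (h.pos x)] at h2
    have h3 : Y (F x) / Y x = deriv F x := by
      refine tendsto_nhds_unique h1 (h2.congr fun n => ?_)
      have a0 := d.cf.apos n
      have m0 := hmu n
      have e : G F (Q n) (P n) (F x) = F (G F (Q n) (P n) x) := by
        have := h.GG_comm (Q n) (P n) 1 0 x
        simpa [G] using this
      simp only [hX, XX, Function.comp, slope_def_field]
      rw [div_div_div_cancel_right₀ a0.ne', abs_div, mu, mu, e]
    rw [← h3]
    field_simp [(hpos x).ne']

end
end HY

namespace HY

lemma conj_of_Y {F : ℝ → ℝ} {ρ : ℝ} (h : Lift F ρ) {Y : ℝ → ℝ} (hY : Sm Y) (hpos : ∀ x, 0 < Y x)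
    (hper : ∀ x, Y (x + 1) = Y x) (hinv : ∀ x, Y (F x) = deriv F x * Y x) :
    ∃ H : ℝ → ℝ, ContDiff ℝ (⊤ : ℕ∞) H ∧ (∀ x : ℝ, H (x + 1) = H x + 1) ∧
      (∀ x : ℝ, 0 < deriv H x) ∧ ∀ x : ℝ, H (F x) = H x + ρ := by
  set g : ℝ → ℝ := fun x => (Y x)⁻¹ with hg
  have gs : Sm g := hY.inv fun x => (hpos x).ne'
  have gc : Continuous g := gs.continuous
  have g0 : ∀ x, 0 < g x := fun x => inv_pos.mpr (hpos x)
  set J : ℝ → ℝ := fun x => ∫ t in (0 : ℝ)..x, g t with hJ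
  have Jd : ∀ x, HasDerivAt J (g x) x := fun x =>
    intervalIntegral.integral_hasDerivAt_right (gc.intervalIntegrable _ _)
      gc.stronglyMeasurable.stronglyMeasurableAtFilter gc.continuousAt
  have J0 : J 0 = 0 := intervalIntegral.integral_same
  have Js : Sm J := by
    refine contDiff_infty_iff_deriv.mpr ⟨fun x => (Jd x).differentiableAt, ?_⟩
    rw [show deriv J = g from funext fun x => (Jd x).deriv]
    exact gs
  have const : ∀ u : ℝ → ℝ, (∀ x, HasDerivAt u 0 x) → ∀ x, u x = u 0 := fun u hu x =>
    is_const_of_deriv_eq_zero (fun x => (hu x).differentiableAt) (fun x => (hu x).deriv) x 0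
  have Jm : StrictMono J := strictMono_of_deriv_pos fun x => by rw [(Jd x).deriv]; exact g0 x
  have κ0 : 0 < J 1 := by rw [← J0]; exact Jm one_pos
  have Jp : ∀ x, J (x + 1) = J x + J 1 := fun x => by
    have := const (fun x => J (x + 1) - J x) (fun x => by
      have h1 := ((Jd (x + 1)).comp_add_const x 1).sub (Jd x)
      have e : g (x + 1) - g x = 0 := by simp only [hg, hper, sub_self]
      rwa [e] at h1) x
    simp only [zero_add, J0] at this
    linarith
  have JF : ∀ x, J (F x) = J x + J (F 0) := fun x => by
    have := const (fun x => J (F x) - J x) (fun x => by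
      have h1 := ((Jd (F x)).comp x (Sm.has h.sm x)).sub (Jd x)
      have e : g (F x) * deriv F x - g x = 0 := by
        have h2 := (hpos x).ne'
        have h3 := (h.pos x).ne'
        simp only [hg, hinv]
        field_simp
        ring
      rwa [e] at h1) x
    simp only [J0] at this
    linarith
  set H : ℝ → ℝ := fun x => (J 1)⁻¹ * J x with hH
  set c := (J 1)⁻¹ * J (F 0) with hc
  have HF : ∀ x, H (F x) = H x + c := fun x => by
    simp only [hH, hc]; rw [JF]; ring
  have Hp : ∀ x, H (x + 1) = H x + 1 := fun x => by
    simp only [hH]; rw [Jp]; field_simp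
  have Hs : Sm H := contDiff_const.mul Js
  have Hit : ∀ n : ℕ, H (F^[n] 0) = n * c := fun n => by
    induction n with
    | zero => simp [hH, J0]
    | succ n ih => rw [Function.iterate_succ_apply', HF, ih]; push_cast; ring
  have hcρ : c = ρ := by
    obtain ⟨M, -, hM⟩ := per_bdd (f := fun x => H x - x)
      (fun x => by rw [Hp]; ring) (Hs.continuous.sub continuous_id)
    have h1 : Tendsto (fun n : ℕ => c - F^[n] 0 / n) atTop (nhds 0) := by
      refine squeeze_zero_norm' ?_ (tendsto_const_div_atTop_nhds_zero_nat M)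
      filter_upwards [eventually_gt_atTop 0] with n hn
      have hn' : (0 : ℝ) < n := by exact_mod_cast hn
      have h2 := hM (F^[n] 0)
      simp only [Hit] at h2
      rw [Real.norm_eq_abs, le_div_iff₀ hn', ← abs_of_pos hn', ← abs_mul, abs_of_pos hn', sub_mul,
        div_mul_cancel₀ _ hn'.ne', mul_comm]
      exact h2
    have h2 := h.rot.const_sub c
    have := tendsto_nhds_unique h1 h2
    linarith
  refine ⟨H, Hs, Hp, fun x => ?_, fun x => by rw [HF, hcρ]⟩
  rw [((Jd x).const_mul (J 1)⁻¹).deriv]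
  exact mul_pos (inv_pos.mpr κ0) (g0 x)

end HY

theorem herman_linearization_diophantine
    (F : ℝ → ℝ) (hsm : ContDiff ℝ (⊤ : ℕ∞) F)
    (hper : ∀ x : ℝ, F (x + 1) = F x + 1)
    (hderiv : ∀ x : ℝ, 0 < deriv F x)
    (ρ : ℝ) (hρ : Tendsto (fun n : ℕ => F^[n] 0 / n) atTop (nhds ρ))
    (hdio : ∃ k : ℕ, 2 ≤ k ∧ ∃ ε : ℝ, 0 < ε ∧
      ∀ p : ℤ, ∀ q : ℕ, 1 ≤ q → ε / (q : ℝ) ^ k < |ρ - (p : ℝ) / (q : ℝ)|) :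
    ∃ H : ℝ → ℝ, ContDiff ℝ (⊤ : ℕ∞) H ∧ (∀ x : ℝ, H (x + 1) = H x + 1) ∧
      (∀ x : ℝ, 0 < deriv H x) ∧ ∀ x : ℝ, H (F x) = H x + ρ := by
  obtain ⟨k, hk, ε, hε, hd⟩ := hdio
  have irr : Irrational ρ := by
    rintro ⟨r, hr⟩
    have h1 := hd r.num r.den r.pos
    have h2 : ((r.num : ℝ) / (r.den : ℝ)) = ρ := by rw [← hr]; exact_mod_cast Rat.num_div_den r
    rw [h2, sub_self, abs_zero] at h1
    have : 0 ≤ ε / (r.den : ℝ) ^ k := by positivity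
    linarith
  have h : HY.Lift F ρ := ⟨hsm, hper, hderiv, hρ, irr⟩
  obtain ⟨L, Q, P, a, Φ, σ, C, c, t, d⟩ := h.exDC hk hε hd
  obtain ⟨L, Q, P, a, Φ, y, m, T, A, B, c, d⟩ := d.exDD
  obtain ⟨Y, h1, h2, h3, h4⟩ := d.exY
  exact HY.conj_of_Y h h1 h2 h3 h4
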